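/- Every 3-planar finite simple graph G on n ≥ 2 vertices can be drawn in the plane with at most (33·n − 66)/5 crossings; in particular, cr(G) ≤ (33·n − 66)/5. -/

import Mathlib

open unitInterval

/-- A (good) drawing of a simple graph in the plane: vertices map to distinct
points, each edge is drawn as a simple continuous arc between its endpoints,
arcs avoid vertex points other than their endpoints, two arcs meet in finitely
many points, and no three arcs pass through a common interior point. -/
structure PlaneDrawing {V : Type*} (G : SimpleGraph V) where
  pos : V → ℝ × ℝ
  pos_inj : Function.Injective pos
  arc : ∀ ⦃u v : V⦄, G.Adj u v → Path (pos u) (pos v)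
  arc_symm : ∀ ⦃u v : V⦄ (h : G.Adj u v), arc h.symm = (arc h).symm
  arc_inj : ∀ ⦃u v : V⦄ (h : G.Adj u v), Function.Injective (arc h)
  no_vertex_mem : ∀ ⦃u v : V⦄ (h : G.Adj u v) (w : V) (t : I),
      arc h t = pos w → w = u ∨ w = v
  finite_inter : ∀ ⦃u v x y : V⦄ (h₁ : G.Adj u v) (h₂ : G.Adj x y),
      s(u, v) ≠ s(x, y) →
      (Set.range (arc h₁) ∩ Set.range (arc h₂)).Finite
  no_triple_point : ∀ ⦃u₁ v₁ u₂ v₂ u₃ v₃ : V⦄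
      (h₁ : G.Adj u₁ v₁) (h₂ : G.Adj u₂ v₂) (h₃ : G.Adj u₃ v₃),
      s(u₁, v₁) ≠ s(u₂, v₂) → s(u₁, v₁) ≠ s(u₃, v₃) → s(u₂, v₂) ≠ s(u₃, v₃) →
      ∀ t₁ t₂ t₃ : I, t₁ ≠ 0 → t₁ ≠ 1 → t₂ ≠ 0 → t₂ ≠ 1 → t₃ ≠ 0 → t₃ ≠ 1 →
      arc h₁ t₁ = arc h₂ t₂ → arc h₂ t₂ = arc h₃ t₃ → False

namespace PlaneDrawing

variable {V : Type*} {G : SimpleGraph V} (D : PlaneDrawing G)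

/-- `p` is an interior point of the arc of the edge `uv`. -/
def IsInteriorPoint {u v : V} (h : G.Adj u v) (p : ℝ × ℝ) : Prop :=
  ∃ t : I, t ≠ 0 ∧ t ≠ 1 ∧ D.arc h t = p

/-- The set of crossing points of the drawing: points where the interiors of
the arcs of two distinct edges meet. -/
def crossings : Set (ℝ × ℝ) :=
  {p | ∃ (u v x y : V) (h₁ : G.Adj u v) (h₂ : G.Adj x y),
    s(u, v) ≠ s(x, y) ∧ D.IsInteriorPoint h₁ p ∧ D.IsInteriorPoint h₂ p}

/-- The number of crossings of the drawing. -/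
noncomputable def crossingCount : ℕ := D.crossings.ncard

/-- The set of crossing points lying on the edge `uv`. -/
def edgeCrossings {u v : V} (h : G.Adj u v) : Set (ℝ × ℝ) :=
  {p | D.IsInteriorPoint h p ∧
    ∃ (x y : V) (h₂ : G.Adj x y), s(u, v) ≠ s(x, y) ∧ D.IsInteriorPoint h₂ p}

/-- A drawing is `k`-plane if every edge is involved in at most `k` crossings. -/
def IsKPlane (k : ℕ) : Prop :=
  ∀ ⦃u v : V⦄ (h : G.Adj u v), (D.edgeCrossings h).ncard ≤ k

end PlaneDrawing

/-- The crossing number of a graph: the minimum number of crossings over all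
drawings. -/
noncomputable def crossingNumber {V : Type*} (G : SimpleGraph V) : ℕ :=
  sInf {c : ℕ | ∃ D : PlaneDrawing G, D.crossingCount = c}

/-- A graph is `k`-planar if it admits a drawing in which every edge is
involved in at most `k` crossings. -/
def KPlanar {V : Type*} (G : SimpleGraph V) (k : ℕ) : Prop :=
  ∃ D : PlaneDrawing G, D.IsKPlane k

/-- `G` has no cycle of length `ℓ`. -/
def HasNoCycleOfLength {V : Type*} (G : SimpleGraph V) (ℓ : ℕ) : Prop :=
  ∀ (v : V) (c : G.Walk v v), c.IsCycle → c.length ≠ ℓ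

/-- A combinatorial map recording the planarization of a drawing: darts `Δ`, edge reversal `α`,
face permutation `φ`, and the predicate `R` saying that the tail of a dart is a vertex of the
graph rather than a crossing.  The fields are the local properties of an optimal drawing in which
every edge has at most three crossings. -/
structure CrossMap (Δ : Type*) where
  α : Equiv.Perm Δ
  φ : Equiv.Perm Δ
  R : Δ → Prop
  inv : ∀ d, α (α d) = d
  tail : ∀ d, R (φ (α d)) ↔ R d
  four : ∀ d, ¬ R d → φ (α (φ (α (φ (α (φ (α d))))))) = d
  three : ∀ x, ¬ R x → ¬ R (φ x) → R (φ (φ (α (φ x)))) ∨ R (φ.symm (α (φ.symm x)))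
  loopless : ∀ d, φ d ≠ d
  digon : ∀ d, φ (φ d) = d → R d ∧ R (φ d)
  noAT : ∀ y, ¬ R y → ¬ R (φ y) → R (φ (φ y)) → φ (φ (φ y)) = y →
    ¬ (φ (φ (φ (α y))) = α y ∧ ¬ R (α y) ∧ ¬ R (φ (α y)) ∧ ¬ R (φ (φ (α y))))
  noAQT : ∀ y, ¬ R y → ¬ R (φ y) → R (φ (φ y)) → φ (φ (φ y)) = y →
    (φ (φ (φ (φ (α y)))) = α y ∧ ¬ R (α y) ∧ ¬ R (φ (α y)) ∧ ¬ R (φ (φ (α y))) ∧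
      ¬ R (φ (φ (φ (α y))))) → ∀ z, z = α (φ (φ (α y))) →
    ¬ (φ (φ (φ z)) = z ∧ ¬ R z ∧ ¬ R (φ z) ∧ ¬ R (φ (φ z)))
  noAQA : ∀ y, ¬ R y → ¬ R (φ y) → R (φ (φ y)) → φ (φ (φ y)) = y →
    (φ (φ (φ (φ (α y)))) = α y ∧ ¬ R (α y) ∧ ¬ R (φ (α y)) ∧ ¬ R (φ (φ (α y))) ∧
      ¬ R (φ (φ (φ (α y))))) → ∀ z, z = α (φ (φ (α y))) →
    ¬ (φ (φ (φ z)) = z ∧ ¬ R z ∧ ¬ R (φ z) ∧ R (φ (φ z)))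
  noAQQA : ∀ y, ¬ R y → ¬ R (φ y) → R (φ (φ y)) → φ (φ (φ y)) = y →
    (φ (φ (φ (φ (α y)))) = α y ∧ ¬ R (α y) ∧ ¬ R (φ (α y)) ∧ ¬ R (φ (φ (α y))) ∧
      ¬ R (φ (φ (φ (α y))))) → ∀ z, z = α (φ (φ (α y))) →
    (φ (φ (φ (φ z))) = z ∧ ¬ R z ∧ ¬ R (φ z) ∧ ¬ R (φ (φ z)) ∧
      ¬ R (φ (φ (φ z)))) → ∀ w, w = α (φ (φ z)) →
    ¬ (φ (φ (φ w)) = w ∧ ¬ R w ∧ ¬ R (φ w) ∧ R (φ (φ w)))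

/-- Sum of `F` over the cycle of `φ` through `x`. -/
noncomputable def Equiv.Perm.cycleSum {Δ M : Type*} [AddCommMonoid M] (φ : Equiv.Perm Δ)
    (F : Δ → M) (x : Δ) : M :=
  ∑ i ∈ Finset.range (Function.minimalPeriod φ x), F (φ^[i] x)

namespace Equiv.Perm

variable {Δ M : Type*} [AddCommMonoid M] (φ : Equiv.Perm Δ)

theorem minimalPeriod_pos_of_fintype [Finite Δ] (x : Δ) : 0 < Function.minimalPeriod φ x :=
  Function.minimalPeriod_pos_of_mem_periodicPts
    (Function.Injective.mem_periodicPts φ.injective x)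

open Classical in
theorem cycleSum_eq_sum_filter [Fintype Δ] (F : Δ → M) (x : Δ) :
    φ.cycleSum F x = ∑ y with φ.SameCycle x y, F y := by
  have hinj : Set.InjOn (fun i => φ^[i] x) (Finset.range (Function.minimalPeriod φ x)) := by
    intro i hi j hj h
    exact Function.iterate_injOn_Iio_minimalPeriod (by simpa using hi) (by simpa using hj) h
  rw [cycleSum, ← Finset.sum_image (f := F) hinj]
  congr 1
  ext y
  simp only [Finset.mem_image, Finset.mem_range, Finset.mem_filter, Finset.mem_univ, true_and]
  constructor
  · rintro ⟨i, -, rfl⟩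
    exact ⟨i, by simp [← Equiv.Perm.iterate_eq_pow]⟩
  · intro h
    obtain ⟨i, hi⟩ := h.exists_nat_pow_eq
    refine ⟨i % Function.minimalPeriod φ x, Nat.mod_lt _ (minimalPeriod_pos_of_fintype φ x), ?_⟩
    rw [Function.iterate_mod_minimalPeriod_eq, ← hi, Equiv.Perm.iterate_eq_pow]

theorem cycleSum_congr_sameCycle [Fintype Δ] (F : Δ → M) {x y : Δ} (h : φ.SameCycle x y) :
    φ.cycleSum F x = φ.cycleSum F y := by
  classical
  rw [cycleSum_eq_sum_filter, cycleSum_eq_sum_filter]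
  congr 1
  ext z
  simp only [Finset.mem_filter, Finset.mem_univ, true_and]
  exact ⟨fun h' => h.symm.trans h', fun h' => h.trans h'⟩

theorem cycleSum_iterate [Fintype Δ] (F : Δ → M) (x : Δ) (i : ℕ) :
    φ.cycleSum F (φ^[i] x) = φ.cycleSum F x :=
  (cycleSum_congr_sameCycle φ F ⟨i, by simp [← Equiv.Perm.iterate_eq_pow]⟩).symm

theorem cycleSum_comp [Fintype Δ] (F : Δ → M) (x : Δ) :
    φ.cycleSum (fun y => F (φ y)) x = φ.cycleSum F x := by
  have h := cycleSum_iterate φ F x 1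
  rw [← h]
  unfold cycleSum
  have : Function.minimalPeriod φ (φ^[1] x) = Function.minimalPeriod φ x :=
    Function.minimalPeriod_apply (Function.Injective.mem_periodicPts φ.injective x)
  rw [this]
  refine Finset.sum_congr rfl fun i _ => ?_
  rw [← Function.iterate_add_apply, Function.iterate_succ_apply']

theorem mul_card_le_sum [Fintype Δ] (F : Δ → ℤ) (c : ℤ) (h : ∀ x, c ≤ φ.cycleSum F x) :
    c * Nat.card (Quotient (Equiv.Perm.SameCycle.setoid φ)) ≤ ∑ x, F x := by
  classical
  let π : Δ → Quotient (Equiv.Perm.SameCycle.setoid φ) := Quotient.mk _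
  have : ∑ x, F x = ∑ q : Quotient (Equiv.Perm.SameCycle.setoid φ), ∑ x with π x = q, F x :=
    (Finset.sum_fiberwise _ _ _).symm
  rw [this, Nat.card_eq_fintype_card, mul_comm, ← Finset.card_univ, ← nsmul_eq_mul]
  refine Finset.card_nsmul_le_sum _ _ _ fun q _ => ?_
  induction q using Quotient.inductionOn with
  | _ x =>
    refine (h x).trans_eq ?_
    rw [cycleSum_eq_sum_filter]
    refine Finset.sum_congr (Finset.filter_congr fun y _ => ?_) fun _ _ => rfl
    constructor
    · intro h; exact Quotient.sound (s := Equiv.Perm.SameCycle.setoid φ) h.symm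
    · intro h; exact (Quotient.exact (s := Equiv.Perm.SameCycle.setoid φ) h).symm

end Equiv.Perm

namespace CrossMap

variable {Δ : Type*} (M : CrossMap Δ)

/-- Both ends of the dart are crossings. -/
def IsInt (d : Δ) : Prop := ¬ M.R d ∧ ¬ M.R (M.φ d)

/-- The face of the dart is a triangle all of whose corners are crossings. -/
def IsTri (x : Δ) : Prop :=
  M.φ (M.φ (M.φ x)) = x ∧ ¬ M.R x ∧ ¬ M.R (M.φ x) ∧ ¬ M.R (M.φ (M.φ x))

/-- The face of the dart is a quadrilateral all of whose corners are crossings. -/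
def IsQuad (x : Δ) : Prop :=
  M.φ (M.φ (M.φ (M.φ x))) = x ∧ ¬ M.R x ∧ ¬ M.R (M.φ x) ∧ ¬ M.R (M.φ (M.φ x)) ∧
    ¬ M.R (M.φ (M.φ (M.φ x)))

/-- The dart is the side opposite to the unique vertex in a triangular face with two crossings. -/
def IsBase (x : Δ) : Prop :=
  M.φ (M.φ (M.φ x)) = x ∧ ¬ M.R x ∧ ¬ M.R (M.φ x) ∧ M.R (M.φ (M.φ x))

/-- The face of the dart is a triangle with exactly one vertex. -/
def IsCorner (x : Δ) : Prop := M.IsBase x ∨ M.IsBase (M.φ x) ∨ M.IsBase (M.φ.symm x)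

/-- The dart joins two crossings and is preceded and followed in its face by two vertices. -/
def Flank (d : Δ) : Prop :=
  M.IsInt d ∧ M.R (M.φ.symm d) ∧ M.R (M.φ (M.φ d)) ∧ M.φ (M.φ (M.φ d)) ≠ d

/-- Some side of the triangle of `t` is flanked on its other side. -/
def HasFlank (t : Δ) : Prop :=
  M.Flank (M.α t) ∨ M.Flank (M.α (M.φ t)) ∨ M.Flank (M.α (M.φ (M.φ t)))

/-- The dart joins two crossings and exactly one of its neighbours in its face is a vertex. -/
def OneInt (d : Δ) : Prop :=
  M.IsInt d ∧ (M.R (M.φ.symm d) ∧ ¬ M.R (M.φ (M.φ d)) ∨ ¬ M.R (M.φ.symm d) ∧ M.R (M.φ (M.φ d)))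

/-- The dart leads from a vertex to a crossing or conversely, and its triangle-side neighbour at
the crossing leads to a vertex. -/
def IsTip (d : Δ) : Prop :=
  (M.R d ∧ ¬ M.R (M.φ d) ∧ M.R (M.φ (M.φ d))) ∨ (¬ M.R d ∧ M.R (M.φ d) ∧ M.R (M.φ.symm d))

open Classical in
/-- Initial charge contributed by a dart to its face. -/
noncomputable def charge (d : Δ) : ℤ :=
  if M.R d then (if M.R (M.φ d) then 33 else 39) else (if M.R (M.φ d) then 6 else 15)

open Classical in
/-- Charge sent across a side joining two crossings. -/
noncomputable def across (d : Δ) : ℤ :=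
  if M.IsInt d ∧ M.IsTri (M.α d) then
    (if M.Flank d then 21 else if ¬ M.HasFlank (M.α d) ∧ M.OneInt d then 7 else 0)
  else if M.IsInt d ∧ M.IsQuad (M.α d) then
    (if M.Flank d then 6 else if M.IsBase d ∨ M.IsTri d ∨ M.IsQuad d then 0 else 3)
  else 0

open Classical in
/-- Charge sent through a quadrilateral. -/
noncomputable def through (d : Δ) : ℤ := if M.Flank d ∧ M.IsQuad (M.α d) then 6 else 0

open Classical in
/-- Charge sent to a triangle with one vertex. -/
noncomputable def tipCharge (d : Δ) : ℤ := if M.IsTip d ∧ M.IsCorner (M.α d) then 6 else 0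

/-- The dart on the far side of a quadrilateral behind `d`. -/
def strip : Equiv.Perm Δ := M.α * M.φ * M.φ * M.α

/-- Charge of a dart after discharging. -/
noncomputable def net (d : Δ) : ℤ :=
  M.charge d - M.across d - M.through d - M.tipCharge d
    + M.across (M.α d) + M.through (M.strip.symm d) + M.tipCharge (M.α d)

theorem across_nonneg (d : Δ) : 0 ≤ M.across d := by unfold across; split_ifs <;> norm_num
theorem through_nonneg (d : Δ) : 0 ≤ M.through d := by unfold through; split_ifs <;> norm_num
theorem tipCharge_nonneg (d : Δ) : 0 ≤ M.tipCharge d := by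
  unfold tipCharge; split_ifs <;> norm_num

theorem net_ge (d : Δ) : M.charge d - M.across d - M.through d - M.tipCharge d ≤ M.net d := by
  have := M.across_nonneg (M.α d)
  have := M.through_nonneg (M.strip.symm d)
  have := M.tipCharge_nonneg (M.α d)
  unfold net; linarith

theorem sum_net [Fintype Δ] : ∑ d, M.net d = ∑ d, M.charge d := by
  simp only [net, Finset.sum_add_distrib, Finset.sum_sub_distrib]
  rw [Equiv.sum_comp M.α M.across, Equiv.sum_comp M.strip.symm M.through,
    Equiv.sum_comp M.α M.tipCharge]
  ring

theorem tail' (d : Δ) : M.R (M.φ d) ↔ M.R (M.α d) := by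
  have := M.tail (M.α d); rwa [M.inv] at this

variable {M}

theorem IsInt.rev {d : Δ} (h : M.IsInt d) : M.IsInt (M.α d) :=
  ⟨fun h' => h.2 ((M.tail' d).2 h'), fun h' => h.1 ((M.tail d).1 h')⟩

theorem IsTri.next {x : Δ} (h : M.IsTri x) : M.IsTri (M.φ x) := by
  obtain ⟨h1, h2, h3, h4⟩ := h
  refine ⟨by rw [h1], h3, h4, by rwa [h1]⟩

theorem IsQuad.next {x : Δ} (h : M.IsQuad x) : M.IsQuad (M.φ x) := by
  obtain ⟨h1, h2, h3, h4, h5⟩ := h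
  refine ⟨by rw [h1], h3, h4, h5, by rwa [h1]⟩

theorem IsTri.symm_eq {x : Δ} (h : M.IsTri x) : M.φ.symm x = M.φ (M.φ x) := by
  rw [Equiv.symm_apply_eq, h.1]

theorem IsQuad.symm_eq {x : Δ} (h : M.IsQuad x) : M.φ.symm x = M.φ (M.φ (M.φ x)) := by
  rw [Equiv.symm_apply_eq, h.1]

theorem IsBase.symm_eq {x : Δ} (h : M.IsBase x) : M.φ.symm x = M.φ (M.φ x) := by
  rw [Equiv.symm_apply_eq, h.1]

theorem IsInt.flank_or_base {d : Δ} (h : M.IsInt d) (h1 : M.R (M.φ.symm d))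
    (h2 : M.R (M.φ (M.φ d))) : M.Flank d ∨ M.IsBase d := by
  by_cases h3 : M.φ (M.φ (M.φ d)) = d
  · exact .inr ⟨h3, h.1, h.2, h2⟩
  · exact .inl ⟨h, h1, h2, h3⟩

/-- The three-crossings property, phrased for three consecutive sides of a face. -/
theorem three_sides {s : Δ} (h : M.IsInt (M.φ s)) :
    M.R (M.φ (M.φ (M.α (M.φ (M.φ s))))) ∨ M.R (M.φ.symm (M.α s)) := by
  have := M.three _ h.1 h.2
  rwa [Equiv.symm_apply_apply] at this

theorem not_isTri_of_isBase {y : Δ} (h : M.IsBase y) : ¬ M.IsTri (M.α y) :=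
  M.noAT y h.2.1 h.2.2.1 h.2.2.2 h.1

theorem IsBase.not_tri_quad {y : Δ} (h : M.IsBase y) (hq : M.IsQuad (M.α y)) :
    ¬ M.IsTri (M.α (M.φ (M.φ (M.α y)))) :=
  M.noAQT y h.2.1 h.2.2.1 h.2.2.2 h.1 hq _ rfl

theorem IsBase.not_base_quad {y : Δ} (h : M.IsBase y) (hq : M.IsQuad (M.α y)) :
    ¬ M.IsBase (M.α (M.φ (M.φ (M.α y)))) :=
  M.noAQA y h.2.1 h.2.2.1 h.2.2.2 h.1 hq _ rfl

theorem IsBase.not_base_quad_quad {y : Δ} (h : M.IsBase y) (hq : M.IsQuad (M.α y))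
    (hq' : M.IsQuad (M.α (M.φ (M.φ (M.α y))))) :
    ¬ M.IsBase (M.α (M.φ (M.φ (M.α (M.φ (M.φ (M.α y))))))) :=
  M.noAQQA y h.2.1 h.2.2.1 h.2.2.2 h.1 hq _ rfl hq' _ rfl

theorem IsTri.cycleSum {x : Δ} (h : M.IsTri x) (F : Δ → ℤ) :
    M.φ.cycleSum F x = F x + F (M.φ x) + F (M.φ (M.φ x)) := by
  have : Function.minimalPeriod M.φ x = 3 := by
    have : Fact (Nat.Prime 3) := ⟨Nat.prime_three⟩
    exact Function.minimalPeriod_eq_prime h.1 (M.loopless x)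
  simp [Equiv.Perm.cycleSum, this, Finset.sum_range_succ]

theorem IsBase.cycleSum {x : Δ} (h : M.IsBase x) (F : Δ → ℤ) :
    M.φ.cycleSum F x = F x + F (M.φ x) + F (M.φ (M.φ x)) := by
  have : Function.minimalPeriod M.φ x = 3 := by
    have : Fact (Nat.Prime 3) := ⟨Nat.prime_three⟩
    exact Function.minimalPeriod_eq_prime h.1 (M.loopless x)
  simp [Equiv.Perm.cycleSum, this, Finset.sum_range_succ]

theorem IsQuad.cycleSum {x : Δ} (h : M.IsQuad x) (F : Δ → ℤ) :
    M.φ.cycleSum F x = F x + F (M.φ x) + F (M.φ (M.φ x)) + F (M.φ (M.φ (M.φ x))) := by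
  have : Function.minimalPeriod M.φ x = 4 := by
    have : Fact (Nat.Prime 2) := ⟨Nat.prime_two⟩
    have h4 : Function.minimalPeriod M.φ x = 2 ^ (1 + 1) := by
      refine Function.minimalPeriod_eq_prime_pow (fun h2 => ?_) h.1
      exact h.2.1 (M.digon x h2).1
    simpa using h4
  simp [Equiv.Perm.cycleSum, this, Finset.sum_range_succ]

theorem tri_pay {x : Δ} (h : M.IsTri x) : M.net x = 15 + M.across (M.α x)
    + M.through (M.strip.symm x) + M.tipCharge (M.α x) := by
  obtain ⟨h1, h2, h3, h4⟩ := id h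
  have hs := h.symm_eq
  have e1 : M.charge x = 15 := by simp [charge, *]
  have e2 : M.across x = 0 := by simp [across, Flank, OneInt, *]
  have e3 : M.through x = 0 := by simp [through, Flank, *]
  have e4 : M.tipCharge x = 0 := by simp [tipCharge, IsTip, *]
  rw [net, e1, e2, e3, e4]; ring

theorem quad_pay {x : Δ} (h : M.IsQuad x) : M.net x = 15 + M.across (M.α x)
    + M.through (M.strip.symm x) + M.tipCharge (M.α x) := by
  obtain ⟨h1, h2, h3, h4, h5⟩ := id h
  have hs := h.symm_eq
  have e1 : M.charge x = 15 := by simp [charge, *]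
  have e2 : M.across x = 0 := by simp [across, Flank, OneInt, *]
  have e3 : M.through x = 0 := by simp [through, Flank, *]
  have e4 : M.tipCharge x = 0 := by simp [tipCharge, IsTip, *]
  rw [net, e1, e2, e3, e4]; ring

theorem IsTri.isInt {x : Δ} (h : M.IsTri x) : M.IsInt x := ⟨h.2.1, h.2.2.1⟩
theorem IsQuad.isInt {x : Δ} (h : M.IsQuad x) : M.IsInt x := ⟨h.2.1, h.2.2.1⟩

theorem across_of_flank {x : Δ} (h : M.IsTri x) (hf : M.Flank (M.α x)) :
    M.across (M.α x) = 21 := by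
  simp [across, M.inv, h, hf, h.isInt.rev]

theorem IsTri.flank_of {x : Δ} (h : M.IsTri x) (h1 : M.R (M.φ.symm (M.α x)))
    (h2 : M.R (M.φ (M.φ (M.α x)))) : M.Flank (M.α x) :=
  (h.isInt.rev.flank_or_base h1 h2).resolve_right fun hb =>
    not_isTri_of_isBase hb (by rwa [M.inv])

theorem IsTri.cycle_ge {x : Δ} (h : M.IsTri x) : 66 ≤ M.φ.cycleSum M.net x := by
  rw [h.cycleSum, tri_pay h, tri_pay h.next, tri_pay h.next.next]
  have n0 := M.across_nonneg (M.α x)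
  have n1 := M.across_nonneg (M.α (M.φ x))
  have n2 := M.across_nonneg (M.α (M.φ (M.φ x)))
  have := M.through_nonneg (M.strip.symm x)
  have := M.through_nonneg (M.strip.symm (M.φ x))
  have := M.through_nonneg (M.strip.symm (M.φ (M.φ x)))
  have := M.tipCharge_nonneg (M.α x)
  have := M.tipCharge_nonneg (M.α (M.φ x))
  have := M.tipCharge_nonneg (M.α (M.φ (M.φ x)))
  suffices 21 ≤ M.across (M.α x) + M.across (M.α (M.φ x)) + M.across (M.α (M.φ (M.φ x))) by
    linarith
  by_cases f0 : M.Flank (M.α x)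
  · have := across_of_flank h f0; linarith
  by_cases f1 : M.Flank (M.α (M.φ x))
  · have := across_of_flank h.next f1; linarith
  by_cases f2 : M.Flank (M.α (M.φ (M.φ x)))
  · have := across_of_flank h.next.next f2; linarith
  have g0 : ¬ M.HasFlank x := by rintro (h' | h' | h') <;> contradiction
  have g1 : ¬ M.HasFlank (M.φ x) := by
    rintro (h' | h' | h')
    · contradiction
    · contradiction
    · rw [h.1] at h'; contradiction
  have g2 : ¬ M.HasFlank (M.φ (M.φ x)) := by
    rintro (h' | h' | h')
    · contradiction
    · rw [h.1] at h'; contradiction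
    · rw [h.1] at h'; contradiction
  have c0 := mt (fun hh : _ ∧ _ => h.flank_of hh.1 hh.2) f0
  have c1 := mt (fun hh : _ ∧ _ => h.next.flank_of hh.1 hh.2) f1
  have c2 := mt (fun hh : _ ∧ _ => h.next.next.flank_of hh.1 hh.2) f2
  have d0 := three_sides h.next.isInt
  have d1 := three_sides h.next.next.isInt
  have d2 := three_sides h.next.next.next.isInt
  rw [h.1] at d1 d2
  have o0 : M.OneInt (M.α x) := ⟨h.isInt.rev, by tauto⟩
  have o1 : M.OneInt (M.α (M.φ x)) := ⟨h.next.isInt.rev, by tauto⟩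
  have o2 : M.OneInt (M.α (M.φ (M.φ x))) := ⟨h.next.next.isInt.rev, by tauto⟩
  have e0 : M.across (M.α x) = 7 := by simp [across, M.inv, h, f0, h.isInt.rev, g0, o0]
  have e1 : M.across (M.α (M.φ x)) = 7 := by
    simp [across, M.inv, h.next, f1, h.next.isInt.rev, g1, o1]
  have e2 : M.across (M.α (M.φ (M.φ x))) = 7 := by
    simp [across, M.inv, h.next.next, f2, h.next.next.isInt.rev, g2, o2]
  linarith

end CrossMap

namespace CrossMap

variable {Δ : Type*} {M : CrossMap Δ}

theorem IsBase.isInt {x : Δ} (h : M.IsBase x) : M.IsInt x := ⟨h.2.1, h.2.2.1⟩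

/-- A quadrilateral across a triangle or another quadrilateral: the opposite side has vertices on
both sides. -/
theorem IsQuad.opposite {s : Δ} (h : M.IsQuad s) (h0 : M.IsTri (M.α s) ∨ M.IsQuad (M.α s)) :
    M.R (M.φ.symm (M.α (M.φ (M.φ s)))) ∧ M.R (M.φ (M.φ (M.α (M.φ (M.φ s))))) := by
  have d1 := three_sides h.next.isInt
  have d3 := three_sides h.next.next.next.isInt
  rw [h.1] at d3
  have a0 : ¬ M.R (M.φ.symm (M.α s)) := by
    rcases h0 with h0 | h0
    · rw [h0.symm_eq]; exact h0.2.2.2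
    · rw [h0.symm_eq]; exact h0.2.2.2.2
  have b0 : ¬ M.R (M.φ (M.φ (M.α s))) := by
    rcases h0 with h0 | h0
    · exact h0.2.2.2
    · exact h0.2.2.2.1
  exact ⟨d3.resolve_left b0, d1.resolve_right a0⟩

/-- A quadrilateral across a triangle or a quadrilateral receives 6. -/
theorem IsQuad.receives {s : Δ} (h : M.IsQuad s)
    (h0 : M.IsTri (M.α s) ∨ M.IsQuad (M.α s)) :
    6 ≤ M.across (M.α (M.φ (M.φ s))) + M.through (M.strip.symm s) := by
  have n1 := M.across_nonneg (M.α (M.φ (M.φ s)))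
  have n2 := M.through_nonneg (M.strip.symm s)
  obtain ⟨a2, b2⟩ := h.opposite h0
  have hnt : ∀ {u}, M.IsQuad u → ¬ M.IsTri u := by
    intro u hu ht
    have := hu.1
    rw [ht.1] at this
    exact M.loopless _ this
  rcases h.next.next.isInt.rev.flank_or_base a2 b2 with hf | hb
  · have : M.across (M.α (M.φ (M.φ s))) = 6 := by
      simp [across, M.inv, hf, h.next.next, h.next.next.isInt.rev, hnt h.next.next]
    linarith
  · have hq : M.IsQuad (M.α (M.α (M.φ (M.φ s)))) := by rw [M.inv]; exact h.next.next
    have e : M.α (M.φ (M.φ (M.α (M.α (M.φ (M.φ s)))))) = M.α s := by rw [M.inv, h.1]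
    rcases h0 with h0 | h0
    · exact absurd h0 (by rw [← e]; exact hb.not_tri_quad hq)
    · have hb' := hb.not_base_quad_quad hq (by rw [e]; exact h0)
      rw [e] at hb'
      obtain ⟨a3, b3⟩ := h0.opposite (.inr (by rwa [M.inv]))
      have hf := (h0.next.next.isInt.rev.flank_or_base a3 b3).resolve_right hb'
      have hs : M.strip.symm s = M.α (M.φ (M.φ (M.α s))) := by
        rw [Equiv.symm_apply_eq]
        simp [strip, M.inv, h0.1]
      have : M.through (M.strip.symm s) = 6 := by
        simp [through, hs, hf, M.inv, h0.next.next]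
      linarith

theorem IsQuad.not_isTri {u : Δ} (hu : M.IsQuad u) : ¬ M.IsTri u := by
  intro ht
  have := hu.1
  rw [ht.1] at this
  exact M.loopless _ this

theorem IsQuad.across_flank {s : Δ} (h : M.IsQuad s) (hf : M.Flank (M.α s)) :
    M.across (M.α s) = 6 := by
  simp [across, M.inv, hf, h, h.isInt.rev, h.not_isTri]

theorem IsQuad.across_other {s : Δ} (h : M.IsQuad s) (hf : ¬ M.Flank (M.α s))
    (hb : ¬ M.IsBase (M.α s)) (hn : ¬ (M.IsTri (M.α s) ∨ M.IsQuad (M.α s))) :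
    M.across (M.α s) = 3 := by
  simp [across, M.inv, hf, h, h.isInt.rev, h.not_isTri, hb, hn]

theorem IsQuad.across_pair {s : Δ} (h : M.IsQuad s)
    (hf : ¬ M.Flank (M.α s)) (hn : ¬ (M.IsTri (M.α s) ∨ M.IsQuad (M.α s)))
    (hf2 : ¬ M.Flank (M.α (M.φ (M.φ s))))
    (hn2 : ¬ (M.IsTri (M.α (M.φ (M.φ s))) ∨ M.IsQuad (M.α (M.φ (M.φ s))))) :
    3 ≤ M.across (M.α s) + M.across (M.α (M.φ (M.φ s))) := by
  have n1 := M.across_nonneg (M.α (M.φ (M.φ s)))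
  have n2 := M.across_nonneg (M.α s)
  by_cases hb : M.IsBase (M.α s)
  · have hb2 := hb.not_base_quad (by rwa [M.inv])
    rw [M.inv] at hb2
    have := h.next.next.across_other hf2 hb2 hn2
    linarith
  · have := h.across_other hf hb hn
    linarith

theorem IsQuad.cycle_ge {x : Δ} (h : M.IsQuad x) : 66 ≤ M.φ.cycleSum M.net x := by
  rw [h.cycleSum, quad_pay h, quad_pay h.next, quad_pay h.next.next, quad_pay h.next.next.next]
  have n0 := M.across_nonneg (M.α x)
  have n1 := M.across_nonneg (M.α (M.φ x))
  have n2 := M.across_nonneg (M.α (M.φ (M.φ x)))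
  have n3 := M.across_nonneg (M.α (M.φ (M.φ (M.φ x))))
  have t0 := M.through_nonneg (M.strip.symm x)
  have t1 := M.through_nonneg (M.strip.symm (M.φ x))
  have t2 := M.through_nonneg (M.strip.symm (M.φ (M.φ x)))
  have t3 := M.through_nonneg (M.strip.symm (M.φ (M.φ (M.φ x))))
  have := M.tipCharge_nonneg (M.α x)
  have := M.tipCharge_nonneg (M.α (M.φ x))
  have := M.tipCharge_nonneg (M.α (M.φ (M.φ x)))
  have := M.tipCharge_nonneg (M.α (M.φ (M.φ (M.φ x))))
  by_cases f0 : M.Flank (M.α x)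
  · have := h.across_flank f0; linarith
  by_cases f1 : M.Flank (M.α (M.φ x))
  · have := h.next.across_flank f1; linarith
  by_cases f2 : M.Flank (M.α (M.φ (M.φ x)))
  · have := h.next.next.across_flank f2; linarith
  by_cases f3 : M.Flank (M.α (M.φ (M.φ (M.φ x))))
  · have := h.next.next.next.across_flank f3; linarith
  by_cases g0 : M.IsTri (M.α x) ∨ M.IsQuad (M.α x)
  · have := h.receives g0; linarith
  by_cases g1 : M.IsTri (M.α (M.φ x)) ∨ M.IsQuad (M.α (M.φ x))
  · have := h.next.receives g1; linarith
  by_cases g2 : M.IsTri (M.α (M.φ (M.φ x))) ∨ M.IsQuad (M.α (M.φ (M.φ x)))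
  · have := h.next.next.receives g2; rw [h.1] at this; linarith
  by_cases g3 : M.IsTri (M.α (M.φ (M.φ (M.φ x)))) ∨ M.IsQuad (M.α (M.φ (M.φ (M.φ x))))
  · have := h.next.next.next.receives g3; rw [h.1] at this; linarith
  have := h.across_pair f0 g0 f2 g2
  have := h.next.across_pair f1 g1 f3 g3
  linarith

theorem IsBase.cycle_ge {x : Δ} (h : M.IsBase x) : 66 ≤ M.φ.cycleSum M.net x := by
  rw [h.cycleSum]
  obtain ⟨h1, h2, h3, h4⟩ := id h
  have hs := h.symm_eq
  have hs' : M.φ.symm (M.φ (M.φ x)) = M.φ x := by simp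
  have hnt := not_isTri_of_isBase h
  have n0 : 15 ≤ M.net x := by
    have := M.net_ge x
    have e1 : M.charge x = 15 := by simp [charge, *]
    have e2 : M.across x = 0 := by simp [across, Flank, *]
    have e3 : M.through x = 0 := by simp [through, Flank, *]
    have e4 : M.tipCharge x = 0 := by simp [tipCharge, IsTip, *]
    linarith
  have n1 : 6 + M.tipCharge (M.α (M.φ x)) ≤ M.net (M.φ x) := by
    have e1 : M.charge (M.φ x) = 6 := by simp [charge, *]
    have e2 : M.across (M.φ x) = 0 := by simp [across, IsInt, *]
    have e3 : M.through (M.φ x) = 0 := by simp [through, Flank, IsInt, *]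
    have e4 : M.tipCharge (M.φ x) = 0 := by simp [tipCharge, IsTip, *]
    have := M.across_nonneg (M.α (M.φ x))
    have := M.through_nonneg (M.strip.symm (M.φ x))
    unfold net; linarith
  have n2 : 39 + M.tipCharge (M.α (M.φ (M.φ x))) ≤ M.net (M.φ (M.φ x)) := by
    have e1 : M.charge (M.φ (M.φ x)) = 39 := by simp [charge, *]
    have e2 : M.across (M.φ (M.φ x)) = 0 := by simp [across, IsInt, *]
    have e3 : M.through (M.φ (M.φ x)) = 0 := by simp [through, Flank, IsInt, *]
    have e4 : M.tipCharge (M.φ (M.φ x)) = 0 := by simp [tipCharge, IsTip, *]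
    have := M.across_nonneg (M.α (M.φ (M.φ x)))
    have := M.through_nonneg (M.strip.symm (M.φ (M.φ x)))
    unfold net; linarith
  have p1 := M.tipCharge_nonneg (M.α (M.φ x))
  have p2 := M.tipCharge_nonneg (M.α (M.φ (M.φ x)))
  rcases M.three x h2 h3 with h5 | h5
  · have : M.tipCharge (M.α (M.φ x)) = 6 := by
      have c : M.IsCorner (M.φ x) := .inr (.inr (by simpa using h))
      have : M.IsTip (M.α (M.φ x)) := .inl ⟨(M.tail' _).1 h4, fun h' => h3 ((M.tail _).1 h'), h5⟩
      simp [tipCharge, this, M.inv, c]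
    linarith
  · have : M.tipCharge (M.α (M.φ (M.φ x))) = 6 := by
      have c : M.IsCorner (M.φ (M.φ x)) := .inr (.inl (by rwa [h1]))
      have : M.IsTip (M.α (M.φ (M.φ x))) := by
        refine .inr ⟨fun h' => h2 ?_, (M.tail _).2 h4, ?_⟩
        · have := (M.tail' _).2 h'; rwa [h1] at this
        · rwa [← hs]
      simp [tipCharge, this, M.inv, c]
    linarith

end CrossMap

namespace CrossMap

variable {Δ : Type*} {M : CrossMap Δ}

theorem across_le_of_not_flank {x : Δ} (h : ¬ M.Flank x) : M.across x ≤ 7 := by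
  simp only [across, h, if_false]; split_ifs <;> norm_num

theorem across_of_R {x : Δ} (h : M.R x ∨ M.R (M.φ x)) : M.across x = 0 := by
  have : ¬ M.IsInt x := fun h' => h.elim h'.1 h'.2
  simp [across, this]

/-- A side whose face has no vertex sends at most 3, and only to a quadrilateral. -/
theorem across_of_no_vertex {x : Δ} (h1 : ¬ M.R (M.φ.symm x)) (h2 : ¬ M.R (M.φ (M.φ x))) :
    M.across x = 0 ∨ (M.across x = 3 ∧ M.IsQuad (M.α x)) := by
  have f : ¬ M.Flank x := fun h => h1 h.2.1
  have o : ¬ M.OneInt x := by rintro ⟨-, h | h⟩ <;> tauto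
  simp only [across, f, o, if_false, and_false]; split_ifs <;> simp_all

theorem net_of_no_vertex {x : Δ} (h1 : ¬ M.R (M.φ.symm x)) (h2 : ¬ M.R x) (h3 : ¬ M.R (M.φ x)) :
    15 - M.across x ≤ M.net x := by
  have := M.net_ge x
  have e1 : M.charge x = 15 := by simp [charge, *]
  have e3 : M.through x = 0 := by simp [through, Flank, *]
  have e4 : M.tipCharge x = 0 := by simp [tipCharge, IsTip, *]
  linarith

theorem symm_iterate (M : CrossMap Δ) (x : Δ) (i : ℕ) : M.φ.symm (M.φ^[i + 1] x) = M.φ^[i] x := by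
  rw [Function.iterate_succ_apply', Equiv.symm_apply_apply]

theorem pair_le {a b : ℤ} {P Q : Prop} (h1 : a = 0 ∨ a = 3 ∧ P) (h2 : b = 0 ∨ b = 3 ∧ Q)
    (h3 : ¬ (P ∧ Q)) : a + b ≤ 3 := by
  rcases h1 with h1 | ⟨h1, hP⟩ <;> rcases h2 with h2 | ⟨h2, hQ⟩ <;> first | omega | tauto

theorem cycle_ge_of_five {x : Δ} (hx : M.φ (M.φ (M.φ (M.φ (M.φ x)))) = x)
    (h : ∀ i, ¬ M.R (M.φ^[i] x)) : 66 ≤ M.φ.cycleSum M.net x := by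
  have hp : Function.minimalPeriod M.φ x = 5 := by
    have : Fact (Nat.Prime 5) := ⟨Nat.prime_five⟩
    exact Function.minimalPeriod_eq_prime hx (M.loopless x)
  simp only [Equiv.Perm.cycleSum, hp, Finset.sum_range_succ, Finset.range_zero, Finset.sum_empty,
    Function.iterate_succ_apply', Function.iterate_zero, id, zero_add]
  have h0 := h 0
  have h1 := h 1
  have h2 := h 2
  have h3 := h 3
  have h4 := h 4
  simp only [Function.iterate_succ_apply', Function.iterate_zero, id] at h0 h1 h2 h3 h4
  have s0 : M.φ.symm x = M.φ (M.φ (M.φ (M.φ x))) := by rw [Equiv.symm_apply_eq, hx]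
  have key : ∀ s, M.IsInt (M.φ s) → ¬ (M.IsQuad (M.α s) ∧ M.IsQuad (M.α (M.φ (M.φ s)))) := by
    rintro s hs ⟨q1, q2⟩
    rcases three_sides hs with h' | h'
    · exact q2.2.2.2.1 h'
    · rw [q1.symm_eq] at h'; exact q1.2.2.2.2 h'
  have k0 := key x ⟨h1, h2⟩
  have k1 := key (M.φ x) ⟨h2, h3⟩
  have k2 := key (M.φ (M.φ x)) ⟨h3, h4⟩
  have k3 := key (M.φ (M.φ (M.φ x))) ⟨h4, by rwa [hx]⟩
  have k4 := key (M.φ (M.φ (M.φ (M.φ x)))) ⟨by rwa [hx], by rwa [hx]⟩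
  simp only [hx] at k3 k4
  have n0 := net_of_no_vertex (by rwa [s0]) h0 h1
  have n1 := net_of_no_vertex (x := M.φ x) (by simpa) h1 h2
  have n2 := net_of_no_vertex (x := M.φ (M.φ x)) (by simpa) h2 h3
  have n3 := net_of_no_vertex (x := M.φ (M.φ (M.φ x))) (by simpa) h3 h4
  have n4 := net_of_no_vertex (x := M.φ (M.φ (M.φ (M.φ x)))) (by simpa) h4 (by rwa [hx])
  have p0 := across_of_no_vertex (x := x) (by rwa [s0]) h2
  have p1 := across_of_no_vertex (x := M.φ x) (by simpa) h3
  have p2 := across_of_no_vertex (x := M.φ (M.φ x)) (by simpa) h4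
  have p3 := across_of_no_vertex (M := M) (x := M.φ (M.φ (M.φ x))) (by simpa) (by rwa [hx])
  have p4 := across_of_no_vertex (M := M) (x := M.φ (M.φ (M.φ (M.φ x)))) (by simpa) (by rwa [hx])
  have := pair_le p0 p2 k0
  have := pair_le p1 p3 k1
  have : M.across (M.φ (M.φ (M.φ (M.φ x)))) ≤ 3 := by rcases p4 with p | ⟨p, -⟩ <;> omega
  linarith

theorem cycle_ge_of_six {x : Δ} (hp : 6 ≤ Function.minimalPeriod M.φ x)
    (h : ∀ y, M.φ.SameCycle x y → ¬ M.R y) : 66 ≤ M.φ.cycleSum M.net x := by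
  have : ∀ i ∈ Finset.range (Function.minimalPeriod M.φ x), (12 : ℤ) ≤ M.net (M.φ^[i] x) := by
    intro i _
    have hc : M.φ.SameCycle x (M.φ^[i] x) := ⟨i, by simp [← Equiv.Perm.iterate_eq_pow]⟩
    have h1 : ¬ M.R (M.φ.symm (M.φ^[i] x)) := h _ (hc.trans ⟨-1, by simp⟩)
    have h2 := h _ hc
    have h3 := h _ (Equiv.Perm.sameCycle_apply_right.2 hc)
    have h4 := h _ (Equiv.Perm.sameCycle_apply_right.2 (Equiv.Perm.sameCycle_apply_right.2 hc))
    have := net_of_no_vertex h1 h2 h3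
    rcases across_of_no_vertex h1 h4 with h5 | ⟨h5, -⟩ <;> linarith
  have := Finset.card_nsmul_le_sum _ _ _ this
  simp only [Finset.card_range, nsmul_eq_mul] at this
  have h6 : (6 : ℤ) ≤ Function.minimalPeriod M.φ x := by exact_mod_cast hp
  unfold Equiv.Perm.cycleSum
  linarith

/-- The two crossing-to-crossing sides of a quadrilateral with one vertex: the first one sending 7
forces the second to send nothing. -/
theorem across_four_first {z : Δ} (h3 : ¬ M.R (M.φ (M.φ (M.φ z)))) (hT : M.IsTri (M.α (M.φ z)))
    (hF : ¬ M.HasFlank (M.α (M.φ z)))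
    (hY : M.IsTri (M.α (M.φ (M.φ z))) ∨ M.IsQuad (M.α (M.φ (M.φ z)))) : False := by
  set t := M.α (M.φ z) with ht
  have htz : M.α t = M.φ z := M.inv _
  have b0 : ¬ M.R (M.φ (M.φ (M.α t))) := by rwa [htz]
  have hnf : ∀ {s}, M.IsTri s → ¬ M.Flank (M.α s) → ¬ (M.R (M.φ.symm (M.α s)) ∧
    M.R (M.φ (M.φ (M.α s)))) := fun hs hf hh => hf (hs.flank_of hh.1 hh.2)
  have c1 := hnf hT.next (fun h => hF (.inr (.inl h)))
  have c2 := hnf hT.next.next (fun h => hF (.inr (.inr h)))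
  have d0 := three_sides hT.next.isInt
  have d1 := three_sides hT.next.next.isInt
  have d2 := three_sides hT.next.next.next.isInt
  rw [hT.1] at d1 d2
  have a2 : M.R (M.φ.symm (M.α (M.φ (M.φ t)))) := by tauto
  have e4 := M.four (M.α (M.φ (M.φ t))) (fun h => hT.2.1 (by
    have := (M.tail' _).2 h; rwa [hT.1] at this))
  rw [M.inv, hT.1, htz] at e4
  have e5 : M.φ.symm (M.α (M.φ (M.φ t))) = M.α (M.φ (M.α (M.φ (M.φ z)))) := by
    rw [Equiv.symm_apply_eq, e4]
  rw [e5, ← M.tail'] at a2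
  rcases hY with hY | hY
  · exact hY.2.2.2 a2
  · exact hY.2.2.2.1 a2

theorem across_four_second {z : Δ} (h1 : ¬ M.R (M.φ z)) (h2 : ¬ M.R (M.φ (M.φ z)))
    (hT : M.IsTri (M.α (M.φ (M.φ z))))
    (hF : ¬ M.HasFlank (M.α (M.φ (M.φ z))))
    (hY : M.IsTri (M.α (M.φ z)) ∨ M.IsQuad (M.α (M.φ z))) : False := by
  set t := M.α (M.φ (M.φ z)) with ht
  have htz : M.α t = M.φ (M.φ z) := M.inv _
  have a0 : ¬ M.R (M.φ.symm (M.α t)) := by rw [htz]; simpa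
  have hnf : ∀ {s}, M.IsTri s → ¬ M.Flank (M.α s) → ¬ (M.R (M.φ.symm (M.α s)) ∧
    M.R (M.φ (M.φ (M.α s)))) := fun hs hf hh => hf (hs.flank_of hh.1 hh.2)
  have c1 := hnf hT.next (fun h => hF (.inr (.inl h)))
  have c2 := hnf hT.next.next (fun h => hF (.inr (.inr h)))
  have d0 := three_sides hT.next.isInt
  have d1 := three_sides hT.next.next.isInt
  have d2 := three_sides hT.next.next.next.isInt
  rw [hT.1] at d1 d2
  have b1 : M.R (M.φ (M.φ (M.α (M.φ t)))) := by tauto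
  have e4 := M.four (M.φ (M.φ z)) h2
  rw [← ht] at e4
  have e5 : M.φ (M.α (M.φ t)) = M.α (M.φ.symm (M.α (M.φ z))) := by
    apply M.α.injective
    rw [M.inv, ← Equiv.apply_eq_iff_eq M.φ, Equiv.apply_symm_apply]
    apply M.α.injective
    apply M.φ.injective
    rw [e4, M.inv]
  rw [e5, M.tail'] at b1
  rw [M.inv] at b1
  rcases hY with hY | hY
  · rw [hY.symm_eq] at b1; exact hY.2.2.2 b1
  · rw [hY.symm_eq] at b1; exact hY.2.2.2.2 b1

theorem across_cases {x : Δ} (h : ¬ M.Flank x) : M.across x = 0 ∨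
    (M.across x = 3 ∧ M.IsQuad (M.α x)) ∨
    (M.across x = 7 ∧ M.IsTri (M.α x) ∧ ¬ M.HasFlank (M.α x)) := by
  simp only [across]; split_ifs <;> simp_all

theorem cycle_ge_of_four {z : Δ} (hz : M.R z) (h1 : ¬ M.R (M.φ z)) (h2 : ¬ M.R (M.φ (M.φ z)))
    (h3 : ¬ M.R (M.φ (M.φ (M.φ z)))) (h4 : M.φ (M.φ (M.φ (M.φ z))) = z) :
    66 ≤ M.φ.cycleSum M.net z := by
  have hp : Function.minimalPeriod M.φ z = 4 := by
    have : Fact (Nat.Prime 2) := ⟨Nat.prime_two⟩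
    have h4 : Function.minimalPeriod M.φ z = 2 ^ (1 + 1) := by
      refine Function.minimalPeriod_eq_prime_pow (fun h2' => ?_) h4
      exact h1 (M.digon z h2').2
    simpa using h4
  have s0 : M.φ.symm z = M.φ (M.φ (M.φ z)) := by rw [Equiv.symm_apply_eq, h4]
  simp only [Equiv.Perm.cycleSum, hp, Finset.sum_range_succ, Finset.range_zero, Finset.sum_empty,
    Function.iterate_succ_apply', Function.iterate_zero, id, zero_add]
  have f1 : ¬ M.Flank (M.φ z) := fun h => h3 h.2.2.1
  have f2 : ¬ M.Flank (M.φ (M.φ z)) := fun h => h1 (by simpa using h.2.1)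
  have n0 : 39 ≤ M.net z := by
    have := M.net_ge z
    have e1 : M.charge z = 39 := by simp [charge, *]
    have e2 := across_of_R (x := z) (.inl hz)
    have e3 : M.through z = 0 := by simp [through, Flank, IsInt, *]
    have e4 : M.tipCharge z = 0 := by simp [tipCharge, IsTip, *]
    linarith
  have n1 : 15 - M.across (M.φ z) ≤ M.net (M.φ z) := by
    have := M.net_ge (M.φ z)
    have e1 : M.charge (M.φ z) = 15 := by simp [charge, *]
    have e3 : M.through (M.φ z) = 0 := by simp [through, *]
    have e4 : M.tipCharge (M.φ z) = 0 := by simp [tipCharge, IsTip, *]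
    linarith
  have n2 : 15 - M.across (M.φ (M.φ z)) ≤ M.net (M.φ (M.φ z)) := by
    have := M.net_ge (M.φ (M.φ z))
    have e1 : M.charge (M.φ (M.φ z)) = 15 := by simp [charge, *]
    have e3 : M.through (M.φ (M.φ z)) = 0 := by simp [through, *]
    have e4 : M.tipCharge (M.φ (M.φ z)) = 0 := by simp [tipCharge, IsTip, *]
    linarith
  have n3 : 6 ≤ M.net (M.φ (M.φ (M.φ z))) := by
    have := M.net_ge (M.φ (M.φ (M.φ z)))
    have e1 : M.charge (M.φ (M.φ (M.φ z))) = 6 := by simp [charge, *]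
    have e2 := across_of_R (x := M.φ (M.φ (M.φ z))) (.inr (by rwa [h4]))
    have e3 : M.through (M.φ (M.φ (M.φ z))) = 0 := by simp [through, Flank, IsInt, *]
    have e4 : M.tipCharge (M.φ (M.φ (M.φ z))) = 0 := by simp [tipCharge, IsTip, *]
    linarith
  have k1 := across_four_first (M := M) (z := z) h3
  have k2 := across_four_second (M := M) (z := z) h1 h2
  have : M.across (M.φ z) + M.across (M.φ (M.φ z)) ≤ 9 := by
    rcases across_cases f1 with p | ⟨p, p'⟩ | ⟨p, p', p''⟩ <;>
    rcases across_cases f2 with q | ⟨q, q'⟩ | ⟨q, q', q''⟩ <;>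
    first
    | (rw [p, q]; norm_num; done)
    | exact (k1 p' p'' (.inl q')).elim
    | exact (k1 p' p'' (.inr q')).elim
    | exact (k2 q' q'' (.inl p')).elim
    | exact (k2 q' q'' (.inr p')).elim
  linarith

theorem cycle_ge_of_one {z : Δ} {k : ℕ} (hk : 3 ≤ k)
    (hp : Function.minimalPeriod M.φ z = k + 2) (hz : M.R z)
    (h : ∀ i, i < k + 1 → ¬ M.R (M.φ^[i + 1] z)) : 66 ≤ M.φ.cycleSum M.net z := by
  have hzz : M.φ^[k + 2] z = z := by
    have := Function.iterate_minimalPeriod (f := M.φ) (x := z); rwa [hp] at this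
  rw [Equiv.Perm.cycleSum, hp, Finset.sum_range_succ, Finset.sum_range_succ']
  have n0 : 39 ≤ M.net (M.φ^[0] z) := by
    have g1 := h 0 (by omega)
    have g2 := h 1 (by omega)
    simp only [Function.iterate_succ_apply', Function.iterate_zero, id] at g1 g2 ⊢
    have := M.net_ge z
    have e1 : M.charge z = 39 := by simp [charge, *]
    have e2 := across_of_R (x := z) (.inl hz)
    have e3 : M.through z = 0 := by simp [through, Flank, IsInt, *]
    have e4 : M.tipCharge z = 0 := by simp [tipCharge, IsTip, *]
    linarith
  have n1 : 6 ≤ M.net (M.φ^[k + 1] z) := by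
    have g1 := h k (by omega)
    have g2 := h (k - 1) (by omega)
    have g3 : M.φ (M.φ^[k + 1] z) = z := by rw [← Function.iterate_succ_apply' M.φ, hzz]
    have g4 := M.symm_iterate z k
    have g5 : ¬ M.R (M.φ^[k] z) := by rwa [Nat.sub_add_cancel (by omega)] at g2
    have := M.net_ge (M.φ^[k + 1] z)
    have e1 : M.charge (M.φ^[k + 1] z) = 6 := by simp only [charge, g1, g3, hz, if_true, if_false]
    have e2 := across_of_R (x := M.φ^[k + 1] z) (.inr (by rwa [g3]))
    have e3 : M.through (M.φ^[k + 1] z) = 0 := by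
      simp only [through, Flank, IsInt, g3, hz, not_true, and_false, false_and, if_false]
    have e4 : M.tipCharge (M.φ^[k + 1] z) = 0 := by
      simp only [tipCharge, IsTip, g1, g3, g4, g5, false_and, and_false, or_false, if_false]
    linarith
  have n2 : ∀ i ∈ Finset.range k, (8 : ℤ) ≤ M.net (M.φ^[i + 1] z) := by
    intro i hi
    rw [Finset.mem_range] at hi
    have g1 := h i (by omega)
    have g2 := h (i + 1) (by omega)
    rw [Function.iterate_succ_apply'] at g2
    have hf : ¬ M.Flank (M.φ^[i + 1] z) := by
      rintro ⟨-, g3, g4, -⟩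
      rw [← Function.iterate_succ_apply' M.φ, ← Function.iterate_succ_apply' M.φ] at g4
      rw [symm_iterate] at g3
      have : i = 0 := by
        by_contra hi0
        obtain ⟨j, rfl⟩ := Nat.exists_eq_succ_of_ne_zero hi0
        exact h j (by omega) g3
      subst this
      exact h 2 (by omega) g4
    have := M.net_ge (M.φ^[i + 1] z)
    have e1 : M.charge (M.φ^[i + 1] z) = 15 := by simp only [charge, g1, g2, if_false]
    have e2 := across_le_of_not_flank hf
    have e3 : M.through (M.φ^[i + 1] z) = 0 := by
      simp only [through, hf, false_and, if_false]
    have e4 : M.tipCharge (M.φ^[i + 1] z) = 0 := by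
      simp only [tipCharge, IsTip, g1, g2, false_and, and_false, or_false, if_false]
    linarith
  have := Finset.card_nsmul_le_sum _ _ _ n2
  simp only [Finset.card_range, nsmul_eq_mul] at this
  have h6 : (3 : ℤ) ≤ k := by exact_mod_cast hk
  linarith

open Classical in
theorem net_ge_of_flank (M : CrossMap Δ) (x : Δ) : (if M.R x then (33 : ℤ) else 0)
    + (if M.Flank (M.φ x) then 6 else 0) - (if M.Flank x then 6 else 0) ≤ M.net x := by
  have := M.net_ge x
  have ha : M.across x + M.through x ≤ if M.Flank x then 21 else 7 := by
    by_cases hq : M.IsQuad (M.α x)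
    · have := hq.not_isTri
      simp only [across, through, this, hq, and_false, if_false]; split_ifs <;> simp_all
    · simp only [across, through, hq, and_false, if_false]; split_ifs <;> simp_all
  by_cases h1 : M.R x <;> by_cases h2 : M.R (M.φ x)
  · have f1 : ¬ M.Flank x := fun h => h.1.1 h1
    have f2 : ¬ M.Flank (M.φ x) := fun h => h.1.1 h2
    have e1 : M.charge x = 33 := by simp [charge, *]
    have e2 := across_of_R (x := x) (.inl h1)
    have e3 : M.through x = 0 := by simp [through, *]
    have e4 : M.tipCharge x = 0 := by simp [tipCharge, IsTip, *]
    simp only [h1, f1, f2, if_true, if_false]; linarith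
  · have f1 : ¬ M.Flank x := fun h => h.1.1 h1
    have e1 : M.charge x = 39 := by simp [charge, *]
    have e2 := across_of_R (x := x) (.inl h1)
    have e3 : M.through x = 0 := by simp [through, *]
    by_cases h3 : M.R (M.φ (M.φ x))
    · have f2 : ¬ M.Flank (M.φ x) := fun h => h.1.2 h3
      have e4 : M.tipCharge x ≤ 6 := by unfold tipCharge; split_ifs <;> norm_num
      simp only [h1, f1, f2, if_true, if_false]; linarith
    · have e4 : M.tipCharge x = 0 := by simp [tipCharge, IsTip, *]
      simp only [h1, f1, if_true, if_false]
      split_ifs <;> linarith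
  · have f1 : ¬ M.Flank x := fun h => h.1.2 h2
    have f2 : ¬ M.Flank (M.φ x) := fun h => h.1.1 h2
    have e1 : M.charge x = 6 := by simp [charge, *]
    have e2 := across_of_R (x := x) (.inr h2)
    have e3 : M.through x = 0 := by simp [through, *]
    have e4 : M.tipCharge x ≤ 6 := by unfold tipCharge; split_ifs <;> norm_num
    simp only [h1, f1, f2, if_false]; linarith
  · have f2 : ¬ M.Flank (M.φ x) := fun h => h1 (by simpa using h.2.1)
    have e1 : M.charge x = 15 := by simp [charge, *]
    have e4 : M.tipCharge x = 0 := by simp [tipCharge, IsTip, *]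
    simp only [h1, f2, if_false]
    split_ifs at ha ⊢ <;> linarith

open Classical in
theorem cycle_ge_of_two [Fintype Δ] {x : Δ}
    (h : 2 ≤ M.φ.cycleSum (fun y => if M.R y then (1 : ℤ) else 0) x) :
    66 ≤ M.φ.cycleSum M.net x := by
  have h1 := M.φ.cycleSum_comp (fun y => if M.Flank y then (6 : ℤ) else 0) x
  have h2 : M.φ.cycleSum (fun y => (if M.R y then (33 : ℤ) else 0)
    + (if M.Flank (M.φ y) then 6 else 0) - (if M.Flank y then 6 else 0)) x
      ≤ M.φ.cycleSum M.net x :=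
    Finset.sum_le_sum fun i _ => M.net_ge_of_flank _
  have h3 : M.φ.cycleSum (fun y => if M.R y then (33 : ℤ) else 0) x =
      33 * M.φ.cycleSum (fun y => if M.R y then (1 : ℤ) else 0) x := by
    simp only [Equiv.Perm.cycleSum, Finset.mul_sum]
    refine Finset.sum_congr rfl fun i _ => ?_
    split_ifs <;> norm_num
  have h4 : M.φ.cycleSum (fun y => (if M.R y then (33 : ℤ) else 0)
    + (if M.Flank (M.φ y) then 6 else 0) - (if M.Flank y then 6 else 0)) x =
    M.φ.cycleSum (fun y => if M.R y then (33 : ℤ) else 0) x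
    + M.φ.cycleSum (fun y => if M.Flank (M.φ y) then (6 : ℤ) else 0) x
    - M.φ.cycleSum (fun y => if M.Flank y then (6 : ℤ) else 0) x := by
    simp only [Equiv.Perm.cycleSum, Finset.sum_add_distrib, Finset.sum_sub_distrib]
  linarith

theorem cycle_ge [Fintype Δ] (M : CrossMap Δ) (x : Δ) : 66 ≤ M.φ.cycleSum M.net x := by
  classical
  by_cases h0 : ∀ y, M.φ.SameCycle x y → ¬ M.R y
  · have hit : ∀ i, ¬ M.R (M.φ^[i] x) := fun i =>
      h0 _ ⟨i, by simp [← Equiv.Perm.iterate_eq_pow]⟩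
    have hper := Function.iterate_minimalPeriod (f := M.φ) (x := x)
    have hpos := M.φ.minimalPeriod_pos_of_fintype x
    by_cases h6 : 6 ≤ Function.minimalPeriod M.φ x
    · exact cycle_ge_of_six h6 h0
    generalize hk : Function.minimalPeriod M.φ x = k at *
    have h1 := hit 0
    have h2 := hit 1
    have h3 := hit 2
    have h4 := hit 3
    simp only [Function.iterate_succ_apply', Function.iterate_zero, id] at h1 h2 h3 h4
    interval_cases k <;>
      simp only [Function.iterate_succ_apply', Function.iterate_zero, id] at hper
    · exact (M.loopless x hper).elim
    · exact (h1 (M.digon x hper).1).elim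
    · exact IsTri.cycle_ge ⟨hper, h1, h2, h3⟩
    · exact IsQuad.cycle_ge ⟨hper, h1, h2, h3, h4⟩
    · exact cycle_ge_of_five hper hit
  · push Not at h0
    obtain ⟨z, hc, hz⟩ := h0
    rw [M.φ.cycleSum_congr_sameCycle _ hc]
    by_cases h2 : 2 ≤ M.φ.cycleSum (fun y => if M.R y then (1 : ℤ) else 0) z
    · exact cycle_ge_of_two h2
    have hper := Function.iterate_minimalPeriod (f := M.φ) (x := z)
    have hpos := M.φ.minimalPeriod_pos_of_fintype z
    have hR : ∀ i, i + 1 < Function.minimalPeriod M.φ z → ¬ M.R (M.φ^[i + 1] z) := by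
      intro i hi hRi
      apply h2
      have hsub : ({0, i + 1} : Finset ℕ) ⊆ Finset.range (Function.minimalPeriod M.φ z) := by
        intro j hj
        simp only [Finset.mem_insert, Finset.mem_singleton] at hj
        rw [Finset.mem_range]; omega
      have := Finset.sum_le_sum_of_subset_of_nonneg (f := fun i =>
        if M.R (M.φ^[i] z) then (1 : ℤ) else 0) hsub (fun i _ _ => by positivity)
      rw [Finset.sum_pair (by omega), if_pos (by simpa using hz), if_pos hRi] at this
      exact this
    generalize hk : Function.minimalPeriod M.φ z = k at *
    by_cases h5 : 5 ≤ k
    · obtain ⟨k, rfl⟩ := Nat.exists_eq_add_of_le' h5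
      exact cycle_ge_of_one (k := k + 3) (by omega) hk hz fun i hi => hR i (by omega)
    have r1 := hR 0
    have r2 := hR 1
    have r3 := hR 2
    simp only [Function.iterate_succ_apply', Function.iterate_zero, id] at r1 r2 r3
    interval_cases k <;>
      simp only [Function.iterate_succ_apply', Function.iterate_zero, id] at hper
    · exact (M.loopless z hper).elim
    · exact (r1 (by norm_num) (M.digon z hper).2).elim
    · have hb : M.IsBase (M.φ z) :=
        ⟨by rw [hper], r1 (by norm_num), r2 (by norm_num), by rwa [hper]⟩
      have := hb.cycle_ge
      rwa [← M.φ.cycleSum_iterate _ z 1]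
    · exact cycle_ge_of_four hz (r1 (by norm_num)) (r2 (by norm_num)) (r3 (by norm_num)) hper

end CrossMap

namespace CrossMap

variable {Δ : Type*} [Fintype Δ] (M : CrossMap Δ)

open Classical in
theorem card_isInt_le : (Finset.univ.filter fun d => M.IsInt d).card ≤
    (Finset.univ.filter fun d => (M.R d ∧ ¬ M.R (M.φ d)) ∨ (¬ M.R d ∧ M.R (M.φ d))).card := by
  let c : Δ → Δ := fun d => M.φ (M.α (M.φ d))
  let p : Δ → Δ := fun d => M.φ.symm (M.α (M.φ.symm d))
  have hc : ∀ d, M.IsInt d → ¬ M.R (c d) := fun d h h' => h.2 ((M.tail _).1 h')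
  have hp : ∀ d, M.IsInt d → ¬ M.R (M.φ (p d)) := fun d h h' => by
    simp only [p, Equiv.apply_symm_apply, ← M.tail'] at h'; exact h.1 h'
  have ic : Function.Injective c := M.φ.injective.comp (M.α.injective.comp M.φ.injective)
  have ip : Function.Injective p :=
    M.φ.symm.injective.comp (M.α.injective.comp M.φ.symm.injective)
  refine Finset.card_le_card_of_injOn (fun d => if M.R (M.φ (c d)) then c d else p d) ?_ ?_
  · intro d hd
    simp only [Finset.coe_filter, Finset.mem_univ, true_and, Set.mem_ofPred_eq] at hd ⊢
    split_ifs with h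
    · exact .inr ⟨hc d hd, h⟩
    · exact .inl ⟨(M.three d hd.1 hd.2).resolve_left h, hp d hd⟩
  · intro d hd e he hde
    simp only [Finset.coe_filter, Finset.mem_univ, true_and, Set.mem_ofPred_eq] at hd he
    simp only at hde
    split_ifs at hde with h1 h2 h2
    · exact ic hde
    · exact (hc d hd (hde ▸ (M.three e he.1 he.2).resolve_left h2)).elim
    · exact (hc e he (hde ▸ (M.three d hd.1 hd.2).resolve_left h1)).elim
    · exact ip hde

open Classical in
/-- The number of faces is bounded in terms of the numbers of darts leaving crossings and
vertices. -/
theorem faces_le : (66 : ℤ) * Nat.card (Quotient (Equiv.Perm.SameCycle.setoid M.φ)) ≤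
    14 * (Finset.univ.filter fun d => ¬ M.R d).card +
      33 * (Finset.univ.filter fun d => M.R d).card := by
  have h1 := M.φ.mul_card_le_sum M.net 66 M.cycle_ge
  rw [sum_net] at h1
  have h2 := M.card_isInt_le
  have e1 : (Finset.univ.filter fun d => ¬ M.R d ∧ M.R (M.φ d)).card =
      (Finset.univ.filter fun d => M.R d ∧ ¬ M.R (M.φ d)).card := by
    refine Finset.card_bij (fun d _ => M.α d) ?_ (fun _ _ _ _ h => M.α.injective h) ?_
    · intro d; simp only [Finset.mem_filter, Finset.mem_univ, true_and]
      rw [M.tail, M.tail']; tauto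
    · intro d; simp only [Finset.mem_filter, Finset.mem_univ, true_and]
      intro h
      refine ⟨M.α d, ?_, M.inv d⟩
      rw [M.tail, ← M.tail']; tauto
  have hs : ∀ d, M.charge d = 15 * (if M.IsInt d then 1 else 0)
      + 6 * (if (M.R d ∧ ¬ M.R (M.φ d)) ∨ (¬ M.R d ∧ M.R (M.φ d)) then 1 else 0)
      + 33 * (if M.R d then 1 else 0) := by
    intro d; unfold charge IsInt; split_ifs <;> first | norm_num; done | tauto
  rw [Finset.sum_congr rfl fun d _ => hs d] at h1
  simp only [Finset.sum_add_distrib, ← Finset.mul_sum, Finset.sum_boole] at h1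
  have e2 : (Finset.univ.filter fun d => (M.R d ∧ ¬ M.R (M.φ d)) ∨ (¬ M.R d ∧ M.R (M.φ d))).card
      = (Finset.univ.filter fun d => M.R d ∧ ¬ M.R (M.φ d)).card +
        (Finset.univ.filter fun d => ¬ M.R d ∧ M.R (M.φ d)).card := by
    rw [Finset.filter_or, Finset.card_union_of_disjoint]
    rw [Finset.disjoint_filter]; tauto
  have e3 : (Finset.univ.filter fun d => ¬ M.R d).card
      = (Finset.univ.filter fun d => M.IsInt d).card +
        (Finset.univ.filter fun d => ¬ M.R d ∧ M.R (M.φ d)).card := by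
    rw [← Finset.card_union_of_disjoint]
    · congr 1; ext d
      simp only [Finset.mem_union, Finset.mem_filter, Finset.mem_univ, true_and]
      unfold IsInt; tauto
    · rw [Finset.disjoint_filter]; unfold IsInt; tauto
  zify at h2 e1 e2 e3
  linarith

end CrossMap

section Euler

variable {Δ N : Type*} [Fintype Δ] [Fintype N]

/-- Euler's inequality for a map in which every flow is a difference of face
potentials. -/
theorem euler_inequality [Nonempty Δ] (α φ : Equiv.Perm Δ) (t : Δ → N)
    (hα : ∀ d, α (α d) = d) (hα' : ∀ d, α d ≠ d)
    (hχ : ∀ z : Δ → ℝ, (∀ d, z (α d) = - z d) →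
      (∀ F : N → ℝ, ∑ d, z d * F (t d) = 0) →
      ∃ χ : Δ → ℝ, (∀ d, χ (φ d) = χ d) ∧ ∀ d, χ d - χ (α d) = z d) :
    Nat.card Δ + 4 ≤ 2 * Nat.card (Quotient (Equiv.Perm.SameCycle.setoid φ)) + 2 * Nat.card N := by
  classical
  let _ : LinearOrder Δ := LinearOrder.lift' (Fintype.equivFin Δ) (Fintype.equivFin Δ).injective
  let O := {d : Δ // d < α d}
  let Q := Quotient (Equiv.Perm.SameCycle.setoid φ)
  let π : Δ → Q := Quotient.mk _
  have hlt : ∀ d, d < α d ∨ α d < d := fun d => lt_or_gt_of_ne (hα' d).symm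
  have hN : Nonempty N := ⟨t (Classical.arbitrary Δ)⟩
  have hQ : Nonempty Q := ⟨π (Classical.arbitrary Δ)⟩
  have cardO : Fintype.card Δ = 2 * Fintype.card O := by
    have h1 : (Finset.univ.filter fun d => α d < d).card =
        (Finset.univ.filter fun d => d < α d).card :=
      Finset.card_bij (fun d _ => α d) (by simp [hα]) (fun _ _ _ _ h => α.injective h)
        (fun d hd => ⟨α d, by simpa [hα] using hd, hα d⟩)
    have h2 : (Finset.univ : Finset Δ) = (Finset.univ.filter fun d => α d < d) ∪
        (Finset.univ.filter fun d => d < α d) := by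
      ext d; simpa using (hlt d).symm
    have h3 : Disjoint (Finset.univ.filter fun d => α d < d)
        (Finset.univ.filter fun d => d < α d) := by
      rw [Finset.disjoint_filter]; intro d _ h; exact not_lt_of_gt h
    rw [← Finset.card_univ, h2, Finset.card_union_of_disjoint h3, h1, Fintype.card_subtype]; ring
  let ext : (O → ℝ) →ₗ[ℝ] (Δ → ℝ) :=
    { toFun := fun w d => if h : d < α d then w ⟨d, h⟩ else
        if h' : α d < α (α d) then - w ⟨α d, h'⟩ else 0
      map_add' := by intro w w'; ext d; simp only [Pi.add_apply]; split_ifs <;> ring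
      map_smul' := by intro c w; ext d; simp only [Pi.smul_apply, smul_eq_mul, RingHom.id_apply]; split_ifs <;> ring }
  have ext_anti : ∀ w d, ext w (α d) = - ext w d := by
    intro w d
    simp only [ext, LinearMap.coe_mk, AddHom.coe_mk]
    rcases hlt d with h | h
    · have h1 : ¬ α d < α (α d) := by rw [hα]; exact not_lt_of_gt h
      have h2 : α (α d) < α (α (α d)) := by rwa [hα]
      rw [dif_neg h1, dif_pos h2, dif_pos h]
      simp only [hα]
    · have h1 : α d < α (α d) := by rwa [hα]
      have h2 : ¬ d < α d := not_lt_of_gt h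
      rw [dif_pos h1, dif_neg h2, dif_pos h1]; ring
  have ext_inj : Function.Injective ext := by
    intro w w' h
    funext ⟨d, hd⟩
    have := congrFun h d
    simpa [ext, hd] using this
  let B : (O → ℝ) →ₗ[ℝ] (N → ℝ) :=
    { toFun := fun w n => ∑ d with t d = n, ext w d
      map_add' := by intro w w'; ext n; simp [Finset.sum_add_distrib]
      map_smul' := by intro c w; ext n; simp [Finset.mul_sum] }
  let S : (N → ℝ) →ₗ[ℝ] ℝ :=
    { toFun := fun w => ∑ n, w n
      map_add' := by intro w w'; simp [Finset.sum_add_distrib]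
      map_smul' := by intro c w; simp [Finset.mul_sum] }
  let F : (Q → ℝ) →ₗ[ℝ] (Δ → ℝ) :=
    { toFun := fun c d => c (π d) - c (π (α d))
      map_add' := by intro w w'; ext n; simp; ring
      map_smul' := by intro c w; ext n; simp; ring }
  have hS : Module.finrank ℝ (LinearMap.ker S) + 1 = Fintype.card N := by
    have h1 := LinearMap.finrank_range_add_finrank_ker S
    have h2 : LinearMap.range S = ⊤ := by
      rw [LinearMap.range_eq_top]
      intro q
      obtain ⟨n⟩ := hN
      exact ⟨Pi.single n q, by simp [S]⟩
    rw [h2, finrank_top, Module.finrank_self, Module.finrank_fintype_fun_eq_card] at h1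
    omega
  have hB : LinearMap.range B ≤ LinearMap.ker S := by
    rintro _ ⟨w, rfl⟩
    simp only [LinearMap.mem_ker, S, B, LinearMap.coe_mk, AddHom.coe_mk]
    have h0 : ∑ n, ∑ d with t d = n, ext w d = ∑ d, ext w d := by
      convert Finset.sum_fiberwise Finset.univ t (ext w)
    rw [h0]
    have h1 : ∑ d, ext w d = ∑ d, ext w (α d) := (Equiv.sum_comp α _).symm
    simp only [ext_anti, Finset.sum_neg_distrib] at h1
    linarith
  have hkB := LinearMap.finrank_range_add_finrank_ker B
  have hrB := Submodule.finrank_mono hB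
  rw [Module.finrank_fintype_fun_eq_card] at hkB
  have hsub : (LinearMap.ker B).map ext ≤ LinearMap.range F := by
    rintro _ ⟨w, hw, rfl⟩
    have hz2 : ∀ F : N → ℝ, ∑ d, ext w d * F (t d) = 0 := by
      intro G
      have h0 : ∀ n, ∑ d with t d = n, ext w d = 0 := fun n => congrFun hw n
      rw [← Finset.sum_fiberwise (g := t)]
      refine Finset.sum_eq_zero fun n _ => ?_
      have : ∀ d ∈ Finset.univ.filter (fun d => t d = n),
          ext w d * G (t d) = G n * ext w d := by
        intro d hd
        rw [(Finset.mem_filter.1 hd).2]; ring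
      rw [Finset.sum_congr rfl this, ← Finset.mul_sum, h0, mul_zero]
    obtain ⟨χ, h1, h2⟩ := hχ (ext w) (ext_anti w) hz2
    have hinv : ∀ a b : Δ, φ.SameCycle a b → χ a = χ b := by
      intro a b hab
      obtain ⟨i, hi⟩ := hab.exists_nat_pow_eq
      rw [← hi]
      clear hi
      induction i with
      | zero => rfl
      | succ i ih => rw [pow_succ', Equiv.Perm.mul_apply, h1, ih]
    exact ⟨fun q => Quotient.lift (s := Equiv.Perm.SameCycle.setoid φ) χ hinv q, funext h2⟩
  have hle := Submodule.finrank_mono hsub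
  rw [← LinearEquiv.finrank_eq (Submodule.equivMapOfInjective ext ext_inj _)] at hle
  have hkF := LinearMap.finrank_range_add_finrank_ker F
  have h1F : 1 ≤ Module.finrank ℝ (LinearMap.ker F) := by
    rw [Nat.one_le_iff_ne_zero, Ne, Submodule.finrank_eq_zero]
    intro h
    have : (fun _ => 1 : Q → ℝ) ∈ LinearMap.ker F := by
      rw [LinearMap.mem_ker]; ext d; simp [F]
    rw [h, Submodule.mem_bot] at this
    obtain ⟨q⟩ := hQ
    simpa using congrFun this q
  rw [Module.finrank_fintype_fun_eq_card] at hkF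
  rw [Nat.card_eq_fintype_card, Nat.card_eq_fintype_card, Nat.card_eq_fintype_card]
  change _ ≤ 2 * Fintype.card Q + _
  omega

end Euler

section PlaneGraph

open Complex

/-- The argument of a complex number, normalised to `(0, 2π]`. -/
noncomputable def Complex.ang (z : ℂ) : ℝ := if z.arg ≤ 0 then z.arg + 2 * Real.pi else z.arg

namespace Complex

theorem ang_pos (z : ℂ) : 0 < ang z := by
  unfold ang
  split_ifs with h
  · linarith [neg_pi_lt_arg z, Real.pi_pos]
  · linarith

theorem ang_le (z : ℂ) : ang z ≤ 2 * Real.pi := by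
  unfold ang
  split_ifs with h
  · linarith
  · linarith [arg_le_pi z, Real.pi_pos]

theorem norm_mul_exp_ang_mul_I (z : ℂ) : (‖z‖ : ℂ) * exp (ang z * Complex.I) = z := by
  unfold ang
  split_ifs with h
  · push_cast
    rw [add_mul, exp_add, exp_two_pi_mul_I, mul_one, norm_mul_exp_arg_mul_I]
  · exact norm_mul_exp_arg_mul_I z

theorem ang_eq_of_eq_mul_exp {z : ℂ} {r θ : ℝ} (hr : 0 < r) (h0 : 0 < θ) (h1 : θ ≤ 2 * Real.pi)
    (h : z = r * exp (θ * Complex.I)) : ang z = θ := by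
  unfold ang
  by_cases hθ : θ ≤ Real.pi
  · have : z.arg = θ := by
      rw [h, exp_mul_I, ← ofReal_cos, ← ofReal_sin]
      have := arg_mul_cos_add_sin_mul_I hr (θ := θ) ⟨by linarith [Real.pi_pos], hθ⟩
      simpa using this
    rw [this, if_neg (by linarith)]
  · have h2 : z = r * exp ((θ - 2 * Real.pi : ℝ) * Complex.I) := by
      rw [h]; push_cast
      rw [sub_mul, exp_sub, exp_two_pi_mul_I, div_one]
    have : z.arg = θ - 2 * Real.pi := by
      rw [h2, exp_mul_I, ← ofReal_cos, ← ofReal_sin]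
      have := arg_mul_cos_add_sin_mul_I hr (θ := θ - 2 * Real.pi) ⟨by linarith [Real.pi_pos], by linarith [Real.pi_pos]⟩
      simpa only [ofReal_cos, ofReal_sin] using this
    rw [this, if_pos (by linarith)]; ring

theorem ang_div_of_lt {u v : ℂ} (hu : u ≠ 0) (hv : v ≠ 0) (h : ang u < ang v) :
    ang (v / u) = ang v - ang u := by
  refine ang_eq_of_eq_mul_exp (r := ‖v‖ / ‖u‖) (by positivity) (by linarith)
    (by linarith [ang_le v, ang_pos u]) ?_
  push_cast
  rw [sub_mul, exp_sub]
  nth_rewrite 1 [← norm_mul_exp_ang_mul_I v, ← norm_mul_exp_ang_mul_I u]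
  rw [mul_div_mul_comm]

theorem ang_div_of_le {u v : ℂ} (hu : u ≠ 0) (hv : v ≠ 0) (h : ang v ≤ ang u) :
    ang (v / u) = ang v - ang u + 2 * Real.pi := by
  refine ang_eq_of_eq_mul_exp (r := ‖v‖ / ‖u‖) (by positivity)
    (by linarith [ang_le u, ang_pos v]) (by linarith) ?_
  push_cast
  rw [add_mul, exp_add, exp_two_pi_mul_I, mul_one, sub_mul, exp_sub]
  nth_rewrite 1 [← norm_mul_exp_ang_mul_I v, ← norm_mul_exp_ang_mul_I u]
  rw [mul_div_mul_comm]

theorem ang_one : ang 1 = 2 * Real.pi := by simp [ang]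

theorem ang_div_self {z : ℂ} (hz : z ≠ 0) : ang (z / z) = 2 * Real.pi := by
  rw [div_self hz, ang_one]

/-- Two nonzero numbers with the same normalised argument relative to `s` are positive multiples
of each other. -/
theorem eq_mul_of_ang_div_eq {s u v : ℂ} (hs : s ≠ 0) (hu : u ≠ 0) (hv : v ≠ 0)
    (h : ang (u / s) = ang (v / s)) : ∃ r : ℝ, 0 < r ∧ v = r * u := by
  refine ⟨‖v‖ / ‖u‖, by positivity, ?_⟩
  have h1 := norm_mul_exp_ang_mul_I (u / s)
  have h2 := norm_mul_exp_ang_mul_I (v / s)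
  rw [h] at h1
  have hu' : (‖u‖ : ℂ) ≠ 0 := by exact_mod_cast norm_ne_zero_iff.2 hu
  have hs' : (‖s‖ : ℂ) ≠ 0 := by exact_mod_cast norm_ne_zero_iff.2 hs
  rw [norm_div] at h1 h2
  have h3 : u = ((‖u‖ / ‖s‖ : ℝ) : ℂ) * exp (ang (v / s) * Complex.I) * s := by
    rw [h1]; field_simp
  have h4 : v = ((‖v‖ / ‖s‖ : ℝ) : ℂ) * exp (ang (v / s) * Complex.I) * s := by
    rw [h2]; field_simp
  set w := exp (ang (v / s) * Complex.I)
  push_cast at h3 h4 ⊢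
  generalize (‖u‖ : ℂ) = a at *
  generalize (‖v‖ : ℂ) = b at *
  rw [h4, h3]
  field_simp

theorem ang_div_comm {u v : ℂ} (hu : u ≠ 0) (hv : v ≠ 0) (h : ang (u / v) ≠ 2 * Real.pi) :
    ang (v / u) = 2 * Real.pi - ang (u / v) := by
  have h1 : v / u = (v / v) / (u / v) := by field_simp
  rw [h1, ang_div_of_lt (div_ne_zero hu hv) (div_ne_zero hv hv), ang_div_self hv]
  rw [ang_div_self hv]
  exact lt_of_le_of_ne (ang_le _) h

end Complex

/-- A finite straight-line plane graph, given by its set of oriented edges. -/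
structure IsPlaneGraph (H : Finset (ℂ × ℂ)) : Prop where
  symm : ∀ {a b}, (a, b) ∈ H → (b, a) ∈ H
  ne : ∀ {a b}, (a, b) ∈ H → a ≠ b
  inter : ∀ {a b c d z}, (a, b) ∈ H → (c, d) ∈ H → z ∈ segment ℝ a b → z ∈ segment ℝ c d →
    (a = c ∧ b = d) ∨ (a = d ∧ b = c) ∨ ((z = a ∨ z = b) ∧ (z = c ∨ z = d))

/-- The point following `s` in counterclockwise order among the neighbours of `t`. -/
noncomputable def nextPt (H : Finset (ℂ × ℂ)) (t s : ℂ) : ℂ :=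
  open Classical in
  if h : ∃ u, (t, u) ∈ H ∧ ∀ v, (t, v) ∈ H → ang ((u - t) / (s - t)) ≤ ang ((v - t) / (s - t))
  then h.choose else s

namespace IsPlaneGraph

variable {H : Finset (ℂ × ℂ)}

theorem eq_of_mul (hH : IsPlaneGraph H) {t u v : ℂ} (hu : (t, u) ∈ H) (hv : (t, v) ∈ H) {r : ℝ} (hr : 0 < r)
    (h : v - t = r * (u - t)) : u = v := by
  have key : ∀ {u v : ℂ}, (t, u) ∈ H → (t, v) ∈ H → ∀ {r : ℝ}, 0 < r → r ≤ 1 →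
      v - t = r * (u - t) → u = v := by
    intro u v hu hv r hr h1 h
    have hseg : v ∈ segment ℝ t u := by
      rw [segment_eq_image']
      exact ⟨r, ⟨hr.le, h1⟩, by simp [← h]⟩
    rcases hH.inter hu hv hseg (right_mem_segment ℝ t v) with ⟨-, h⟩ | ⟨h, -⟩ | ⟨h | h, -⟩
    · exact h
    · exact absurd h (hH.ne hv)
    · exact absurd h.symm (hH.ne hv)
    · exact h.symm
  rcases le_total r 1 with h1 | h1
  · exact key hu hv hr h1 h
  · refine (key hv hu (inv_pos.2 hr) (inv_le_one_of_one_le₀ h1) ?_).symm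
    rw [h]; push_cast
    have : (r : ℂ) ≠ 0 := by exact_mod_cast hr.ne'
    field_simp

theorem sub_ne (hH : IsPlaneGraph H) {t u : ℂ} (hu : (t, u) ∈ H) : u - t ≠ 0 := sub_ne_zero.2 (hH.ne hu).symm

theorem eq_of_ang (hH : IsPlaneGraph H) {t s u v : ℂ} (hs : s ≠ t) (hu : (t, u) ∈ H) (hv : (t, v) ∈ H)
    (h : ang ((u - t) / (s - t)) = ang ((v - t) / (s - t))) : u = v := by
  obtain ⟨r, hr, h⟩ := eq_mul_of_ang_div_eq (sub_ne_zero.2 hs) (hH.sub_ne hu) (hH.sub_ne hv) h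
  exact hH.eq_of_mul hu hv hr h

theorem nextPt_spec {t s : ℂ} (hs : (t, s) ∈ H) : (t, nextPt H t s) ∈ H ∧
    ∀ v, (t, v) ∈ H → ang ((nextPt H t s - t) / (s - t)) ≤ ang ((v - t) / (s - t)) := by
  classical
  have h : ∃ u, (t, u) ∈ H ∧ ∀ v, (t, v) ∈ H →
      ang ((u - t) / (s - t)) ≤ ang ((v - t) / (s - t)) := by
    obtain ⟨⟨a, b⟩, hb, hmin⟩ := Finset.exists_min_image (H.filter fun d => d.1 = t)
      (fun d => ang ((d.2 - t) / (s - t))) ⟨(t, s), by simp [hs]⟩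
    simp only [Finset.mem_filter] at hb
    obtain ⟨hb, rfl⟩ := hb
    exact ⟨b, hb, fun v hv => hmin (a, v) (by simp [hv])⟩
  rw [nextPt, dif_pos h]
  exact h.choose_spec

theorem nextPt_eq (hH : IsPlaneGraph H) {t s u : ℂ} (hs : (t, s) ∈ H) (hu : (t, u) ∈ H)
    (h : ∀ v, (t, v) ∈ H → ang ((u - t) / (s - t)) ≤ ang ((v - t) / (s - t))) :
    nextPt H t s = u := by
  obtain ⟨h1, h2⟩ := nextPt_spec hs
  exact hH.eq_of_ang (hH.ne hs).symm h1 hu (le_antisymm (h2 u hu) (h _ h1))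

theorem nextPt_injOn (hH : IsPlaneGraph H) {t s s' : ℂ} (hs : (t, s) ∈ H) (hs' : (t, s') ∈ H)
    (h : nextPt H t s = nextPt H t s') : s = s' := by
  by_contra hne
  obtain ⟨h1, h2⟩ := nextPt_spec hs
  obtain ⟨-, h3⟩ := nextPt_spec hs'
  rw [← h] at h3
  set u := nextPt H t s
  have hA := hH.sub_ne hs
  have hB := hH.sub_ne hs'
  have hC := hH.sub_ne h1
  have hβ : ang ((s' - t) / (s - t)) ≠ 2 * Real.pi := by
    intro h
    rw [← ang_div_self hA] at h
    exact hne (hH.eq_of_ang (hH.ne hs).symm hs hs' h.symm)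
  have e1 := ang_div_comm hB hA hβ
  have e2 := h2 s' hs'
  have e3 := h3 s hs
  rw [e1] at e3
  have hd : (u - t) / (s' - t) = ((u - t) / (s - t)) / ((s' - t) / (s - t)) := by field_simp
  rcases e2.lt_or_eq with e2 | e2
  · rw [hd, ang_div_of_le (div_ne_zero hB hA) (div_ne_zero hC hA) e2.le] at e3
    linarith [ang_pos ((u - t) / (s - t))]
  · rw [hd, ang_div_of_le (div_ne_zero hB hA) (div_ne_zero hC hA) e2.le, e2] at e3
    linarith [ang_pos ((s' - t) / (s - t))]

end IsPlaneGraph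

end PlaneGraph

section PlaneGraphWinding

open Complex Topology Filter

theorem div_mem_slitPlane_of_notMem_segment {a b y : ℂ} (h : y ∉ segment ℝ a b) :
    (b - y) / (a - y) ∈ slitPlane := by
  by_contra hc
  apply h
  have ha : a ≠ y := by rintro rfl; exact h (left_mem_segment ℝ a b)
  have ha' : a - y ≠ 0 := sub_ne_zero.2 ha
  rw [mem_slitPlane_iff, not_or, not_lt, not_not] at hc
  set r := -((b - y) / (a - y)).re
  have hr : 0 ≤ r := by simp only [r]; linarith [hc.1]
  have h1 : (b - y) / (a - y) = ((-r : ℝ) : ℂ) := by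
    apply Complex.ext <;> simp [r, hc.2]
  rw [div_eq_iff ha'] at h1
  push_cast at h1
  have h2 : (1 + r : ℝ) ≠ 0 := by positivity
  have h2' : (1 + r : ℂ) ≠ 0 := by exact_mod_cast h2
  rw [segment_eq_image]
  refine ⟨1 / (1 + r), ⟨by positivity, by rw [div_le_one (by positivity)]; linarith⟩, ?_⟩
  simp only [real_smul]
  push_cast
  have : (1 : ℂ) - 1 / (1 + r) = r / (1 + r) := by field_simp; ring
  rw [this]
  field_simp
  linear_combination h1

/-- The complement of the drawing of a straight-line plane graph. -/
def freeSet (H : Finset (ℂ × ℂ)) : Set ℂ := {y | ∀ d ∈ H, y ∉ segment ℝ d.1 d.2}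

/-- The (unnormalised) winding function of a flow on a straight-line plane graph. -/
noncomputable def windSum (H : Finset (ℂ × ℂ)) (z : ℂ × ℂ → ℝ) (y : ℂ) : ℝ :=
  ∑ d ∈ H, z d * arg ((d.2 - y) / (d.1 - y))

theorem isOpen_freeSet (H : Finset (ℂ × ℂ)) : IsOpen (freeSet H) := by
  have : freeSet H = ⋂ d ∈ H, (segment ℝ d.1 d.2)ᶜ := by
    ext; simp [freeSet]
  rw [this]
  refine isOpen_biInter_finset fun d _ => ?_
  rw [isOpen_compl_iff, segment_eq_image]
  exact (isCompact_Icc.image (by fun_prop)).isClosed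

theorem continuousAt_arg_div {a b y : ℂ} (h : y ∉ segment ℝ a b) :
    ContinuousAt (fun y => arg ((b - y) / (a - y))) y := by
  have ha : a - y ≠ 0 := sub_ne_zero.2 (by rintro rfl; exact h (left_mem_segment ℝ a b))
  have h1 := continuousAt_arg (div_mem_slitPlane_of_notMem_segment h)
  have h2 : ContinuousAt (fun y => (b - y) / (a - y)) y := by fun_prop (disch := exact ha)
  exact ContinuousAt.comp (f := fun y => (b - y) / (a - y)) h1 h2

theorem continuousAt_arg_div_const {p y : ℂ} (h : p ≠ y) :
    ContinuousAt (fun x => arg ((p - x) / (p - y))) y := by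
  have ha : p - y ≠ 0 := sub_ne_zero.2 h
  have h1 : ContinuousAt arg ((p - y) / (p - y)) := by
    apply continuousAt_arg; rw [div_self ha]; exact one_mem_slitPlane
  have h2 : ContinuousAt (fun x => (p - x) / (p - y)) y := by fun_prop
  exact ContinuousAt.comp (f := fun x => (p - x) / (p - y)) h1 h2

theorem eventually_arg_div_sub {a b y₀ : ℂ} (h : y₀ ∉ segment ℝ a b) :
    ∀ᶠ y in 𝓝 y₀, arg ((b - y) / (a - y)) - arg ((b - y₀) / (a - y₀)) =
      arg ((b - y) / (b - y₀)) - arg ((a - y) / (a - y₀)) := by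
  have ha : a ≠ y₀ := by rintro rfl; exact h (left_mem_segment ℝ a b)
  have hb : b ≠ y₀ := by rintro rfl; exact h (right_mem_segment ℝ a b)
  let f : ℂ → ℝ := fun y => arg ((b - y) / (a - y)) - arg ((b - y₀) / (a - y₀)) -
      (arg ((b - y) / (b - y₀)) - arg ((a - y) / (a - y₀)))
  have hf : ContinuousAt f y₀ := ((continuousAt_arg_div h).sub continuousAt_const).sub
    ((continuousAt_arg_div_const hb).sub (continuousAt_arg_div_const ha))
  have hf0 : f y₀ = 0 := by
    simp [f, div_self (sub_ne_zero.2 ha), div_self (sub_ne_zero.2 hb)]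
  have h1 : ∀ᶠ y in 𝓝 y₀, |f y| < 2 * Real.pi := by
    have : Tendsto (fun y => |f y|) (𝓝 y₀) (𝓝 0) := by
      have := hf.abs.tendsto; rwa [hf0, abs_zero] at this
    exact this.eventually_lt_const (by positivity)
  filter_upwards [h1, isOpen_ne.mem_nhds ha.symm, isOpen_ne.mem_nhds hb.symm] with y hy hya hyb
  have hya' : a - y ≠ 0 := sub_ne_zero.2 (Ne.symm hya)
  have hyb' : b - y ≠ 0 := sub_ne_zero.2 (Ne.symm hyb)
  have ha' := sub_ne_zero.2 ha
  have hb' := sub_ne_zero.2 hb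
  have h0 : ((f y : ℝ) : Real.Angle) = 0 := by
    simp only [f, Real.Angle.coe_sub]
    rw [arg_div_coe_angle hyb' hya', arg_div_coe_angle hb' ha', arg_div_coe_angle hyb' hb',
      arg_div_coe_angle hya' ha']
    abel
  rw [← Real.Angle.coe_zero, Real.Angle.angle_eq_iff_two_pi_dvd_sub] at h0
  obtain ⟨k, hk⟩ := h0
  rw [sub_zero] at hk
  have hk0 : k = 0 := by
    by_contra hk0
    rw [hk, abs_mul, abs_of_pos (by positivity)] at hy
    have : (1 : ℝ) ≤ |(k : ℝ)| := by exact_mod_cast Int.one_le_abs hk0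
    nlinarith [Real.pi_pos]
  rw [hk0] at hk
  simp only [f] at hk
  push_cast at hk
  linarith

theorem sum_swap {H : Finset (ℂ × ℂ)} (hsymm : ∀ {a b}, (a, b) ∈ H → (b, a) ∈ H)
    (f : ℂ × ℂ → ℝ) : ∑ d ∈ H, f d.swap = ∑ d ∈ H, f d :=
  Finset.sum_bij (fun d _ => d.swap) (fun d hd => hsymm hd) (fun _ _ _ _ h => Prod.swap_injective h)
    (fun d hd => ⟨d.swap, hsymm hd, by simp⟩) (fun _ _ => rfl)

theorem eventually_windSum_eq {H : Finset (ℂ × ℂ)} (hH : IsPlaneGraph H) {z : ℂ × ℂ → ℝ}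
    (hz : ∀ d, z d.swap = - z d) (hcons : ∀ F : ℂ → ℝ, ∑ d ∈ H, z d * F d.1 = 0) {y₀ : ℂ}
    (hy : y₀ ∈ freeSet H) : ∀ᶠ y in 𝓝 y₀, windSum H z y = windSum H z y₀ := by
  have h1 : ∀ᶠ y in 𝓝 y₀, ∀ d ∈ H, arg ((d.2 - y) / (d.1 - y)) - arg ((d.2 - y₀) / (d.1 - y₀)) =
      arg ((d.2 - y) / (d.2 - y₀)) - arg ((d.1 - y) / (d.1 - y₀)) :=
    (Filter.eventually_all_finset H).2 fun d hd => eventually_arg_div_sub (hy d hd)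
  filter_upwards [h1] with y hy
  rw [← sub_eq_zero, windSum, windSum, ← Finset.sum_sub_distrib]
  simp only [← mul_sub]
  rw [Finset.sum_congr rfl fun d hd => by rw [hy d hd]]
  simp only [mul_sub, Finset.sum_sub_distrib]
  have h2 := hcons fun p => arg ((p - y) / (p - y₀))
  have h3 := sum_swap hH.symm fun d => z d * arg ((d.1 - y) / (d.1 - y₀))
  simp only [hz, Prod.fst_swap, neg_mul, Finset.sum_neg_distrib] at h3
  linarith

theorem windSum_eq_of_isPreconnected {H : Finset (ℂ × ℂ)} (hH : IsPlaneGraph H) {z : ℂ × ℂ → ℝ}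
    (hz : ∀ d, z d.swap = - z d) (hcons : ∀ F : ℂ → ℝ, ∑ d ∈ H, z d * F d.1 = 0) {S : Set ℂ}
    (hS : IsPreconnected S) (hSH : S ⊆ freeSet H) {x y : ℂ} (hx : x ∈ S) (hy : y ∈ S) :
    windSum H z x = windSum H z y := by
  refine hS.induction₂ (fun x y => windSum H z x = windSum H z y) ?_ ?_ ?_ hx hy
  · intro x hx
    exact (eventually_nhdsWithin_of_eventually_nhds
      ((eventually_windSum_eq hH hz hcons (hSH hx)).mono fun _ h => h.symm))
  · intro x y w _ _ _ h h'; exact h.trans h'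
  · intro x y _ _ h; exact h.symm

end PlaneGraphWinding

section PlaneGraphFaces

open Complex Topology Filter

/-- The point at position `l` along the segment from `s` to `t`, pushed off to the right by `e`. -/
noncomputable def rightPt (s t : ℂ) (l e : ℝ) : ℂ := s + l * (t - s) - Complex.I * e * (t - s)

variable {H : Finset (ℂ × ℂ)}

theorem exists_rightPt_mem_freeSet (hH : IsPlaneGraph H) {s t : ℂ} (hst : (s, t) ∈ H) {a b : ℝ}
    (ha : 0 < a) (hb : b < 1) :
    ∃ δ > 0, ∀ l ∈ Set.Icc a b, ∀ e ∈ Set.Ioo 0 δ, rightPt s t l e ∈ freeSet H := by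
  have hne : t - s ≠ 0 := sub_ne_zero.2 (hH.ne hst).symm
  set K : Set ℂ := (fun l : ℝ => s + l * (t - s)) '' Set.Icc a b
  have hK : IsCompact K := isCompact_Icc.image (by fun_prop)
  let H' := H.filter fun d => d ≠ (s, t) ∧ d ≠ (t, s)
  have hKU : K ⊆ freeSet H' := by
    rintro _ ⟨l, hl, rfl⟩ ⟨c, d⟩ hd hmem
    simp only [H', Finset.mem_filter] at hd
    obtain ⟨hd, hd1, hd2⟩ := hd
    have hmem' : s + l * (t - s) ∈ segment ℝ s t := by
      rw [segment_eq_image']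
      exact ⟨l, ⟨by linarith [hl.1], by linarith [hl.2]⟩, by simp⟩
    rcases hH.inter hst hd hmem' hmem with ⟨rfl, rfl⟩ | ⟨rfl, rfl⟩ | ⟨h | h, -⟩
    · exact hd1 rfl
    · exact hd2 rfl
    · have : (l : ℂ) * (t - s) = 0 := by linear_combination h
      rcases mul_eq_zero.1 this with h | h
      · have : l = 0 := by exact_mod_cast h
        linarith [hl.1]
      · exact hne h
    · have : ((l : ℂ) - 1) * (t - s) = 0 := by linear_combination h
      rcases mul_eq_zero.1 this with h | h
      · have : l - 1 = 0 := by exact_mod_cast h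
        linarith [hl.2]
      · exact hne h
  obtain ⟨δ, hδ, hsub⟩ := hK.exists_thickening_subset_open (isOpen_freeSet H') hKU
  refine ⟨δ / ‖t - s‖, by positivity, fun l hl e he => ?_⟩
  have h1 : rightPt s t l e ∈ freeSet H' := by
    apply hsub
    rw [Metric.mem_thickening_iff]
    refine ⟨_, ⟨l, hl, rfl⟩, ?_⟩
    rw [dist_eq_norm, rightPt]
    have : s + l * (t - s) - Complex.I * e * (t - s) - (s + l * (t - s)) =
      - (Complex.I * e * (t - s)) := by ring
    rw [this, norm_neg, norm_mul, norm_mul, norm_I, one_mul, norm_real, Real.norm_of_nonneg he.1.le]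
    have := he.2
    rwa [lt_div_iff₀ (by positivity)] at this
  have h2 : rightPt s t l e ∉ segment ℝ s t := by
    rw [segment_eq_image']
    rintro ⟨c, -, hc⟩
    have : ((c - l : ℝ) + e * Complex.I) * (t - s) = 0 := by
      simp only [real_smul, rightPt] at hc
      push_cast
      linear_combination hc
    rcases mul_eq_zero.1 this with h | h
    · have := congrArg im h
      simp at this
      linarith [he.1]
    · exact hne h
  intro d hd
  by_cases hd1 : d = (s, t)
  · rw [hd1]; exact h2
  by_cases hd2 : d = (t, s)
  · rw [hd2, segment_symm]; exact h2
  exact h1 d (by simp [H', hd, hd1, hd2])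

theorem exists_sector_mem_freeSet (hH : IsPlaneGraph H) {s t : ℂ} (hst : (s, t) ∈ H) :
    ∃ r > (0 : ℝ), ∀ ρ ∈ Set.Ioo 0 r, ∀ θ ∈ Set.Ioo 0 (ang ((nextPt H t s - t) / (s - t))),
      t + ρ * exp (θ * Complex.I) * (s - t) ∈ freeSet H := by
  obtain ⟨hu, hmin⟩ := IsPlaneGraph.nextPt_spec (hH.symm hst)
  have hne : s - t ≠ 0 := sub_ne_zero.2 (hH.ne hst)
  let H' := H.filter fun d => d.1 ≠ t ∧ d.2 ≠ t
  have ht : t ∈ freeSet H' := by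
    rintro ⟨c, d⟩ hd hmem
    simp only [H', Finset.mem_filter] at hd
    obtain ⟨hd, hd1, hd2⟩ := hd
    rcases hH.inter hst hd (right_mem_segment ℝ s t) hmem with ⟨rfl, rfl⟩ | ⟨rfl, rfl⟩ | ⟨-, h | h⟩
    · exact hd2 rfl
    · exact hd1 rfl
    · exact hd1 h.symm
    · exact hd2 h.symm
  obtain ⟨r, hr, hball⟩ := Metric.isOpen_iff.1 (isOpen_freeSet H') t ht
  refine ⟨r / ‖s - t‖, by positivity, fun ρ hρ θ hθ => ?_⟩
  set w : ℂ := t + ρ * exp (θ * Complex.I) * (s - t) with hw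
  have h1 : w ∈ freeSet H' := by
    apply hball
    rw [Metric.mem_ball, dist_eq_norm, hw, add_sub_cancel_left, norm_mul, norm_mul,
      norm_exp_ofReal_mul_I, mul_one, norm_real, Real.norm_of_nonneg hρ.1.le]
    have := hρ.2
    rwa [lt_div_iff₀ (by positivity)] at this
  have h2 : ∀ v, (t, v) ∈ H → w ∉ segment ℝ t v := by
    intro v hv
    rw [segment_eq_image']
    rintro ⟨c, ⟨hc0, -⟩, hc⟩
    have h3 : c * (v - t) = ρ * exp (θ * Complex.I) * (s - t) := by
      simp only [real_smul, hw] at hc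
      linear_combination hc
    have hc1 : 0 < c := by
      rcases hc0.lt_or_eq with h | h
      · exact h
      · rw [← h] at h3
        have hρ' : (ρ : ℂ) ≠ 0 := by exact_mod_cast hρ.1.ne'
        simp [hne, hρ'] at h3
    have hc' : (c : ℂ) ≠ 0 := by exact_mod_cast hc1.ne'
    have h4 : (v - t) / (s - t) = ((ρ / c : ℝ) : ℂ) * exp (θ * Complex.I) := by
      push_cast
      field_simp
      linear_combination h3
    have h5 := ang_eq_of_eq_mul_exp (div_pos hρ.1 hc1) hθ.1 (hθ.2.le.trans (ang_le _)) h4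
    have := hmin v hv
    rw [h5] at this
    exact absurd hθ.2 (not_lt.2 this)
  rintro ⟨c, d⟩ hd
  by_cases hc : c = t
  · subst hc; exact h2 d hd
  by_cases hd' : d = t
  · subst hd'; rw [segment_symm]; exact h2 c (hH.symm hd)
  exact h1 _ (by simp [H', hd, hc, hd'])

theorem exists_sideVal (hH : IsPlaneGraph H) {z : ℂ × ℂ → ℝ}
    (hz : ∀ d, z d.swap = - z d) (hcons : ∀ F : ℂ → ℝ, ∑ d ∈ H, z d * F d.1 = 0) {s t : ℂ}
    (hst : (s, t) ∈ H) : ∃ v, ∀ a b : ℝ, 0 < a → b < 1 → ∃ δ > 0, ∀ l ∈ Set.Icc a b,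
      ∀ e ∈ Set.Ioo 0 δ, windSum H z (rightPt s t l e) = v := by
  have hconst : ∀ a b : ℝ, 0 < a → b < 1 → ∃ δ > 0, ∀ l ∈ Set.Icc a b, ∀ e ∈ Set.Ioo 0 δ,
      ∀ l' ∈ Set.Icc a b, ∀ e' ∈ Set.Ioo 0 δ,
      windSum H z (rightPt s t l e) = windSum H z (rightPt s t l' e') := by
    intro a b ha hb
    obtain ⟨δ, hδ, h⟩ := exists_rightPt_mem_freeSet hH hst ha hb
    refine ⟨δ, hδ, fun l hl e he l' hl' e' he' => ?_⟩
    refine windSum_eq_of_isPreconnected hH hz hcons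
      (S := (fun q : ℝ × ℝ => rightPt s t q.1 q.2) '' (Set.Icc a b ×ˢ Set.Ioo 0 δ)) ?_ ?_
      ⟨(l, e), ⟨hl, he⟩, rfl⟩ ⟨(l', e'), ⟨hl', he'⟩, rfl⟩
    · refine (isPreconnected_Icc.prod isPreconnected_Ioo).image _ ?_
      unfold rightPt
      fun_prop
    · rintro _ ⟨⟨l, e⟩, ⟨hl, he⟩, rfl⟩
      exact h l hl e he
  obtain ⟨δ₀, hδ₀, h₀⟩ := hconst (1 / 2) (1 / 2) (by norm_num) (by norm_num)
  refine ⟨windSum H z (rightPt s t (1 / 2) (δ₀ / 2)), fun a b ha hb => ?_⟩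
  obtain ⟨δ, hδ, h⟩ := hconst (min a (1 / 2)) (max b (1 / 2)) (by positivity)
    (max_lt hb (by norm_num))
  refine ⟨δ, hδ, fun l hl e he => ?_⟩
  have hm : 0 < min δ δ₀ := lt_min hδ hδ₀
  rw [h l ⟨min_le_of_left_le hl.1, le_max_of_le_left hl.2⟩ e he (1 / 2)
    ⟨min_le_right _ _, le_max_right _ _⟩ (min δ δ₀ / 2)
    ⟨by positivity, by linarith [min_le_left δ δ₀]⟩]
  exact h₀ _ ⟨le_rfl, le_rfl⟩ _ ⟨by positivity, by linarith [min_le_right δ δ₀]⟩ _ ⟨le_rfl, le_rfl⟩ _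
    ⟨by positivity, by linarith⟩

theorem sideVal_next (hH : IsPlaneGraph H) {z : ℂ × ℂ → ℝ}
    (hz : ∀ d, z d.swap = - z d) (hcons : ∀ F : ℂ → ℝ, ∑ d ∈ H, z d * F d.1 = 0) {s t : ℂ}
    (hst : (s, t) ∈ H) {v v' : ℝ}
    (hv : ∀ a b : ℝ, 0 < a → b < 1 → ∃ δ > 0, ∀ l ∈ Set.Icc a b,
      ∀ e ∈ Set.Ioo 0 δ, windSum H z (rightPt s t l e) = v)
    (hv' : ∀ a b : ℝ, 0 < a → b < 1 → ∃ δ > 0, ∀ l ∈ Set.Icc a b,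
      ∀ e ∈ Set.Ioo 0 δ, windSum H z (rightPt t (nextPt H t s) l e) = v') : v' = v := by
  obtain ⟨hu, -⟩ := IsPlaneGraph.nextPt_spec (hH.symm hst)
  obtain ⟨r, hr, hsec⟩ := exists_sector_mem_freeSet hH hst
  have hne : s - t ≠ 0 := sub_ne_zero.2 (hH.ne hst)
  set u := nextPt H t s
  have hne' : u - t ≠ 0 := hH.sub_ne hu
  set Θ := ang ((u - t) / (s - t)) with hΘ
  have hΘ0 : 0 < Θ := ang_pos _
  set k := ‖(u - t) / (s - t)‖ with hk
  have hk0 : 0 < k := norm_pos_iff.2 (div_ne_zero hne' hne)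
  have hk0' : (k : ℂ) ≠ 0 := by exact_mod_cast hk0.ne'
  have hu' : u - t = k * exp (Θ * Complex.I) * (s - t) := by
    rw [norm_mul_exp_ang_mul_I]; field_simp
  have hcosc : ∀ᶠ θ in 𝓝[>] (0 : ℝ), 1 / 2 < Real.cos θ := by
    refine eventually_nhdsWithin_of_eventually_nhds
      ((Real.continuous_cos.tendsto 0).eventually_const_lt (by rw [Real.cos_zero]; norm_num))
  have hsin : ∀ᶠ θ in 𝓝[>] (0 : ℝ), 0 < Real.sin θ := by
    filter_upwards [Ioo_mem_nhdsGT Real.pi_pos] with θ hθ using Real.sin_pos_of_pos_of_lt_pi hθ.1 hθ.2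
  have hsin' : ∀ c : ℝ, 0 < c → ∀ d : ℝ, 0 < d → ∀ᶠ θ in 𝓝[>] (0 : ℝ), c * Real.sin θ < d := by
    intro c hc d hd
    refine eventually_nhdsWithin_of_eventually_nhds
      (((Real.continuous_sin.const_mul c).tendsto 0).eventually_lt_const (by simpa using hd))
  have hΘe : ∀ᶠ θ in 𝓝[>] (0 : ℝ), θ ∈ Set.Ioo 0 Θ := Ioo_mem_nhdsGT hΘ0
  -- the starting point of the arc, near the incoming edge
  set ρ := min r 1 / 2 with hρ
  have hρ0 : 0 < ρ := by positivity
  have hρr : ρ < r := by linarith [min_le_left r 1]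
  have hρ1 : ρ ≤ 1 / 2 := by linarith [min_le_right r 1]
  obtain ⟨δ, hδ, h1⟩ := hv (1 / 2) (1 - ρ / 2) (by norm_num) (by linarith)
  obtain ⟨θ, hc, hs0, hs1, hθ⟩ := (hcosc.and (hsin.and ((hsin' ρ hρ0 δ hδ).and hΘe))).exists
  have e1 : rightPt s t (1 - ρ * Real.cos θ) (ρ * Real.sin θ) =
      t + ρ * exp (θ * Complex.I) * (s - t) := by
    rw [rightPt, exp_mul_I]; push_cast; ring
  have hw1 : windSum H z (t + ρ * exp (θ * Complex.I) * (s - t)) = v := by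
    rw [← e1]
    refine h1 _ ⟨?_, ?_⟩ _ ⟨by positivity, hs1⟩
    · nlinarith [Real.cos_le_one θ]
    · nlinarith
  -- the end point of the arc, near the outgoing edge
  set ρ' := min r k / 2 with hρ'
  have hρ'0 : 0 < ρ' := by positivity
  have hρ'r : ρ' < r := by linarith [min_le_left r k]
  have hρ'1 : ρ' / k ≤ 1 / 2 := by rw [div_le_iff₀ hk0]; linarith [min_le_right r k]
  have hρk : 0 < ρ' / k := by positivity
  obtain ⟨δ', hδ', h2⟩ := hv' (ρ' / k / 2) (1 / 2) (by positivity) (by norm_num)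
  obtain ⟨θ', hc', hs0', hs1', hθ'⟩ :=
    (hcosc.and (hsin.and ((hsin' (ρ' / k) hρk δ' hδ').and hΘe))).exists
  have e2 : rightPt t u (ρ' / k * Real.cos θ') (ρ' / k * Real.sin θ') =
      t + ρ' * exp ((Θ - θ' : ℝ) * Complex.I) * (s - t) := by
    have : exp ((Θ - θ' : ℝ) * Complex.I) =
        exp (Θ * Complex.I) * (Real.cos θ' - Real.sin θ' * Complex.I) := by
      push_cast
      rw [sub_mul, sub_eq_add_neg, exp_add, ← neg_mul, exp_mul_I (-(θ' : ℂ)), cos_neg, sin_neg]; ring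
    rw [rightPt, hu', this]
    push_cast
    field_simp
    ring
  have hw2 : windSum H z (t + ρ' * exp ((Θ - θ' : ℝ) * Complex.I) * (s - t)) = v' := by
    rw [← e2]
    refine h2 _ ⟨?_, ?_⟩ _ ⟨by positivity, hs1'⟩
    · nlinarith
    · nlinarith [Real.cos_le_one θ']
  rw [← hw1, ← hw2]
  refine windSum_eq_of_isPreconnected hH hz hcons
    (S := (fun q : ℝ × ℝ => t + q.1 * exp (q.2 * Complex.I) * (s - t)) ''
      (Set.Ioo 0 r ×ˢ Set.Ioo 0 Θ)) ?_ ?_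
    ⟨(ρ', Θ - θ'), ⟨⟨hρ'0, hρ'r⟩, ⟨by linarith [hθ'.2], by linarith [hθ'.1]⟩⟩, rfl⟩
    ⟨(ρ, θ), ⟨⟨hρ0, hρr⟩, hθ⟩, rfl⟩
  · exact (isPreconnected_Ioo.prod isPreconnected_Ioo).image _ (by fun_prop)
  · rintro _ ⟨⟨l, e⟩, ⟨hl, he⟩, rfl⟩
    exact hsec l hl e he

theorem tendsto_arg_jump :
    Tendsto (fun e : ℝ => arg ((1 / 2 + e * Complex.I) / (-1 / 2 + e * Complex.I)))
      (𝓝[>] 0) (𝓝 (-Real.pi)) ∧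
    Tendsto (fun e : ℝ => arg ((-1 / 2 + e * Complex.I) / (1 / 2 + e * Complex.I)))
      (𝓝[>] 0) (𝓝 Real.pi) := by
  constructor
  · have h := tendsto_arg_nhdsWithin_im_neg_of_re_neg_of_im_zero (z := -1) (by simp) (by simp)
    refine h.comp (tendsto_nhdsWithin_iff.2 ⟨?_, ?_⟩)
    · have : ContinuousAt (fun e : ℝ => (1 / 2 + e * Complex.I) / (-1 / 2 + e * Complex.I)) 0 := by
        fun_prop (disch := norm_num)
      have := this.tendsto
      have e0 : (1 / 2 + ((0 : ℝ) : ℂ) * Complex.I) / (-1 / 2 + ((0 : ℝ) : ℂ) * Complex.I) = -1 := by norm_num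
      rw [e0] at this
      exact this.mono_left nhdsWithin_le_nhds
    · filter_upwards [self_mem_nhdsWithin] with e he
      have he : 0 < e := he
      change ((1 / 2 + e * Complex.I) / (-1 / 2 + e * Complex.I)).im < 0
      have : (0:ℝ) < 1 / 4 + e * e := by positivity
      simp [div_im, normSq_apply]
      field_simp
      nlinarith
  · have h := (continuousWithinAt_arg_of_re_neg_of_im_zero (z := -1) (by simp) (by simp)).tendsto
    rw [arg_neg_one] at h
    refine h.comp (tendsto_nhdsWithin_iff.2 ⟨?_, ?_⟩)
    · have : ContinuousAt (fun e : ℝ => (-1 / 2 + e * Complex.I) / (1 / 2 + e * Complex.I)) 0 := by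
        fun_prop (disch := norm_num)
      have := this.tendsto
      have e0 : (-1 / 2 + ((0 : ℝ) : ℂ) * Complex.I) / (1 / 2 + ((0 : ℝ) : ℂ) * Complex.I) = -1 := by norm_num
      rw [e0] at this
      exact this.mono_left nhdsWithin_le_nhds
    · filter_upwards [self_mem_nhdsWithin] with e he
      have he : 0 < e := he
      change 0 ≤ ((-1 / 2 + e * Complex.I) / (1 / 2 + e * Complex.I)).im
      simp [div_im, normSq_apply]
      field_simp
      nlinarith

theorem sideVal_sub (hH : IsPlaneGraph H) {z : ℂ × ℂ → ℝ}
    (hz : ∀ d, z d.swap = - z d) {s t : ℂ} (hst : (s, t) ∈ H) {v v' : ℝ}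
    (hv : ∀ a b : ℝ, 0 < a → b < 1 → ∃ δ > 0, ∀ l ∈ Set.Icc a b,
      ∀ e ∈ Set.Ioo 0 δ, windSum H z (rightPt s t l e) = v)
    (hv' : ∀ a b : ℝ, 0 < a → b < 1 → ∃ δ > 0, ∀ l ∈ Set.Icc a b,
      ∀ e ∈ Set.Ioo 0 δ, windSum H z (rightPt t s l e) = v') :
    v - v' = - (4 * Real.pi) * z (s, t) := by
  classical
  have hne : t - s ≠ 0 := sub_ne_zero.2 (hH.ne hst).symm
  let D : ℂ × ℂ → ℝ := fun d => if d = (s, t) then -2 * Real.pi else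
    if d = (t, s) then 2 * Real.pi else 0
  let f : ℂ × ℂ → ℝ → ℝ := fun d e =>
    arg ((d.2 - rightPt s t (1 / 2) e) / (d.1 - rightPt s t (1 / 2) e)) -
      arg ((d.2 - rightPt t s (1 / 2) e) / (d.1 - rightPt t s (1 / 2) e))
  have a1 : ∀ e, t - rightPt s t (1 / 2) e = (1 / 2 + e * Complex.I) * (t - s) := by
    intro e; rw [rightPt]; push_cast; ring
  have a2 : ∀ e, s - rightPt s t (1 / 2) e = (-1 / 2 + e * Complex.I) * (t - s) := by
    intro e; rw [rightPt]; push_cast; ring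
  have a3 : ∀ e, t - rightPt t s (1 / 2) e = - (-1 / 2 + e * Complex.I) * (t - s) := by
    intro e; rw [rightPt]; push_cast; ring
  have a4 : ∀ e, s - rightPt t s (1 / 2) e = - (1 / 2 + e * Complex.I) * (t - s) := by
    intro e; rw [rightPt]; push_cast; ring
  have hf : ∀ d ∈ H, Tendsto (f d) (𝓝[>] 0) (𝓝 (D d)) := by
    intro d hd
    by_cases h1 : d = (s, t)
    · have : D d = -Real.pi - Real.pi := by simp only [D, if_pos h1]; ring
      rw [this]
      refine (tendsto_arg_jump.1.sub tendsto_arg_jump.2).congr fun e => ?_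
      simp only [f, h1, a1, a2, a3, a4]
      rw [mul_div_mul_right _ _ hne, mul_div_mul_right _ _ hne, neg_div_neg_eq]
    by_cases h2 : d = (t, s)
    · have : D d = Real.pi - -Real.pi := by simp only [D, if_neg h1, if_pos h2]; ring
      rw [this]
      refine (tendsto_arg_jump.2.sub tendsto_arg_jump.1).congr fun e => ?_
      simp only [f, h2, a1, a2, a3, a4]
      rw [mul_div_mul_right _ _ hne, mul_div_mul_right _ _ hne, neg_div_neg_eq]
    have hD : D d = 0 := by simp only [D, if_neg h1, if_neg h2]
    set m : ℂ := (s + t) / 2 with hm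
    have hmst : m ∈ segment ℝ s t := by
      rw [segment_eq_image']
      refine ⟨1 / 2, by norm_num, ?_⟩
      simp only [hm, real_smul]; push_cast; ring
    have hmd : m ∉ segment ℝ d.1 d.2 := by
      intro h
      rcases hH.inter hst (c := d.1) (d := d.2) hd hmst h with ⟨h, h'⟩ | ⟨h, h'⟩ | ⟨h | h, -⟩
      · exact h1 (Prod.ext h.symm h'.symm)
      · exact h2 (Prod.ext h'.symm h.symm)
      · apply hne; rw [hm] at h; linear_combination 2 * h
      · apply hne; rw [hm] at h; linear_combination (-2) * h
    have hc := continuousAt_arg_div hmd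
    have r1 : Tendsto (fun e : ℝ => rightPt s t (1 / 2) e) (𝓝[>] 0) (𝓝 m) := by
      have : Continuous (fun e : ℝ => rightPt s t (1 / 2) e) := by unfold rightPt; fun_prop
      have h := this.tendsto 0
      have e0 : rightPt s t (1 / 2) 0 = m := by rw [rightPt, hm]; push_cast; ring
      rw [e0] at h
      exact h.mono_left nhdsWithin_le_nhds
    have r2 : Tendsto (fun e : ℝ => rightPt t s (1 / 2) e) (𝓝[>] 0) (𝓝 m) := by
      have : Continuous (fun e : ℝ => rightPt t s (1 / 2) e) := by unfold rightPt; fun_prop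
      have h := this.tendsto 0
      have e0 : rightPt t s (1 / 2) 0 = m := by rw [rightPt, hm]; push_cast; ring
      rw [e0] at h
      exact h.mono_left nhdsWithin_le_nhds
    have := (hc.tendsto.comp r1).sub (hc.tendsto.comp r2)
    rw [sub_self] at this
    rw [hD]
    exact this
  have hlim : Tendsto (fun e : ℝ => windSum H z (rightPt s t (1 / 2) e) -
      windSum H z (rightPt t s (1 / 2) e)) (𝓝[>] 0) (𝓝 (∑ d ∈ H, z d * D d)) := by
    refine (tendsto_finsetSum H fun d hd => (hf d hd).const_mul (z d)).congr fun e => ?_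
    simp only [f, windSum, mul_sub, Finset.sum_sub_distrib]
  have hlim' : Tendsto (fun e : ℝ => windSum H z (rightPt s t (1 / 2) e) -
      windSum H z (rightPt t s (1 / 2) e)) (𝓝[>] 0) (𝓝 (v - v')) := by
    obtain ⟨δ, hδ, h⟩ := hv (1 / 2) (1 / 2) (by norm_num) (by norm_num)
    obtain ⟨δ', hδ', h'⟩ := hv' (1 / 2) (1 / 2) (by norm_num) (by norm_num)
    refine tendsto_const_nhds.congr' ?_
    filter_upwards [Ioo_mem_nhdsGT hδ, Ioo_mem_nhdsGT hδ'] with e he he'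
    rw [h _ ⟨le_rfl, le_rfl⟩ e he, h' _ ⟨le_rfl, le_rfl⟩ e he']
  rw [tendsto_nhds_unique hlim' hlim]
  have hst' := hH.symm hst
  have hne2 : (t, s) ≠ (s, t) := by
    intro h; exact hH.ne hst (Prod.ext_iff.1 h).2
  have hsum : ∑ d ∈ H, z d * D d = ∑ d ∈ ({(s, t), (t, s)} : Finset (ℂ × ℂ)), z d * D d := by
    refine (Finset.sum_subset ?_ ?_).symm
    · intro d hd
      rcases Finset.mem_insert.1 hd with rfl | hd
      · exact hst
      · rw [Finset.mem_singleton.1 hd]; exact hst'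
    · intro d _ hd
      simp only [Finset.mem_insert, Finset.mem_singleton, not_or] at hd
      simp [D, hd.1, hd.2]
  have hz' : z (t, s) = - z (s, t) := hz (s, t)
  rw [hsum, Finset.sum_pair hne2.symm]
  simp only [D, if_pos, if_neg hne2, hz']
  ring

/-- Every flow on a straight-line plane graph is a difference of potentials on the faces. -/
theorem exists_face_potential (hH : IsPlaneGraph H) {z : ℂ × ℂ → ℝ}
    (hz : ∀ d, z d.swap = - z d) (hcons : ∀ F : ℂ → ℝ, ∑ d ∈ H, z d * F d.1 = 0) :
    ∃ χ : ℂ → ℂ → ℝ, (∀ s t, (s, t) ∈ H → χ t (nextPt H t s) = χ s t) ∧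
      ∀ s t, (s, t) ∈ H → χ s t - χ t s = z (s, t) := by
  classical
  choose! v hv using fun (s t : ℂ) (h : (s, t) ∈ H) => exists_sideVal hH hz hcons h
  refine ⟨fun s t => - v s t / (4 * Real.pi), fun s t hst => ?_, fun s t hst => ?_⟩
  · have := sideVal_next hH hz hcons hst (hv s t hst) (hv _ _ (IsPlaneGraph.nextPt_spec (hH.symm hst)).1)
    simp only [this]
  · have := sideVal_sub hH hz hst (hv s t hst) (hv t s (hH.symm hst))
    rw [← sub_div, div_eq_iff (by positivity)]
    linarith

end PlaneGraphFaces

section Seg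

variable {α : Type*}

/-- `p` and `q` are consecutive entries of the list `l`. -/
def Seg (l : List α) (p q : α) : Prop := ∃ s t, l = s ++ p :: q :: t

/-- `p` and `q` are consecutive entries of the list `l`, in some order. -/
def USeg (l : List α) (p q : α) : Prop := Seg l p q ∨ Seg l q p

theorem not_seg_nil {p q : α} : ¬ Seg [] p q := by
  rintro ⟨s, t, h⟩; simp at h

theorem not_seg_singleton {x p q : α} : ¬ Seg [x] p q := by
  rintro ⟨s, t, h⟩
  have := congrArg List.length h
  simp at this; omega

theorem seg_cons_cons {x y p q : α} {l : List α} :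
    Seg (x :: y :: l) p q ↔ (p = x ∧ q = y) ∨ Seg (y :: l) p q := by
  constructor
  · rintro ⟨s, t, h⟩
    cases s with
    | nil => simp at h; exact Or.inl ⟨h.1.symm, h.2.1.symm⟩
    | cons a s => simp at h; exact Or.inr ⟨s, t, h.2⟩
  · rintro (⟨rfl, rfl⟩ | ⟨s, t, h⟩)
    · exact ⟨[], l, rfl⟩
    · exact ⟨x :: s, t, by rw [h]; rfl⟩

theorem seg_append {l₁ l₂ : List α} {x p q : α} :
    Seg (l₁ ++ x :: l₂) p q ↔ Seg (l₁ ++ [x]) p q ∨ Seg (x :: l₂) p q := by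
  induction l₁ with
  | nil => simp [not_seg_singleton]
  | cons a l ih =>
    cases l with
    | nil => simp [seg_cons_cons, not_seg_singleton]
    | cons b l =>
      simp only [List.cons_append, seg_cons_cons] at ih ⊢
      rw [ih, or_assoc]

theorem Seg.mono_append {l l₁ l₂ : List α} {p q : α} (h : Seg l p q) : Seg (l₁ ++ l ++ l₂) p q := by
  obtain ⟨s, t, rfl⟩ := h
  exact ⟨l₁ ++ s, t ++ l₂, by simp⟩

theorem Seg.of_infix {l m : List α} {p q : α} (h : Seg l p q) (hl : l <:+: m) : Seg m p q := by
  obtain ⟨a, b, rfl⟩ := hl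
  exact h.mono_append

theorem Seg.reverse {l : List α} {p q : α} (h : Seg l p q) : Seg l.reverse q p := by
  obtain ⟨s, t, rfl⟩ := h
  exact ⟨t.reverse, s.reverse, by simp⟩

theorem seg_reverse {l : List α} {p q : α} : Seg l.reverse p q ↔ Seg l q p :=
  ⟨fun h => by simpa using h.reverse, Seg.reverse⟩

theorem useg_reverse {l : List α} {p q : α} : USeg l.reverse p q ↔ USeg l p q := by
  simp only [USeg, seg_reverse]; exact or_comm

theorem USeg.symm {l : List α} {p q : α} (h : USeg l p q) : USeg l q p := Or.symm h

theorem Seg.left_mem {l : List α} {p q : α} (h : Seg l p q) : p ∈ l := by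
  obtain ⟨s, t, rfl⟩ := h; simp

theorem Seg.right_mem {l : List α} {p q : α} (h : Seg l p q) : q ∈ l := by
  obtain ⟨s, t, rfl⟩ := h; simp

theorem USeg.left_mem {l : List α} {p q : α} (h : USeg l p q) : p ∈ l :=
  h.elim Seg.left_mem Seg.right_mem

theorem USeg.right_mem {l : List α} {p q : α} (h : USeg l p q) : q ∈ l := h.symm.left_mem

theorem useg_append {l₁ l₂ : List α} {x p q : α} :
    USeg (l₁ ++ x :: l₂) p q ↔ USeg (l₁ ++ [x]) p q ∨ USeg (x :: l₂) p q := by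
  simp only [USeg, seg_append (x := x) (l₁ := l₁) (l₂ := l₂)]; tauto

theorem useg_cons_cons {x y p q : α} {l : List α} :
    USeg (x :: y :: l) p q ↔ (p = x ∧ q = y) ∨ (p = y ∧ q = x) ∨ USeg (y :: l) p q := by
  simp only [USeg, seg_cons_cons]; tauto

theorem List.Nodup.append_cons_inj {l₁ l₂ m₁ m₂ : List α} {x : α} (h : (l₁ ++ x :: l₂).Nodup)
    (he : l₁ ++ x :: l₂ = m₁ ++ x :: m₂) : l₁ = m₁ ∧ l₂ = m₂ := by
  induction l₁ generalizing m₁ with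
  | nil =>
    cases m₁ with
    | nil => simpa using he
    | cons a m =>
      simp only [List.nil_append, List.cons_append, List.cons.injEq] at he
      rw [List.nil_append, List.nodup_cons, he.2] at h
      simp at h
  | cons b l ih =>
    cases m₁ with
    | nil =>
      simp only [List.nil_append, List.cons_append, List.cons.injEq] at he
      rw [he.1, List.cons_append, List.nodup_cons] at h
      simp at h
    | cons a m =>
      simp only [List.cons_append, List.cons.injEq] at he
      rw [List.cons_append, List.nodup_cons] at h
      obtain ⟨h1, h2⟩ := ih h.2 he.2
      exact ⟨by rw [he.1, h1], h2⟩

theorem Seg.ne {l : List α} (hl : l.Nodup) {p q : α} (h : Seg l p q) : p ≠ q := by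
  obtain ⟨s, t, rfl⟩ := h
  rintro rfl
  rw [List.nodup_append] at hl
  simpa using hl.2.1

theorem USeg.ne {l : List α} (hl : l.Nodup) {p q : α} (h : USeg l p q) : p ≠ q :=
  h.elim (Seg.ne hl) fun h => (Seg.ne hl h).symm

theorem Seg.right_unique {l : List α} (hl : l.Nodup) {p q q' : α} (h : Seg l p q)
    (h' : Seg l p q') : q = q' := by
  obtain ⟨s, t, rfl⟩ := h
  obtain ⟨s', t', h'⟩ := h'
  have := (hl.append_cons_inj h').2
  simp at this
  exact this.1

theorem Seg.left_unique {l : List α} (hl : l.Nodup) {p p' q : α} (h : Seg l p q)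
    (h' : Seg l p' q) : p = p' :=
  Seg.right_unique (List.nodup_reverse.2 hl) h.reverse h'.reverse

theorem Seg.not_symm {l : List α} (hl : l.Nodup) {p q : α} (h : Seg l p q) : ¬ Seg l q p := by
  intro h'
  obtain ⟨s, t, rfl⟩ := h
  obtain ⟨s', t', h'⟩ := h'
  have h1 : s ++ p :: q :: t = (s' ++ [q]) ++ p :: t' := by simpa using h'
  have h2 := (hl.append_cons_inj h1).1
  subst h2
  rw [List.nodup_append] at hl
  simpa using hl.2.2 q

/-- The neighbours of an inner entry of a list without repetition. -/
theorem useg_iff_of_nodup {l₁ l₂ : List α} {a p c w : α} (hl : (l₁ ++ a :: p :: c :: l₂).Nodup) :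
    USeg (l₁ ++ a :: p :: c :: l₂) p w ↔ w = a ∨ w = c := by
  have h1 : Seg (l₁ ++ a :: p :: c :: l₂) a p := ⟨l₁, _, rfl⟩
  have h2 : Seg (l₁ ++ a :: p :: c :: l₂) p c := ⟨l₁ ++ [a], l₂, by simp⟩
  constructor
  · rintro (h | h)
    · exact Or.inr (Seg.right_unique hl h h2)
    · exact Or.inl (Seg.left_unique hl h h1)
  · rintro (rfl | rfl)
    · exact Or.inr h1
    · exact Or.inl h2

end Seg

section PLDrawing

variable {V E : Type*}

/-- A polygonal drawing of the edges `E` with end vertices `ends` in which every crossing is a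
common bend point of the two crossing edges. -/
structure PLDrawing (ends : E → Sym2 V) where
  pos : V → ℂ
  pos_inj : Function.Injective pos
  L : E → List ℂ
  shape : ∀ e, ∃ u v l, ends e = s(u, v) ∧ L e = pos u :: (l ++ [pos v]) ∧ ∀ w, pos w ∉ l
  nodup : ∀ e, (L e).Nodup
  inter : ∀ {e f p q p' q' z}, USeg (L e) p q → USeg (L f) p' q' → z ∈ segment ℝ p q →
    z ∈ segment ℝ p' q' → (p = p' ∧ q = q') ∨ (p = q' ∧ q = p') ∨
      ((z = p ∨ z = q) ∧ (z = p' ∨ z = q'))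
  sep : ∀ {e f p q}, USeg (L e) p q → USeg (L f) p q → e = f
  vert : ∀ {e p q w}, USeg (L e) p q → pos w ∈ segment ℝ p q → pos w = p ∨ pos w = q
  triple : ∀ {e f g z}, z ∉ Set.range pos → z ∈ L e → z ∈ L f → z ∈ L g → e = f ∨ e = g ∨ f = g

namespace PLDrawing

variable {ends : E → Sym2 V} (D : PLDrawing ends)

/-- The crossing points of a polygonal drawing. -/
def Cross (z : ℂ) : Prop := z ∉ Set.range D.pos ∧ ∃ e f, e ≠ f ∧ z ∈ D.L e ∧ z ∈ D.L f

/-- The number of crossings. -/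
noncomputable def cr : ℕ := {z | D.Cross z}.ncard

/-- Every edge has at most three crossings. -/
def Plane3 : Prop := ∀ e, open Classical in (D.L e).countP (fun z => D.Cross z) ≤ 3

/-- The drawing minimises the number of crossings among those with at most three crossings per
edge. -/
def IsMin : Prop := D.Plane3 ∧ ∀ D' : PLDrawing ends, D'.Plane3 → D.cr ≤ D'.cr

/-- `l` lists the bend points of the edge `e`, in one of the two directions. -/
def Or (e : E) (l : List ℂ) : Prop := l = D.L e ∨ l = (D.L e).reverse

variable {D}

theorem Or.reverse {e : E} {l : List ℂ} (h : D.Or e l) : D.Or e l.reverse := by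
  rcases h with rfl | rfl
  · exact Or.inr rfl
  · exact Or.inl (List.reverse_reverse _)

theorem Or.nodup {e : E} {l : List ℂ} (h : D.Or e l) : l.Nodup := by
  rcases h with rfl | rfl
  · exact D.nodup e
  · exact List.nodup_reverse.2 (D.nodup e)

theorem Or.mem {e : E} {l : List ℂ} (h : D.Or e l) {z : ℂ} : z ∈ l ↔ z ∈ D.L e := by
  rcases h with rfl | rfl
  · rfl
  · simp

theorem Or.useg {e : E} {l : List ℂ} (h : D.Or e l) {p q : ℂ} : USeg l p q ↔ USeg (D.L e) p q := by
  rcases h with rfl | rfl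
  · rfl
  · exact useg_reverse

theorem Or.countP {e : E} {l : List ℂ} (h : D.Or e l) (P : ℂ → Bool) :
    l.countP P = (D.L e).countP P := by
  rcases h with rfl | rfl
  · rfl
  · exact List.countP_reverse

theorem Or.shape {e : E} {l : List ℂ} (h : D.Or e l) :
    ∃ u v k, ends e = s(u, v) ∧ l = D.pos u :: (k ++ [D.pos v]) ∧ ∀ w, D.pos w ∉ k := by
  obtain ⟨u, v, k, he, hl, hk⟩ := D.shape e
  rcases h with rfl | rfl
  · exact ⟨u, v, k, he, hl, hk⟩
  · exact ⟨v, u, k.reverse, by rw [he, Sym2.eq_swap], by simp [hl], by simpa using hk⟩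

/-- The two orientations of an edge are distinguished by any pair of consecutive points. -/
theorem Or.eq_of_seg {e f : E} {l m : List ℂ} (hl : D.Or e l) (hm : D.Or f m) {p q : ℂ}
    (h : Seg l p q) (h' : Seg m p q) : e = f ∧ l = m := by
  have hef : e = f := D.sep (hl.useg.1 (.inl h)) (hm.useg.1 (.inl h'))
  subst hef
  refine ⟨rfl, ?_⟩
  have key : ∀ {k : List ℂ}, D.Or e k → Seg k p q → Seg k.reverse p q → False := by
    intro k hk h1 h2
    exact h1.not_symm hk.nodup (seg_reverse.1 h2)
  rcases hl with rfl | rfl <;> rcases hm with rfl | rfl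
  · rfl
  · exact (key (.inl rfl) h h').elim
  · exact (key (.inl rfl) h' h).elim
  · rfl

theorem exists_or {e : E} {p q : ℂ} (h : USeg (D.L e) p q) : ∃ l, D.Or e l ∧ Seg l p q := by
  rcases h with h | h
  · exact ⟨_, .inl rfl, h⟩
  · exact ⟨_, .inr rfl, h.reverse⟩

/-- Splitting an oriented edge into three parts with nonempty outer parts. -/
theorem Or.shape_split {e : E} {A M B : List ℂ} (h : D.Or e (A ++ M ++ B)) (hA : A ≠ [])
    (hB : B ≠ []) : ∃ u v A' B', ends e = s(u, v) ∧ A = D.pos u :: A' ∧ B = B' ++ [D.pos v] ∧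
      ∀ w, D.pos w ∉ A' ++ M ++ B' := by
  obtain ⟨u, v, k, he, hl, hk⟩ := h.shape
  obtain ⟨x, A', rfl⟩ := List.exists_cons_of_ne_nil hA
  obtain ⟨B', y, rfl⟩ := List.eq_nil_or_concat B |>.resolve_left hB
  simp only [List.cons_append, List.cons.injEq, List.concat_eq_append] at hl
  obtain ⟨rfl, hl⟩ := hl
  rw [← List.append_assoc] at hl
  obtain ⟨h1, h2⟩ := List.append_inj' hl rfl
  refine ⟨u, v, A', B', he, rfl, by simpa using h2, ?_⟩
  rw [h1]; exact hk

/-- An inner point of an edge which is not a vertex has two neighbours on the edge. -/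
theorem Or.exists_split {e : E} {l : List ℂ} (h : D.Or e l) {p : ℂ} (hp : p ∈ l)
    (hr : p ∉ Set.range D.pos) : ∃ l₁ a c l₂, l = l₁ ++ a :: p :: c :: l₂ := by
  obtain ⟨u, v, k, he, hl, hk⟩ := h.shape
  have hpk : p ∈ k := by
    rw [hl] at hp
    simp only [List.mem_cons, List.mem_append, List.not_mem_nil, or_false] at hp
    rcases hp with rfl | hp | rfl
    · exact absurd ⟨u, rfl⟩ hr
    · exact hp
    · exact absurd ⟨v, rfl⟩ hr
  obtain ⟨s, t, rfl⟩ := List.append_of_mem hpk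
  obtain ⟨l₁, a, h1⟩ := (List.eq_nil_or_concat (D.pos u :: s)).resolve_left (by simp)
  obtain ⟨c, l₂, h2⟩ := List.exists_cons_of_ne_nil (l := t ++ [D.pos v]) (by simp)
  refine ⟨l₁, a, c, l₂, ?_⟩
  have : l = (D.pos u :: s) ++ p :: (t ++ [D.pos v]) := by rw [hl]; simp
  rw [this, h1, h2]; simp

theorem exists_useg {e : E} {p : ℂ} (hp : p ∈ D.L e) : ∃ q, USeg (D.L e) p q := by
  obtain ⟨s, t, h⟩ := List.append_of_mem hp
  rcases t with _ | ⟨q, t⟩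
  · rcases List.eq_nil_or_concat s with rfl | ⟨s, q, rfl⟩
    · obtain ⟨u, v, k, -, hl, -⟩ := D.shape e
      rw [h] at hl
      have := congrArg List.length hl
      simp at this
    · exact ⟨q, .inr ⟨s, [], by simpa using h⟩⟩
  · exact ⟨q, .inl ⟨s, t, h⟩⟩

theorem cross_of_mem {e f : E} {z : ℂ} (hr : z ∉ Set.range D.pos) (hef : e ≠ f) (he : z ∈ D.L e)
    (hf : z ∈ D.L f) : D.Cross z := ⟨hr, e, f, hef, he, hf⟩

theorem eq_of_mem_segment {e : E} {a p : ℂ} (h : USeg (D.L e) a p) {z : ℂ} (hz : z ∈ segment ℝ a p)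
    {g : E} (hg : z ∈ D.L g) : z = a ∨ z = p := by
  obtain ⟨w, hw⟩ := exists_useg hg
  rcases D.inter h hw hz (left_mem_segment ℝ z w) with ⟨h, -⟩ | ⟨-, h⟩ | ⟨h, -⟩
  · exact .inl h.symm
  · exact .inr h.symm
  · exact h

variable (D)

/-- The segments of a polygonal drawing. -/
noncomputable def H [Fintype E] : Finset (ℂ × ℂ) :=
  open Classical in
  (Finset.univ.biUnion fun e => (D.L e).toFinset ×ˢ (D.L e).toFinset).filter
    fun d => ∃ e, USeg (D.L e) d.1 d.2

theorem mem_H [Fintype E] {p q : ℂ} : (p, q) ∈ D.H ↔ ∃ e, USeg (D.L e) p q := by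
  classical
  simp only [H, Finset.mem_filter, Finset.mem_biUnion, Finset.mem_univ, true_and,
    Finset.mem_product, List.mem_toFinset, and_iff_right_iff_imp]
  rintro ⟨e, he⟩
  exact ⟨e, he.left_mem, he.right_mem⟩

theorem isPlaneGraph [Fintype E] : IsPlaneGraph D.H where
  symm := by
    intro a b h
    obtain ⟨e, he⟩ := D.mem_H.1 h
    exact D.mem_H.2 ⟨e, he.symm⟩
  ne := by
    intro a b h
    obtain ⟨e, he⟩ := D.mem_H.1 h
    exact he.ne (D.nodup e)
  inter := by
    intro a b c d z h h' hz hz'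
    obtain ⟨e, he⟩ := D.mem_H.1 h
    obtain ⟨f, hf⟩ := D.mem_H.1 h'
    exact D.inter he hf hz hz'

theorem finite_cross [Finite E] : {z | D.Cross z}.Finite := by
  refine (Set.finite_iUnion fun e => (D.L e).finite_toSet).subset ?_
  rintro z ⟨-, e, f, -, he, -⟩
  exact Set.mem_iUnion.2 ⟨e, he⟩

end PLDrawing

end PLDrawing

section Uncross

namespace PLDrawing

variable {V E : Type*} {ends : E → Sym2 V} {D : PLDrawing ends}

/-- Points `a'`, `c'` near `p` on the segments `ap` and `cp` whose chord avoids the rest of the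
drawing. -/
theorem exists_chord [Fintype E] [Finite V] {e : E} {a p c : ℂ} (ha : USeg (D.L e) a p)
    (hc : USeg (D.L e) c p) (hp : p ∉ Set.range D.pos)
    (hind : ∀ x y : ℝ, x * (a - p) + y * (c - p) = 0 → x = 0 ∧ y = 0)
    (hcone : ∀ w, (p, w) ∈ D.H → w ≠ a → w ≠ c → ∀ x y r : ℝ, 0 ≤ x → 0 ≤ y → 0 < x + y → 0 ≤ r →
      x * (a - p) + y * (c - p) ≠ r * (w - p)) :
    ∃ a' c', a' ≠ c' ∧
      (a' ∈ segment ℝ a p ∧ a' ≠ a ∧ a' ≠ p ∧ p ∉ segment ℝ a a') ∧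
      (c' ∈ segment ℝ c p ∧ c' ≠ c ∧ c' ≠ p ∧ p ∉ segment ℝ c c') ∧
      (∀ g x y z, USeg (D.L g) x y → z ∈ segment ℝ a' c' → z ∈ segment ℝ x y →
        (((x = a ∧ y = p) ∨ (x = p ∧ y = a)) ∧ z = a') ∨
        (((x = c ∧ y = p) ∨ (x = p ∧ y = c)) ∧ z = c')) ∧
      ∀ w, D.pos w ∉ segment ℝ a' c' := by
  classical
  let H' := D.H.filter fun d => d.1 ≠ p ∧ d.2 ≠ p
  have hp' : p ∈ freeSet H' := by
    rintro ⟨x, y⟩ hd hmem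
    simp only [H', Finset.mem_filter, mem_H] at hd
    obtain ⟨⟨g, hg⟩, hd1, hd2⟩ := hd
    rcases eq_of_mem_segment hg hmem ha.right_mem with h | h
    · exact hd1 h.symm
    · exact hd2 h.symm
  have hopen : IsOpen (freeSet H' ∩ (Set.range D.pos)ᶜ) :=
    (isOpen_freeSet H').inter (Set.finite_range D.pos).isClosed.isOpen_compl
  obtain ⟨r, hr, hball⟩ := Metric.isOpen_iff.1 hopen p ⟨hp', hp⟩
  set S := ‖a - p‖ + ‖c - p‖ + 1 with hS
  have hS0 : 0 < S := by positivity
  set ε := min (1 / 2) (r / (2 * S)) with hε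
  have hε0 : 0 < ε := by positivity
  have hε1 : ε ≤ 1 / 2 := min_le_left _ _
  have hεr : ε * S < r := by
    have : ε ≤ r / (2 * S) := min_le_right _ _
    calc ε * S ≤ r / (2 * S) * S := by gcongr
      _ = r / 2 := by field_simp
      _ < r := by linarith
  have hε0' : (ε : ℂ) ≠ 0 := by exact_mod_cast hε0.ne'
  have hchord : ∀ z ∈ segment ℝ (p + ε * (a - p)) (p + ε * (c - p)), ∃ x y : ℝ, 0 ≤ x ∧ 0 ≤ y ∧
      x + y = ε ∧ z = p + x * (a - p) + y * (c - p) := by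
    rintro z ⟨s, t, hs, ht, hst, rfl⟩
    refine ⟨ε * s, ε * t, by positivity, by positivity, by rw [← mul_add, hst, mul_one], ?_⟩
    simp only [Complex.real_smul]
    have : (s : ℂ) + t = 1 := by exact_mod_cast hst
    push_cast
    linear_combination p * this
  have hchball : ∀ z ∈ segment ℝ (p + ε * (a - p)) (p + ε * (c - p)), z ∈ Metric.ball p r := by
    intro z hz
    obtain ⟨x, y, hx, hy, hxy, rfl⟩ := hchord z hz
    rw [Metric.mem_ball, dist_eq_norm]
    calc ‖p + x * (a - p) + y * (c - p) - p‖ = ‖x * (a - p) + y * (c - p)‖ := by congr 1; ring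
      _ ≤ ‖(x : ℂ) * (a - p)‖ + ‖(y : ℂ) * (c - p)‖ := norm_add_le _ _
      _ = x * ‖a - p‖ + y * ‖c - p‖ := by
        rw [norm_mul, norm_mul, Complex.norm_real, Complex.norm_real, Real.norm_of_nonneg hx,
          Real.norm_of_nonneg hy]
      _ ≤ ε * ‖a - p‖ + ε * ‖c - p‖ := by gcongr <;> linarith
      _ ≤ ε * S := by rw [hS]; nlinarith
      _ < r := hεr
  have hside : ∀ {b : ℂ}, b ≠ p → p + ε * (b - p) ∈ segment ℝ b p ∧ p + ε * (b - p) ≠ b ∧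
      p + ε * (b - p) ≠ p ∧ p ∉ segment ℝ b (p + ε * (b - p)) := by
    intro b hb
    have hb' := sub_ne_zero.2 hb
    refine ⟨?_, ?_, ?_, ?_⟩
    · refine ⟨ε, 1 - ε, hε0.le, by linarith, by ring, ?_⟩
      simp only [Complex.real_smul]; push_cast; ring
    · intro h
      have : ((1 - ε : ℝ) : ℂ) * (b - p) = 0 := by push_cast; linear_combination -h
      rcases mul_eq_zero.1 this with h | h
      · have : 1 - ε = 0 := by exact_mod_cast h
        linarith
      · exact hb' h
    · intro h
      have : (ε : ℂ) * (b - p) = 0 := by linear_combination h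
      exact (mul_ne_zero hε0' hb') this
    · rintro ⟨s, t, hs, ht, hst, h⟩
      simp only [Complex.real_smul] at h
      have h1 : (s : ℂ) + t = 1 := by exact_mod_cast hst
      have : ((s + t * ε : ℝ) : ℂ) * (b - p) = 0 := by push_cast; linear_combination h - p * h1
      rcases mul_eq_zero.1 this with h | h
      · have : s + t * ε = 0 := by exact_mod_cast h
        have : 0 < s + t * ε := by
          rcases hs.lt_or_eq with h | h
          · positivity
          · rw [← h, show t = 1 by linarith]; linarith
        linarith
      · exact hb' h
  have hap : a ≠ p := ha.ne (D.nodup e)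
  have hcp : c ≠ p := hc.ne (D.nodup e)
  have hac : a ≠ c := by
    rintro rfl
    have := (hind 1 (-1) (by push_cast; ring)).1
    norm_num at this
  refine ⟨p + ε * (a - p), p + ε * (c - p), ?_, hside hap, hside hcp, ?_, ?_⟩
  · intro h
    have := (hind ε (-ε) (by push_cast; linear_combination h)).1
    exact hε0.ne' this
  · intro g x y z hg hz hz'
    have hz1 := hball (hchball z hz)
    obtain ⟨s, t, hs, ht, hst, rfl⟩ := hchord z hz
    have key : ∀ w, (p, w) ∈ D.H → p + s * (a - p) + t * (c - p) ∈ segment ℝ p w →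
        (w = a ∧ p + s * (a - p) + t * (c - p) = p + ε * (a - p)) ∨
        (w = c ∧ p + s * (a - p) + t * (c - p) = p + ε * (c - p)) := by
      intro w hw hmem
      rw [segment_eq_image'] at hmem
      obtain ⟨k, hk, hk'⟩ := hmem
      simp only [Complex.real_smul] at hk'
      by_cases hwa : w = a
      · subst hwa
        have := (hind (s - k) t (by push_cast; linear_combination -hk')).2
        have hsε : s = ε := by linarith
        exact .inl ⟨rfl, by rw [this, hsε]; push_cast; ring⟩
      by_cases hwc : w = c
      · subst hwc
        have := (hind s (t - k) (by push_cast; linear_combination -hk')).1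
        have hsε : t = ε := by linarith
        exact .inr ⟨rfl, by rw [this, hsε]; push_cast; ring⟩
      · exact absurd (by linear_combination -hk')
          (hcone w hw hwa hwc s t k hs ht (by linarith) hk.1)
    by_cases hxp : x = p
    · subst hxp
      rcases key y (D.mem_H.2 ⟨g, hg⟩) hz' with ⟨h, h'⟩ | ⟨h, h'⟩
      · exact .inl ⟨.inr ⟨rfl, h⟩, h'⟩
      · exact .inr ⟨.inr ⟨rfl, h⟩, h'⟩
    by_cases hyp : y = p
    · subst hyp
      rw [segment_symm] at hz'
      rcases key x (D.mem_H.2 ⟨g, hg.symm⟩) hz' with ⟨h, h'⟩ | ⟨h, h'⟩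
      · exact .inl ⟨.inl ⟨h, rfl⟩, h'⟩
      · exact .inr ⟨.inl ⟨h, rfl⟩, h'⟩
    · exact absurd hz' (hz1.1 (x, y) (by simp [H', mem_H, hxp, hyp]; exact ⟨g, hg⟩))
  · intro w hw
    exact (hball (hchball _ hw)).2 ⟨w, rfl⟩

end PLDrawing

end Uncross

section Uncross

/-- Two segments only meet in common end points, unless they are equal. -/
def MeetAtEnds (x y x' y' : ℂ) : Prop := ∀ z, z ∈ segment ℝ x y → z ∈ segment ℝ x' y' →
  (x = x' ∧ y = y') ∨ (x = y' ∧ y = x') ∨ ((z = x ∨ z = y) ∧ (z = x' ∨ z = y'))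

theorem MeetAtEnds.symm {x y x' y' : ℂ} (h : MeetAtEnds x y x' y') : MeetAtEnds x' y' x y := by
  intro z h1 h2
  rcases h z h2 h1 with ⟨rfl, rfl⟩ | ⟨rfl, rfl⟩ | ⟨h3, h4⟩
  · exact .inl ⟨rfl, rfl⟩
  · exact .inr (.inl ⟨rfl, rfl⟩)
  · exact .inr (.inr ⟨h4, h3⟩)

theorem MeetAtEnds.swap {x y x' y' : ℂ} (h : MeetAtEnds x y x' y') : MeetAtEnds y x x' y' := by
  intro z h1 h2
  rcases h z (segment_symm ℝ y x ▸ h1) h2 with ⟨rfl, rfl⟩ | ⟨rfl, rfl⟩ | ⟨h3, h4⟩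
  · exact .inr (.inl ⟨rfl, rfl⟩)
  · exact .inl ⟨rfl, rfl⟩
  · exact .inr (.inr ⟨h3.symm, h4⟩)

theorem meetAtEnds_self (x y : ℂ) : MeetAtEnds x y x y := fun _ _ _ => .inl ⟨rfl, rfl⟩

namespace PLDrawing

variable {V E : Type*} {ends : E → Sym2 V} {D : PLDrawing ends}

theorem meetAtEnds {e f : E} {x y x' y' : ℂ} (h : USeg (D.L e) x y) (h' : USeg (D.L f) x' y') :
    MeetAtEnds x y x' y' := fun _ h1 h2 => D.inter h h' h1 h2

set_option maxHeartbeats 1600000 in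
/-- Cutting off a bend at which an edge turns without being separated by the other edge removes
a crossing. -/
theorem exists_uncross [Fintype E] [Finite V] (hD : D.Plane3) {e : E} {a p c : ℂ}
    {l₁ l₂ : List ℂ} (hl : D.Or e (l₁ ++ a :: p :: c :: l₂)) (hp : D.Cross p)
    (hind : ∀ x y : ℝ, x * (a - p) + y * (c - p) = 0 → x = 0 ∧ y = 0)
    (hcone : ∀ w, (p, w) ∈ D.H → w ≠ a → w ≠ c → ∀ x y r : ℝ, 0 ≤ x → 0 ≤ y → 0 < x + y → 0 ≤ r →
      x * (a - p) + y * (c - p) ≠ r * (w - p)) :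
    ∃ D' : PLDrawing ends, D'.Plane3 ∧ D'.cr < D.cr := by
  classical
  have hn := hl.nodup
  have hn1 : p ∉ l₁ ++ [a] ∧ p ∉ c :: l₂ ∧ a ≠ p ∧ c ≠ p ∧ a ≠ c := by
    have := hn
    simp only [List.nodup_append, List.nodup_cons, List.mem_cons, List.mem_append] at this ⊢
    grind
  obtain ⟨hpA, hpB, hap, hcp, hac⟩ := hn1
  have hsegs : ∀ x y, USeg (D.L e) x y ↔ USeg (l₁ ++ [a]) x y ∨ (x = a ∧ y = p) ∨
      (x = p ∧ y = a) ∨ (x = p ∧ y = c) ∨ (x = c ∧ y = p) ∨ USeg (c :: l₂) x y := by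
    intro x y
    rw [← hl.useg, useg_append, useg_cons_cons, useg_cons_cons]
  have ha : USeg (D.L e) a p := by rw [hsegs]; grind
  have hc : USeg (D.L e) c p := by rw [hsegs]; grind
  obtain ⟨a', c', hac', ⟨ha1, ha2, ha3, ha4⟩, ⟨hc1, hc2, hc3, hc4⟩, hch, hchw⟩ :=
    exists_chord ha hc hp.1 hind hcone
  have ha' : ∀ g, a' ∉ D.L g := fun g hg => (eq_of_mem_segment ha ha1 hg).elim ha2 ha3
  have hc' : ∀ g, c' ∉ D.L g := fun g hg => (eq_of_mem_segment hc hc1 hg).elim hc2 hc3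
  have haa : ∀ z, z ∈ segment ℝ a a' → z ∈ segment ℝ a p := fun z hz =>
    (convex_segment (𝕜 := ℝ) a p).segment_subset (left_mem_segment ..) ha1 hz
  have hcc : ∀ z, z ∈ segment ℝ c c' → z ∈ segment ℝ c p := fun z hz =>
    (convex_segment (𝕜 := ℝ) c p).segment_subset (left_mem_segment ..) hc1 hz
  set lN := l₁ ++ a :: a' :: c' :: c :: l₂ with hlN
  set L' := Function.update D.L e lN with hL'
  have hL'e : L' e = lN := by simp [hL']
  have hL'g : ∀ {g}, g ≠ e → L' g = D.L g := fun h => by simp [hL', h]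
  have hmemN : ∀ z, z ∈ lN ↔ (z ∈ D.L e ∧ z ≠ p) ∨ z = a' ∨ z = c' := by
    intro z
    rw [← hl.mem, hlN]
    simp only [List.mem_append, List.mem_cons, List.not_mem_nil, or_false] at hpA hpB ⊢
    grind
  have hmem' : ∀ g z, z ∈ L' g → z ∈ D.L g ∨ (g = e ∧ (z = a' ∨ z = c')) := by
    intro g z hz
    by_cases hg : g = e
    · subst hg
      rw [hL'e, hmemN] at hz
      grind
    · rw [hL'g hg] at hz
      exact .inl hz
  -- old and new segments
  let Old : E → ℂ → ℂ → Prop := fun g x y => USeg (D.L g) x y ∧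
    ¬ ((x = a ∧ y = p) ∨ (x = p ∧ y = a) ∨ (x = p ∧ y = c) ∨ (x = c ∧ y = p))
  let N : ℂ → ℂ → Prop := fun x y => (x = a ∧ y = a') ∨ (x = a' ∧ y = c') ∨ (x = c' ∧ y = c)
  have hseg : ∀ g x y, USeg (L' g) x y → Old g x y ∨ (g = e ∧ (N x y ∨ N y x)) := by
    intro g x y h
    by_cases hg : g = e
    · subst hg
      rw [hL'e, hlN, useg_append, useg_cons_cons, useg_cons_cons, useg_cons_cons] at h
      have hA : USeg (l₁ ++ [a]) x y → Old g x y := fun h => by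
        refine ⟨(hsegs x y).2 (.inl h), ?_⟩
        have h1 : x ≠ p := fun hh => hpA (hh ▸ h.left_mem)
        have h2 : y ≠ p := fun hh => hpA (hh ▸ h.right_mem)
        grind
      have hB : USeg (c :: l₂) x y → Old g x y := fun h => by
        refine ⟨(hsegs x y).2 (by grind), ?_⟩
        have h1 : x ≠ p := fun hh => hpB (hh ▸ h.left_mem)
        have h2 : y ≠ p := fun hh => hpB (hh ▸ h.right_mem)
        grind
      simp only [N]
      grind
    · rw [hL'g hg] at h
      refine .inl ⟨h, ?_⟩
      rintro (⟨rfl, rfl⟩ | ⟨rfl, rfl⟩ | ⟨rfl, rfl⟩ | ⟨rfl, rfl⟩)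
      · exact hg (D.sep h ha)
      · exact hg (D.sep h ha.symm)
      · exact hg (D.sep h hc.symm)
      · exact hg (D.sep h hc)
  have oldN : ∀ {g x y x' y'}, Old g x y → N x' y' → MeetAtEnds x y x' y' := by
    rintro g x y x' y' ⟨h, hx⟩ (⟨rfl, rfl⟩ | ⟨rfl, rfl⟩ | ⟨rfl, rfl⟩) z hz hz'
    · rcases D.inter h ha hz (haa z hz') with h1 | h1 | ⟨h1, h2⟩
      · grind
      · grind
      · have : z ≠ p := fun hh => ha4 (hh ▸ hz')
        grind
    · rcases hch g x y z h hz' hz with ⟨h1, -⟩ | ⟨h1, -⟩ <;> grind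
    · rw [segment_symm] at hz'
      rcases D.inter h hc hz (hcc z hz') with h1 | h1 | ⟨h1, h2⟩
      · grind
      · grind
      · have : z ≠ p := fun hh => hc4 (hh ▸ hz')
        grind
  have n12 : MeetAtEnds a a' a' c' := by
    intro z hz hz'
    rcases hch e a p z ha hz' (haa z hz) with ⟨-, h⟩ | ⟨h, -⟩
    · exact .inr (.inr ⟨.inr h, .inl h⟩)
    · grind
  have n23 : MeetAtEnds c' c a' c' := by
    intro z hz hz'
    rw [segment_symm] at hz
    rcases hch e c p z hc hz' (hcc z hz) with ⟨h, -⟩ | ⟨-, h⟩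
    · exact absurd h (by rintro (⟨h, -⟩ | ⟨h, -⟩); exacts [hac h.symm, hcp h])
    · exact .inr (.inr ⟨.inl h, .inr h⟩)
  have n13 : MeetAtEnds a a' c' c := by
    intro z hz hz'
    rw [segment_symm] at hz'
    have h3 : z ≠ p := fun hh => ha4 (hh ▸ hz)
    rcases D.inter ha hc (haa z hz) (hcc z hz') with h1 | h1 | ⟨h1, h2⟩
    · grind
    · grind
    · exact absurd ((h1.resolve_right h3).symm.trans (h2.resolve_right h3)) hac
  have nN : ∀ {x y x' y'}, N x y → N x' y' → MeetAtEnds x y x' y' := by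
    rintro x y x' y' (⟨rfl, rfl⟩ | ⟨rfl, rfl⟩ | ⟨rfl, rfl⟩)
      (⟨rfl, rfl⟩ | ⟨rfl, rfl⟩ | ⟨rfl, rfl⟩)
    exacts [meetAtEnds_self _ _, n12, n13, n12.symm, meetAtEnds_self _ _, n23.symm, n13.symm, n23,
      meetAtEnds_self _ _]
  have hmeet : ∀ {g g' x y x' y'}, USeg (L' g) x y → USeg (L' g') x' y' →
      MeetAtEnds x y x' y' := by
    intro g g' x y x' y' h h'
    rcases hseg g x y h with h | ⟨-, h | h⟩ <;> rcases hseg g' x' y' h' with h' | ⟨-, h' | h'⟩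
    · exact meetAtEnds h.1 h'.1
    · exact oldN h h'
    · exact (oldN h h').symm.swap.symm
    · exact (oldN h' h).symm
    · exact nN h h'
    · exact (nN h h').symm.swap.symm
    · exact (oldN h' h).symm.swap
    · exact (nN h h').swap
    · exact (nN h h').swap.symm.swap.symm
  have newmem : ∀ {x y}, N x y ∨ N y x → (x = a' ∨ x = c') ∨ (y = a' ∨ y = c') := by
    simp only [N]; grind
  have oldnew : ∀ {g x y}, Old g x y → ¬ (N x y ∨ N y x) := by
    intro g x y h h'
    rcases newmem h' with (rfl | rfl) | (rfl | rfl)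
    exacts [ha' _ h.1.left_mem, hc' _ h.1.left_mem, ha' _ h.1.right_mem, hc' _ h.1.right_mem]
  have hchw' : ∀ {x y w}, N x y → D.pos w ∈ segment ℝ x y → D.pos w = x ∨ D.pos w = y := by
    have hw : ∀ w, D.pos w ≠ p := fun w h => hp.1 ⟨w, h⟩
    rintro x y w (⟨rfl, rfl⟩ | ⟨rfl, rfl⟩ | ⟨rfl, rfl⟩) hz
    · exact .inl ((D.vert ha (haa _ hz)).resolve_right (hw w))
    · exact absurd hz (hchw w)
    · rw [segment_symm] at hz
      exact .inr ((D.vert hc (hcc _ hz)).resolve_right (hw w))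
  have hreal : ∀ w, D.pos w ≠ a' ∧ D.pos w ≠ c' := fun w =>
    ⟨fun h => hchw w (h ▸ left_mem_segment ..), fun h => hchw w (h ▸ right_mem_segment ..)⟩
  let D' : PLDrawing ends :=
    { pos := D.pos
      pos_inj := D.pos_inj
      L := L'
      shape := by
        intro g
        by_cases hg : g = e
        · subst hg
          have hl2 : D.Or g ((l₁ ++ [a]) ++ [p] ++ (c :: l₂)) := by simpa using hl
          obtain ⟨u, v, A', B', he, hA, hB, hw⟩ := hl2.shape_split (by simp) (by simp)
          refine ⟨u, v, A' ++ [a', c'] ++ B', he, ?_, ?_⟩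
          · rw [hL'e, hlN]
            have : l₁ ++ a :: a' :: c' :: c :: l₂ = (l₁ ++ [a]) ++ [a', c'] ++ (c :: l₂) := by simp
            rw [this, hA, hB]; simp
          · intro w
            have := hw w
            have := hreal w
            simp only [List.mem_append, List.mem_cons, List.not_mem_nil, or_false] at *
            grind
        · rw [hL'g hg]; exact D.shape g
      nodup := by
        intro g
        by_cases hg : g = e
        · subst hg
          rw [hL'e, hlN]
          have h1 := ha' g
          have h2 := hc' g
          rw [← hl.mem] at h1 h2
          simp only [List.nodup_append, List.nodup_cons, List.mem_cons, List.mem_append] at *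
          grind
        · rw [hL'g hg]; exact D.nodup g
      inter := fun h h' hz hz' => hmeet h h' _ hz hz'
      sep := by
        intro g g' x y h h'
        rcases hseg _ _ _ h with h1 | ⟨hg, h1⟩ <;> rcases hseg _ _ _ h' with h2 | ⟨hg', h2⟩
        · exact D.sep h1.1 h2.1
        · exact (oldnew h1 h2).elim
        · exact (oldnew h2 h1).elim
        · exact hg.trans hg'.symm
      vert := by
        intro g x y w h hw
        rcases hseg _ _ _ h with h | ⟨-, h | h⟩
        · exact D.vert h.1 hw
        · exact hchw' h hw
        · rw [segment_symm] at hw; exact (hchw' h hw).symm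
      triple := by
        intro f g k z hz h1 h2 h3
        rcases hmem' _ _ h1 with h1 | ⟨rfl, h1⟩ <;> rcases hmem' _ _ h2 with h2 | ⟨rfl, h2⟩ <;>
          rcases hmem' _ _ h3 with h3 | ⟨rfl, h3⟩
        · exact D.triple hz h1 h2 h3
        all_goals grind }
  have hcross : ∀ z, D'.Cross z → D.Cross z ∧ z ≠ p := by
    rintro z ⟨hz, g, k, hgk, h1, h2⟩
    have hzp : z ≠ p := by
      rintro rfl
      have h3 : ∀ g, z ∈ L' g → g ≠ e := by
        rintro g hg rfl
        rw [hL'e, hmemN] at hg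
        grind
      have hg := h3 g h1
      have hk := h3 k h2
      change z ∈ L' g at h1
      change z ∈ L' k at h2
      rw [hL'g hg] at h1
      rw [hL'g hk] at h2
      have := D.triple hz ha.right_mem h1 h2
      grind
    refine ⟨⟨hz, g, k, hgk, ?_⟩, hzp⟩
    rcases hmem' _ _ h1 with h1 | ⟨rfl, h1⟩ <;> rcases hmem' _ _ h2 with h2 | ⟨rfl, h2⟩
    · exact ⟨h1, h2⟩
    all_goals grind
  refine ⟨D', ?_, ?_⟩
  · intro g
    change (L' g).countP (fun z => decide (D'.Cross z)) ≤ 3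
    have hle : ∀ l : List ℂ, l.countP (fun z => decide (D'.Cross z)) ≤
        l.countP (fun z => decide (D.Cross z)) := fun l => by
      refine List.countP_mono_left ?_
      intro x _ h
      simp only [decide_eq_true_eq] at h ⊢
      exact (hcross x h).1
    by_cases hg : g = e
    · subst hg
      refine le_trans ?_ (hD g)
      rw [← hl.countP, hL'e, hlN]
      have h1 : ¬ D'.Cross a' := fun h => ha' _ ((hcross _ h).1.2.choose_spec.choose_spec.2.1)
      have h2 : ¬ D'.Cross c' := fun h => hc' _ ((hcross _ h).1.2.choose_spec.choose_spec.2.1)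
      have e1 := hle (l₁ ++ [a])
      have e2 := hle (c :: l₂)
      simp only [List.countP_append, List.countP_cons, List.countP_nil] at e1 e2 ⊢
      simp only [h1, h2, decide_false, Bool.false_eq_true, if_false]
      omega
    · rw [hL'g hg]
      exact (hle _).trans (hD g)
  · refine Set.ncard_lt_ncard ?_ D.finite_cross
    refine ⟨fun z hz => (hcross z hz).1, fun h => ?_⟩
    exact (hcross p (h hp)).2 rfl

end PLDrawing

end Uncross

section Alternate

open Complex

theorem indep_of_ang {u v : ℂ} (hu : u ≠ 0) (hv : v ≠ 0) (h : ang (v / u) < Real.pi) {x y : ℝ}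
    (hxy : x * u + y * v = 0) : x = 0 ∧ y = 0 := by
  have h1 := norm_mul_exp_ang_mul_I (v / u)
  set θ := ang (v / u)
  have hθ : 0 < Real.sin θ := Real.sin_pos_of_pos_of_lt_pi (ang_pos _) h
  have hV : 0 < ‖v / u‖ := norm_pos_iff.2 (div_ne_zero hv hu)
  have h2 : (x : ℂ) + y * (v / u) = 0 := by
    field_simp; rw [mul_zero]; exact hxy
  rw [← h1, exp_mul_I] at h2
  have him := congrArg Complex.im h2
  simp [← ofReal_sin, ← ofReal_cos, -ofReal_div, -ofReal_mul] at him
  have hy : y = 0 := by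
    rcases him with h | h | h
    · exact h
    · rcases h with h | h
      · exact absurd h hv
      · exact absurd h hu
    · exact absurd h hθ.ne'
  subst hy
  exact ⟨by simpa using h2, rfl⟩

theorem cone_of_ang {u v w : ℂ} (hu : u ≠ 0) (hv : v ≠ 0) (hw : w ≠ 0)
    (h : ang (v / u) < Real.pi) (h' : ang (v / u) < ang (w / u)) (h2π : ang (w / u) < 2 * Real.pi)
    {x y r : ℝ} (hx : 0 ≤ x) (hy : 0 ≤ y) (hxy : 0 < x + y) (hr : 0 ≤ r) :
    x * u + y * v ≠ r * w := by
  intro heq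
  have h1 := norm_mul_exp_ang_mul_I (v / u)
  have h2 := norm_mul_exp_ang_mul_I (w / u)
  have h0 := ang_pos (v / u)
  set θ := ang (v / u)
  set ψ := ang (w / u)
  have hθ : 0 < Real.sin θ := Real.sin_pos_of_pos_of_lt_pi h0 h
  have hV : 0 < ‖v / u‖ := norm_pos_iff.2 (div_ne_zero hv hu)
  have hW : 0 < ‖w / u‖ := norm_pos_iff.2 (div_ne_zero hw hu)
  have h3 : (x : ℂ) + y * (v / u) = r * (w / u) := by field_simp; exact heq
  rw [← h1, ← h2, exp_mul_I, exp_mul_I] at h3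
  set V := ‖v / u‖
  set W := ‖w / u‖
  have him := congrArg Complex.im h3
  have hre := congrArg Complex.re h3
  simp only [← ofReal_sin, ← ofReal_cos, add_re, add_im, mul_re, mul_im, ofReal_re, ofReal_im,
    I_re, I_im] at him hre
  ring_nf at him hre
  have e1 : -x * Real.sin θ = r * W * Real.sin (ψ - θ) := by
    rw [Real.sin_sub]
    linear_combination (-Real.sin θ) * hre + Real.cos θ * him
  have e2 : y * V * Real.sin θ = r * W * Real.sin ψ := by linear_combination him
  have hfin : r = 0 → False := by
    rintro rfl
    have hx0 : x * Real.sin θ = 0 := by linarith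
    have hy0 : y * V * Real.sin θ = 0 := by linarith
    have hx1 : x = 0 := by rcases mul_eq_zero.1 hx0 with h | h; exacts [h, absurd h hθ.ne']
    have hy1 : y = 0 := by
      rcases mul_eq_zero.1 hy0 with h | h
      · rcases mul_eq_zero.1 h with h | h; exacts [h, absurd h hV.ne']
      · exact absurd h hθ.ne'
    linarith
  rcases lt_or_ge Real.pi ψ with hc | hc
  · have hs : Real.sin ψ < 0 := by
      have := Real.sin_neg_of_neg_of_neg_pi_lt (x := ψ - 2 * Real.pi) (by linarith) (by linarith)
      rwa [Real.sin_sub_two_pi] at this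
    have h5 : 0 ≤ y * V * Real.sin θ := by positivity
    by_contra
    have hr' : 0 < r := lt_of_le_of_ne hr (fun h => hfin h.symm)
    have : r * W * Real.sin ψ < 0 := mul_neg_of_pos_of_neg (by positivity) hs
    linarith
  · have hs : 0 < Real.sin (ψ - θ) :=
      Real.sin_pos_of_pos_of_lt_pi (by linarith) (by linarith)
    have h5 : 0 ≤ x * Real.sin θ := by positivity
    have hr' : 0 < r := lt_of_le_of_ne hr (fun h => hfin h.symm)
    have : 0 < r * W * Real.sin (ψ - θ) := by positivity
    linarith

namespace PLDrawing

variable {V E : Type*} {ends : E → Sym2 V} {D : PLDrawing ends}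

theorem IsMin.false_of_ang [Fintype E] [Finite V] (hD : D.IsMin) {e : E} {u p v : ℂ}
    {l₁ l₂ : List ℂ} (hl : D.Or e (l₁ ++ u :: p :: v :: l₂)) (hp : D.Cross p)
    (h : ang ((v - p) / (u - p)) < Real.pi)
    (hw : ∀ w, (p, w) ∈ D.H → w ≠ u → w ≠ v →
      ang ((v - p) / (u - p)) < ang ((w - p) / (u - p))) : False := by
  have hn := hl.nodup
  have hpu : (p, u) ∈ D.H := D.mem_H.2 ⟨e, hl.useg.1 ((useg_iff_of_nodup hn).2 (.inl rfl))⟩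
  have hpv : (p, v) ∈ D.H := D.mem_H.2 ⟨e, hl.useg.1 ((useg_iff_of_nodup hn).2 (.inr rfl))⟩
  have hu := D.isPlaneGraph.sub_ne hpu
  have hv := D.isPlaneGraph.sub_ne hpv
  obtain ⟨D', h1, h2⟩ := exists_uncross hD.1 hl hp (fun x y => indep_of_ang hu hv h)
    (fun w hpw hwu hwv x y r hx hy hxy hr =>
      cone_of_ang hu hv (D.isPlaneGraph.sub_ne hpw) h (hw w hpw hwu hwv) (lt_of_le_of_ne (ang_le _)
        (fun h => hwu (D.isPlaneGraph.eq_of_ang (D.isPlaneGraph.ne hpu).symm hpw hpu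
          (h.trans (ang_div_self hu).symm)))) hx hy hxy hr)
  exact absurd (hD.2 D' h1) (not_le.2 h2)

/-- The four neighbours of a crossing. -/
theorem Cross.exists_split {p : ℂ} (hp : D.Cross p) {e : E} {l₁ l₂ : List ℂ} {a c : ℂ}
    (hl : D.Or e (l₁ ++ a :: p :: c :: l₂)) : ∃ f m₁ m₂ b d, f ≠ e ∧
      D.Or f (m₁ ++ b :: p :: d :: m₂) ∧ (∀ g w, USeg (D.L g) p w ↔
        (g = e ∧ (w = a ∨ w = c)) ∨ (g = f ∧ (w = b ∨ w = d))) ∧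
      a ≠ c ∧ b ≠ d ∧ a ≠ b ∧ a ≠ d ∧ c ≠ b ∧ c ≠ d := by
  have hpe : p ∈ D.L e := hl.mem.1 (by simp)
  obtain ⟨f, hfe, hpf⟩ : ∃ f, f ≠ e ∧ p ∈ D.L f := by
    obtain ⟨-, g, k, hgk, h1, h2⟩ := hp
    by_cases h : g = e
    · exact ⟨k, fun hk => hgk (h.trans hk.symm), h2⟩
    · exact ⟨g, h, h1⟩
  have hfl : D.Or f (D.L f) := .inl rfl
  obtain ⟨m₁, b, d, m₂, hm⟩ := hfl.exists_split hpf hp.1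
  rw [hm] at hfl
  have hn := hl.nodup
  have hn' := hfl.nodup
  have he : ∀ w, USeg (D.L e) p w ↔ w = a ∨ w = c := fun w => by
    rw [← hl.useg, useg_iff_of_nodup hn]
  have hf : ∀ w, USeg (D.L f) p w ↔ w = b ∨ w = d := fun w => by
    rw [← hfl.useg, useg_iff_of_nodup hn']
  refine ⟨f, m₁, m₂, b, d, hfe, hfl, ?_, ?_, ?_, ?_, ?_, ?_, ?_⟩
  · intro g w
    constructor
    · intro h
      by_cases hg : g = e
      · subst hg
        exact .inl ⟨rfl, (he w).1 h⟩
      by_cases hg' : g = f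
      · subst hg'
        exact .inr ⟨rfl, (hf w).1 h⟩
      have := D.triple hp.1 hpe hpf h.left_mem
      grind
    · rintro (⟨rfl, h⟩ | ⟨rfl, h⟩)
      · exact (he w).2 h
      · exact (hf w).2 h
  · rintro rfl; simp [List.nodup_append] at hn
  · rintro rfl; simp [List.nodup_append] at hn'
  · exact fun h => hfe (D.sep ((hf b).2 (.inl rfl)) ((he b).2 (.inl h.symm)))
  · exact fun h => hfe (D.sep ((hf d).2 (.inr rfl)) ((he d).2 (.inl h.symm)))
  · exact fun h => hfe (D.sep ((hf b).2 (.inl rfl)) ((he b).2 (.inr h.symm)))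
  · exact fun h => hfe (D.sep ((hf d).2 (.inr rfl)) ((he d).2 (.inr h.symm)))

/-- In a minimal drawing, the two edges alternate around each crossing. -/
theorem IsMin.nextPt_nextPt [Fintype E] [Finite V] (hD : D.IsMin) {p : ℂ} (hp : D.Cross p) {e : E}
    {l₁ l₂ : List ℂ} {a c : ℂ} (hl : D.Or e (l₁ ++ a :: p :: c :: l₂)) :
    nextPt D.H p (nextPt D.H p a) = c := by
  obtain ⟨f, m₁, m₂, b, d, hfe, hm, hN, hac, hbd, hab, had, hcb, hcd⟩ := hp.exists_split hl
  have hH := D.isPlaneGraph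
  have hN' : ∀ w, (p, w) ∈ D.H ↔ w = a ∨ w = c ∨ w = b ∨ w = d := by
    intro w
    rw [D.mem_H]
    simp only [hN]
    constructor
    · grind
    · rintro (rfl | rfl | rfl | rfl)
      exacts [⟨e, by simp⟩, ⟨e, by simp⟩, ⟨f, by simp⟩, ⟨f, by simp⟩]
  clear hN
  have key : ∀ m₁ m₂ b d, D.Or f (m₁ ++ b :: p :: d :: m₂) →
      (∀ w, (p, w) ∈ D.H ↔ w = a ∨ w = c ∨ w = b ∨ w = d) → b ≠ d → a ≠ b → a ≠ d → c ≠ b →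
      c ≠ d → ang ((b - p) / (a - p)) < ang ((d - p) / (a - p)) →
      nextPt D.H p (nextPt D.H p a) = c := by
    clear hm hN' hbd hab had hcb hcd m₁ m₂ b d
    intro m₁ m₂ b d hm hN hbd hab had hcb hcd hlt
    have ha := (hN a).2 (by simp)
    have hb := (hN b).2 (by simp)
    have hc := (hN c).2 (by simp)
    have hd := (hN d).2 (by simp)
    have ha0 := hH.sub_ne ha
    have hb0 := hH.sub_ne hb
    have hc0 := hH.sub_ne hc
    have hd0 := hH.sub_ne hd
    have hpa := (hH.ne ha).symm
    have haa := ang_div_self ha0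
    have hdiv : ∀ x y : ℂ, (x - p) / (y - p) = ((x - p) / (a - p)) / ((y - p) / (a - p)) := by
      intro x y; field_simp
    have hne : ∀ x y, (p, x) ∈ D.H → (p, y) ∈ D.H → x ≠ y →
        ang ((x - p) / (a - p)) ≠ ang ((y - p) / (a - p)) :=
      fun x y hx hy hxy h => hxy (hH.eq_of_ang hpa hx hy h)
    have hlt2 : ∀ x, (p, x) ∈ D.H → x ≠ a → ang ((x - p) / (a - p)) < 2 * Real.pi :=
      fun x hx hxa => lt_of_le_of_ne (ang_le _) (haa ▸ hne x a hx ha hxa)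
    have hb2 := hlt2 b hb hab.symm
    have hc2 := hlt2 c hc hac.symm
    have hd2 := hlt2 d hd had.symm
    have hb1 := ang_pos ((b - p) / (a - p))
    have hc1 := ang_pos ((c - p) / (a - p))
    have hd1 := ang_pos ((d - p) / (a - p))
    have hcb' := hne c b hc hb hcb
    have hcd' := hne c d hc hd hcd
    have up : ∀ x y, (p, x) ∈ D.H → (p, y) ∈ D.H →
        ang ((x - p) / (a - p)) < ang ((y - p) / (a - p)) →
        ang ((y - p) / (x - p)) = ang ((y - p) / (a - p)) - ang ((x - p) / (a - p)) := by
      intro x y hx hy h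
      rw [hdiv y x, ang_div_of_lt (div_ne_zero (hH.sub_ne hx) ha0)
        (div_ne_zero (hH.sub_ne hy) ha0) h]
    have dn : ∀ x y, (p, x) ∈ D.H → (p, y) ∈ D.H →
        ang ((y - p) / (a - p)) ≤ ang ((x - p) / (a - p)) →
        ang ((y - p) / (x - p)) = ang ((y - p) / (a - p)) - ang ((x - p) / (a - p)) +
          2 * Real.pi := by
      intro x y hx hy h
      rw [hdiv y x, ang_div_of_le (div_ne_zero (hH.sub_ne hx) ha0)
        (div_ne_zero (hH.sub_ne hy) ha0) h]
    rcases lt_or_gt_of_ne hcb' with h1 | h1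
    · -- the order is `c, b, d, a`
      exfalso
      by_cases hpi : ang ((c - p) / (a - p)) < Real.pi
      · refine hD.false_of_ang hl hp hpi fun w hw hwa hwc => ?_
        rcases (hN w).1 hw with rfl | rfl | rfl | rfl
        · exact absurd rfl hwa
        · exact absurd rfl hwc
        · exact h1
        · linarith
      · have hbd' := up b d hb hd hlt
        refine hD.false_of_ang hm hp (by rw [hbd']; linarith) fun w hw hwb hwd => ?_
        rw [hbd']
        rcases (hN w).1 hw with rfl | rfl | rfl | rfl
        · rw [up b w hb ha (by rw [haa]; exact hb2), haa]; linarith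
        · rw [dn b w hb hc h1.le]; linarith
        · exact absurd rfl hwb
        · exact absurd rfl hwd
    rcases lt_or_gt_of_ne hcd' with h2 | h2
    · -- the order is `b, c, d, a`
      have e1 : nextPt D.H p a = b := hH.nextPt_eq ha hb fun v hv => by
        rcases (hN v).1 hv with rfl | rfl | rfl | rfl
        · rw [haa]; exact hb2.le
        · exact h1.le
        · exact le_rfl
        · exact hlt.le
      rw [e1]
      refine hH.nextPt_eq hb hc fun v hv => ?_
      rw [up b c hb hc h1]
      rcases (hN v).1 hv with rfl | rfl | rfl | rfl
      · rw [up b v hb ha (by rw [haa]; exact hb2), haa]; linarith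
      · rw [up b v hb hc h1]
      · rw [dn v v hb hb le_rfl]; linarith
      · rw [up b v hb hd hlt]; linarith
    · -- the order is `b, d, c, a`
      exfalso
      by_cases hpi : ang ((a - p) / (c - p)) < Real.pi
      · have hl' := hl.reverse
        simp only [List.reverse_append, List.reverse_cons, List.append_assoc, List.cons_append,
          List.nil_append] at hl'
        refine hD.false_of_ang hl' hp hpi fun w hw hwc hwa => ?_
        rw [up c a hc ha (by rw [haa]; exact hc2), haa]
        rcases (hN w).1 hw with rfl | rfl | rfl | rfl
        · exact absurd rfl hwa
        · exact absurd rfl hwc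
        · rw [dn c w hc hb h1.le]; linarith
        · rw [dn c w hc hd h2.le]; linarith
      · have hbd' := up b d hb hd hlt
        rw [up c a hc ha (by rw [haa]; exact hc2), haa] at hpi
        refine hD.false_of_ang hm hp (by rw [hbd']; linarith) fun w hw hwb hwd => ?_
        rw [hbd']
        rcases (hN w).1 hw with rfl | rfl | rfl | rfl
        · rw [up b w hb ha (by rw [haa]; exact hb2), haa]; linarith
        · rw [up b w hb hc h1]; linarith
        · exact absurd rfl hwb
        · exact absurd rfl hwd
  rcases lt_trichotomy (ang ((b - p) / (a - p))) (ang ((d - p) / (a - p))) with h | h | h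
  · exact key m₁ m₂ b d hm hN' hbd hab had hcb hcd h
  · exact absurd (hH.eq_of_ang (hH.ne ((hN' a).2 (by simp))).symm ((hN' b).2 (by simp))
      ((hN' d).2 (by simp)) h) hbd
  · have hm' := hm.reverse
    simp only [List.reverse_append, List.reverse_cons, List.append_assoc, List.cons_append,
      List.nil_append] at hm'
    exact key _ _ d b hm' (fun w => by rw [hN']; tauto) hbd.symm had hab hcd hcb h

end PLDrawing

end Alternate

section Lens

theorem not_useg_of_inter_subsingleton {α : Type*} {l m : List α} (hl : l.Nodup) {r : α}
    (h : ∀ x, x ∈ l → x ∈ m → x = r) {x y : α} (hx : USeg l x y) (hy : USeg m x y) : False :=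
  hx.ne hl ((h x hx.left_mem hy.left_mem).trans (h y hx.right_mem hy.right_mem).symm)

theorem nodup_replace {α : Type*} {a b b' c : List α} {p q : α}
    (h : (a ++ q :: (b ++ p :: c)).Nodup) (hb : b'.Nodup)
    (hb' : ∀ z ∈ b', ¬ (z ∈ a ∨ z = q ∨ z = p ∨ z ∈ c)) : (a ++ q :: (b' ++ p :: c)).Nodup := by
  simp only [List.nodup_append, List.nodup_cons, List.mem_append, List.mem_cons] at h ⊢
  grind

namespace PLDrawing

variable {V E : Type*} {ends : E → Sym2 V} {D : PLDrawing ends}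

set_option maxHeartbeats 1600000 in
/-- In a minimal drawing there is no lens with equally many crossings on both sides. -/
theorem IsMin.no_lens [Fintype E] [Finite V] (hD : D.IsMin) {e f : E} (hef : e ≠ f)
    {l₁ l₂ m₁ m₂ α β : List ℂ} {p q : ℂ} (hl : D.Or e (l₁ ++ q :: (α ++ p :: l₂)))
    (hm : D.Or f (m₁ ++ q :: (β ++ p :: m₂))) (hα : ∀ z ∈ α, z ∉ D.L f) (hβ : ∀ z ∈ β, z ∉ D.L e)
    (hp : D.Cross p) (hcount : open Classical in α.countP (fun z => D.Cross z) =
      β.countP (fun z => D.Cross z)) : False := by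
  classical
  set L' : E → List ℂ := fun g => if g = e then l₁ ++ q :: (β ++ p :: l₂) else
    if g = f then m₁ ++ q :: (α ++ p :: m₂) else D.L g with hL'
  have hL'e : L' e = l₁ ++ q :: (β ++ p :: l₂) := by simp [hL']
  have hL'f : L' f = m₁ ++ q :: (α ++ p :: m₂) := by simp [hL', hef.symm]
  have hL'g : ∀ {g}, g ≠ e → g ≠ f → L' g = D.L g := fun h h' => by simp [hL', h, h']
  have hln := hl.nodup
  have hmn := hm.nodup
  have hmeme : ∀ z, z ∈ D.L e ↔ z ∈ l₁ ∨ z = q ∨ z ∈ α ∨ z = p ∨ z ∈ l₂ := fun z => by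
    rw [← hl.mem]; simp
  have hmemf : ∀ z, z ∈ D.L f ↔ z ∈ m₁ ∨ z = q ∨ z ∈ β ∨ z = p ∨ z ∈ m₂ := fun z => by
    rw [← hm.mem]; simp
  have hmeme' : ∀ z, z ∈ L' e ↔ z ∈ l₁ ∨ z = q ∨ z ∈ β ∨ z = p ∨ z ∈ l₂ := fun z => by
    rw [hL'e]; simp
  have hmemf' : ∀ z, z ∈ L' f ↔ z ∈ m₁ ∨ z = q ∨ z ∈ α ∨ z = p ∨ z ∈ m₂ := fun z => by
    rw [hL'f]; simp
  have split : ∀ (a b c : List ℂ) x y, USeg (a ++ q :: (b ++ p :: c)) x y ↔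
      (USeg (a ++ [q]) x y ∨ USeg (p :: c) x y) ∨ USeg (q :: (b ++ [p])) x y := by
    intro a b c x y
    have h := useg_append (l₁ := q :: b) (l₂ := c) (x := p) (p := x) (q := y)
    rw [useg_append]
    simp only [List.cons_append] at h
    rw [h]
    tauto
  have hse : ∀ x y, USeg (D.L e) x y ↔ (USeg (l₁ ++ [q]) x y ∨ USeg (p :: l₂) x y) ∨
      USeg (q :: (α ++ [p])) x y := fun x y => by rw [← hl.useg, split]
  have hsf : ∀ x y, USeg (D.L f) x y ↔ (USeg (m₁ ++ [q]) x y ∨ USeg (p :: m₂) x y) ∨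
      USeg (q :: (β ++ [p])) x y := fun x y => by rw [← hm.useg, split]
  have hse' : ∀ x y, USeg (L' e) x y ↔ (USeg (l₁ ++ [q]) x y ∨ USeg (p :: l₂) x y) ∨
      USeg (q :: (β ++ [p])) x y := fun x y => by rw [hL'e, split]
  have hsf' : ∀ x y, USeg (L' f) x y ↔ (USeg (m₁ ++ [q]) x y ∨ USeg (p :: m₂) x y) ∨
      USeg (q :: (α ++ [p])) x y := fun x y => by rw [hL'f, split]
  have disj : ∀ {a b c : List ℂ} {x y}, (a ++ q :: (b ++ p :: c)).Nodup →
      USeg (a ++ [q]) x y ∨ USeg (p :: c) x y → USeg (q :: (b ++ [p])) x y → False := by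
    intro a b c x y hn h h'
    simp only [List.nodup_append, List.nodup_cons, List.mem_append, List.mem_cons] at hn
    have hn2 : (q :: (b ++ [p])).Nodup := by
      simp only [List.nodup_append, List.nodup_cons, List.mem_append, List.mem_cons]
      grind
    rcases h with h | h
    · refine not_useg_of_inter_subsingleton hn2 (r := q) (fun z h1 h2 => ?_) h' h
      simp only [List.mem_append, List.mem_cons, List.not_mem_nil, or_false] at h1 h2
      grind
    · refine not_useg_of_inter_subsingleton hn2 (r := p) (fun z h1 h2 => ?_) h' h
      simp only [List.mem_append, List.mem_cons, List.not_mem_nil, or_false] at h1 h2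
      grind
  have hold : ∀ {g x y}, USeg (L' g) x y → ∃ g', USeg (D.L g') x y ∧
      (g = g' ∨ ((g = e ∨ g = f) ∧ (g' = e ∨ g' = f))) := by
    intro g x y h
    by_cases hg : g = e
    · subst hg
      rcases (hse' x y).1 h with h | h
      · exact ⟨g, (hse x y).2 (.inl h), .inl rfl⟩
      · exact ⟨f, (hsf x y).2 (.inr h), by simp⟩
    by_cases hg' : g = f
    · subst hg'
      rcases (hsf' x y).1 h with h | h
      · exact ⟨g, (hsf x y).2 (.inl h), .inl rfl⟩
      · exact ⟨e, (hse x y).2 (.inr h), by simp⟩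
    · rw [hL'g hg hg'] at h
      exact ⟨g, h, .inl rfl⟩
  have hnew : ∀ {g x y}, USeg (D.L g) x y → ∃ g', USeg (L' g') x y := by
    intro g x y h
    by_cases hg : g = e
    · subst hg
      rcases (hse x y).1 h with h | h
      · exact ⟨g, (hse' x y).2 (.inl h)⟩
      · exact ⟨f, (hsf' x y).2 (.inr h)⟩
    by_cases hg' : g = f
    · subst hg'
      rcases (hsf x y).1 h with h | h
      · exact ⟨g, (hsf' x y).2 (.inl h)⟩
      · exact ⟨e, (hse' x y).2 (.inr h)⟩
    · exact ⟨g, by rwa [hL'g hg hg']⟩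
  have hsepef : ∀ {x y}, USeg (L' e) x y → USeg (L' f) x y → False := by
    intro x y h h'
    rcases (hse' x y).1 h with h | h <;> rcases (hsf' x y).1 h' with h' | h'
    · exact hef (D.sep ((hse x y).2 (.inl h)) ((hsf x y).2 (.inl h')))
    · exact disj hln h h'
    · exact disj hmn h' h
    · exact hef (D.sep ((hse x y).2 (.inr h')) ((hsf x y).2 (.inr h)))
  have hperm : ∀ z, ∃ s : Equiv.Perm E, ∀ g, z ∈ L' g ↔ z ∈ D.L (s g) := by
    intro z
    by_cases hz : z ∈ α ∨ z ∈ β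
    · refine ⟨Equiv.swap e f, fun g => ?_⟩
      have hln' := hln
      have hmn' := hmn
      simp only [List.nodup_append, List.nodup_cons, List.mem_append, List.mem_cons] at hln' hmn'
      by_cases hg : g = e
      · subst hg
        rw [Equiv.swap_apply_left, hmeme', hmemf]
        have h1 := hα z
        have h2 := hβ z
        rw [hmemf] at h1
        rw [hmeme] at h2
        grind
      by_cases hg' : g = f
      · subst hg'
        rw [Equiv.swap_apply_right, hmemf', hmeme]
        have h1 := hα z
        have h2 := hβ z
        rw [hmemf] at h1
        rw [hmeme] at h2
        grind
      rw [Equiv.swap_apply_of_ne_of_ne hg hg', hL'g hg hg']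
    · refine ⟨Equiv.refl E, fun g => ?_⟩
      push Not at hz
      by_cases hg : g = e
      · subst hg
        simp [hmeme', hmeme, hz.1, hz.2]
      by_cases hg' : g = f
      · subst hg'
        simp [hmemf', hmemf, hz.1, hz.2]
      rw [hL'g hg hg']; rfl
  have hl3 : D.Or e ((l₁ ++ [q]) ++ α ++ (p :: l₂)) := by simpa using hl
  have hm3 : D.Or f ((m₁ ++ [q]) ++ β ++ (p :: m₂)) := by simpa using hm
  obtain ⟨u, v, A', B', he, hA, hB, hw⟩ := hl3.shape_split (by simp) (by simp)
  obtain ⟨u', v', A₂, B₂, hf, hA₂, hB₂, hw₂⟩ := hm3.shape_split (by simp) (by simp)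
  let D' : PLDrawing ends :=
    { pos := D.pos
      pos_inj := D.pos_inj
      L := L'
      shape := by
        intro g
        by_cases hg : g = e
        · subst hg
          refine ⟨u, v, A' ++ β ++ B', he, ?_, ?_⟩
          · rw [hL'e]
            have : l₁ ++ q :: (β ++ p :: l₂) = (l₁ ++ [q]) ++ β ++ (p :: l₂) := by simp
            rw [this, hA, hB]; simp
          · intro w
            have h1 := hw w
            have h2 := hw₂ w
            simp only [List.mem_append] at h1 h2 ⊢
            tauto
        by_cases hg' : g = f
        · subst hg'
          refine ⟨u', v', A₂ ++ α ++ B₂, hf, ?_, ?_⟩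
          · rw [hL'f]
            have : m₁ ++ q :: (α ++ p :: m₂) = (m₁ ++ [q]) ++ α ++ (p :: m₂) := by simp
            rw [this, hA₂, hB₂]; simp
          · intro w
            have h1 := hw w
            have h2 := hw₂ w
            simp only [List.mem_append] at h1 h2 ⊢
            tauto
        · rw [hL'g hg hg']; exact D.shape g
      nodup := by
        intro g
        have hln' := hln
        have hmn' := hmn
        simp only [List.nodup_append, List.nodup_cons, List.mem_append, List.mem_cons] at hln' hmn'
        by_cases hg : g = e
        · subst hg
          rw [hL'e]
          exact nodup_replace hln hmn'.2.1.2.1 fun z hz h => hβ z hz ((hmeme z).2 (by tauto))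
        by_cases hg' : g = f
        · subst hg'
          rw [hL'f]
          exact nodup_replace hmn hln'.2.1.2.1 fun z hz h => hα z hz ((hmemf z).2 (by tauto))
        · rw [hL'g hg hg']; exact D.nodup g
      inter := by
        intro g g' x y x' y' z h h' hz hz'
        obtain ⟨k, hk, -⟩ := hold h
        obtain ⟨k', hk', -⟩ := hold h'
        exact D.inter hk hk' hz hz'
      sep := by
        intro g g' x y h h'
        obtain ⟨k, hk, hk2⟩ := hold h
        obtain ⟨k', hk', hk2'⟩ := hold h'
        have := D.sep hk hk'
        subst this
        rcases hk2 with rfl | ⟨h1, h2⟩ <;> rcases hk2' with rfl | ⟨h3, h4⟩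
        · rfl
        · rcases h3 with rfl | rfl <;> rcases h4 with rfl | rfl
          · rfl
          · exact (hsepef h' h).elim
          · exact (hsepef h h').elim
          · rfl
        · rcases h1 with rfl | rfl <;> rcases h2 with rfl | rfl
          · rfl
          · exact (hsepef h h').elim
          · exact (hsepef h' h).elim
          · rfl
        · rcases h1 with rfl | rfl <;> rcases h3 with rfl | rfl
          · rfl
          · exact (hsepef h h').elim
          · exact (hsepef h' h).elim
          · rfl
      vert := by
        intro g x y w h hw
        obtain ⟨k, hk, -⟩ := hold h
        exact D.vert hk hw
      triple := by
        intro g k j z hz h1 h2 h3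
        obtain ⟨s, hs⟩ := hperm z
        rw [hs] at h1 h2 h3
        simpa using D.triple hz h1 h2 h3 }
  have hcross : ∀ z, D'.Cross z ↔ D.Cross z := by
    intro z
    obtain ⟨s, hs⟩ := hperm z
    refine and_congr Iff.rfl ⟨?_, ?_⟩
    · rintro ⟨g, k, hgk, h1, h2⟩
      exact ⟨s g, s k, fun h => hgk (s.injective h), (hs g).1 h1, (hs k).1 h2⟩
    · rintro ⟨g, k, hgk, h1, h2⟩
      exact ⟨s.symm g, s.symm k, fun h => hgk (s.symm.injective h), (hs _).2 (by simpa using h1),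
        (hs _).2 (by simpa using h2)⟩
  have hmin : D'.IsMin := by
    constructor
    · intro g
      change (L' g).countP (fun z => decide (D'.Cross z)) ≤ 3
      simp only [hcross]
      by_cases hg : g = e
      · subst hg
        refine le_trans (le_of_eq ?_) (hD.1 g)
        rw [← hl.countP, hL'e]
        simp only [List.countP_append, List.countP_cons]
        omega
      by_cases hg' : g = f
      · subst hg'
        refine le_trans (le_of_eq ?_) (hD.1 g)
        rw [← hm.countP, hL'f]
        simp only [List.countP_append, List.countP_cons]
        omega
      · rw [hL'g hg hg']; exact hD.1 g
    · intro D₂ h₂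
      refine le_trans (le_of_eq ?_) (hD.2 D₂ h₂)
      simp only [cr, hcross]
  have hH : D'.H = D.H := by
    ext ⟨x, y⟩
    rw [mem_H, mem_H]
    constructor
    · rintro ⟨g, hg⟩
      obtain ⟨k, hk, -⟩ := hold hg
      exact ⟨k, hk⟩
    · rintro ⟨g, hg⟩
      exact hnew hg
  obtain ⟨c, l₂', rfl⟩ : ∃ c l₂', l₂ = c :: l₂' := by
    refine List.exists_cons_of_ne_nil ?_
    rintro rfl
    obtain ⟨-, h⟩ := List.append_inj' (s₁ := []) (t₁ := [p]) hB rfl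
    simp only [List.cons.injEq, and_true] at h
    exact hp.1 ⟨v, h.symm⟩
  obtain ⟨s, a, hsa⟩ := (List.eq_nil_or_concat (q :: α)).resolve_left (by simp)
  obtain ⟨t, b, htb⟩ := (List.eq_nil_or_concat (q :: β)).resolve_left (by simp)
  simp only [List.concat_eq_append] at hsa htb
  have e1 : l₁ ++ q :: (α ++ p :: c :: l₂') = (l₁ ++ s) ++ a :: p :: c :: l₂' := by
    have : q :: (α ++ p :: c :: l₂') = (q :: α) ++ p :: c :: l₂' := rfl
    rw [this, hsa]; simp
  have e2 : l₁ ++ q :: (β ++ p :: c :: l₂') = (l₁ ++ t) ++ b :: p :: c :: l₂' := by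
    have : q :: (β ++ p :: c :: l₂') = (q :: β) ++ p :: c :: l₂' := rfl
    rw [this, htb]; simp
  have hl' : D'.Or e ((l₁ ++ t) ++ b :: p :: c :: l₂') := by
    refine .inl ?_
    rw [← e2]
    exact hL'e.symm
  have hap : USeg (D.L e) a p := by
    refine hl.useg.1 ?_
    rw [e1]
    exact .inl ⟨_, _, rfl⟩
  have hbp : USeg (D.L f) b p := by
    refine hm.useg.1 (.inl ⟨m₁ ++ t, m₂, ?_⟩)
    have : q :: (β ++ p :: m₂) = (q :: β) ++ p :: m₂ := rfl
    rw [this, htb]; simp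
  have n1 := hD.nextPt_nextPt hp (e1 ▸ hl)
  have n2 := hmin.nextPt_nextPt ((hcross p).2 hp) hl'
  rw [hH] at n2
  have ha : (p, a) ∈ D.H := D.mem_H.2 ⟨e, hap.symm⟩
  have hb : (p, b) ∈ D.H := D.mem_H.2 ⟨f, hbp.symm⟩
  have hab : a = b := D.isPlaneGraph.nextPt_injOn ha hb
    (D.isPlaneGraph.nextPt_injOn (IsPlaneGraph.nextPt_spec ha).1 (IsPlaneGraph.nextPt_spec hb).1 (n1.trans n2.symm))
  rw [hab] at hap
  exact hef (D.sep hap hbp)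

end PLDrawing

end Lens

section Chain

theorem List.exists_first {α : Type*} {P : α → Prop} {l : List α} (h : ∃ x ∈ l, P x) :
    ∃ γ p t, l = γ ++ p :: t ∧ (∀ z ∈ γ, ¬ P z) ∧ P p := by
  induction l with
  | nil => simp at h
  | cons a l ih =>
    by_cases ha : P a
    · exact ⟨[], a, l, rfl, by simp, ha⟩
    · obtain ⟨γ, p, t, rfl, h1, h2⟩ := ih (by simpa [ha] using h)
      exact ⟨a :: γ, p, t, rfl, by simpa [ha] using h1, h2⟩

theorem List.first_unique {α : Type*} {P : α → Prop} {γ γ' t t' : List α} {p p' : α}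
    (h : γ ++ p :: t = γ' ++ p' :: t') (h1 : ∀ z ∈ γ, ¬ P z) (h2 : P p) (h1' : ∀ z ∈ γ', ¬ P z)
    (h2' : P p') : γ = γ' ∧ p = p' ∧ t = t' := by
  induction γ generalizing γ' with
  | nil =>
    cases γ' with
    | nil => simpa using h
    | cons a γ' =>
      simp only [List.nil_append, List.cons_append, List.cons.injEq] at h
      exact absurd (h.1 ▸ h2) (h1' a (by simp))
  | cons b γ ih =>
    cases γ' with
    | nil =>
      simp only [List.nil_append, List.cons_append, List.cons.injEq] at h
      exact absurd (h.1 ▸ h2') (h1 b (by simp))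
    | cons a γ' =>
      simp only [List.cons_append, List.cons.injEq] at h
      obtain ⟨h3, h4, h5⟩ := ih h.2 (fun z hz => h1 z (by simp [hz])) fun z hz => h1' z (by simp [hz])
      exact ⟨by rw [h.1, h3], h4, h5⟩

theorem List.exists_headD {α : Type*} (γ : List α) (p : α) (t : List α) :
    ∃ r, γ ++ p :: t = γ.headD p :: r := by
  cases γ with
  | nil => exact ⟨t, rfl⟩
  | cons a γ => exact ⟨γ ++ p :: t, rfl⟩

namespace PLDrawing

variable {V E : Type*} {ends : E → Sym2 V} (D : PLDrawing ends)

/-- The nodes of a drawing are the vertices and the crossings. -/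
def Node (z : ℂ) : Prop := z ∈ Set.range D.pos ∨ D.Cross z

/-- The part of an edge between two consecutive nodes, starting with the segment from `q`
to `x`. -/
structure Chain (q x : ℂ) where
  e : E
  s : List ℂ
  γ : List ℂ
  p : ℂ
  t : List ℂ
  or : D.Or e (s ++ q :: (γ ++ p :: t))
  head : γ.headD p = x
  free : ∀ z ∈ γ, ¬ D.Node z
  node : D.Node q
  node' : D.Node p

variable {D}

namespace Chain

/-- The oriented edge containing a chain. -/
def o {q x : ℂ} (c : D.Chain q x) : List ℂ := c.s ++ q :: (c.γ ++ c.p :: c.t)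

theorem seg {q x : ℂ} (c : D.Chain q x) : Seg c.o q x := by
  obtain ⟨r, hr⟩ := List.exists_headD c.γ c.p c.t
  exact ⟨c.s, r, by rw [o, hr, c.head]⟩

theorem useg {q x : ℂ} (c : D.Chain q x) : USeg (D.L c.e) q x := c.or.useg.1 (.inl c.seg)

instance {q x : ℂ} : Subsingleton (D.Chain q x) := by
  constructor
  intro c c'
  obtain ⟨he, hl⟩ := c.or.eq_of_seg c'.or c.seg c'.seg
  have h0 := c.or.nodup
  obtain ⟨h1, h2⟩ := h0.append_cons_inj hl
  obtain ⟨h3, h4, h5⟩ := List.first_unique h2 c.free c.node' c'.free c'.node'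
  cases c; cases c'
  simp only at he h1 h3 h4 h5
  subst he h1 h3 h4 h5
  rfl

/-- The reversed chain. -/
def rev {q x : ℂ} (c : D.Chain q x) : D.Chain c.p (c.γ.reverse.headD q) where
  e := c.e
  s := c.t.reverse
  γ := c.γ.reverse
  p := q
  t := c.s.reverse
  or := by simpa using c.or.reverse
  head := rfl
  free := by simpa using c.free
  node := c.node'
  node' := c.node

theorem ne {q x : ℂ} (c : D.Chain q x) : q ≠ c.p := by
  have h := c.or.nodup
  have := (List.nodup_append.1 h).2.1
  grind

end Chain

theorem nonempty_chain {e : E} {q x : ℂ} (h : USeg (D.L e) q x) (hq : D.Node q) :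
    Nonempty (D.Chain q x) := by
  obtain ⟨l, hl, s, r, rfl⟩ := exists_or h
  have : ∃ z ∈ x :: r, D.Node z := by
    obtain ⟨u, v, A, B, -, -, hB, -⟩ := Or.shape_split (A := s ++ [q]) (M := []) (B := x :: r)
      (by simpa using hl) (by simp) (by simp)
    exact ⟨D.pos v, by rw [hB]; simp, .inl ⟨v, rfl⟩⟩
  obtain ⟨γ, p, t, h1, h2, h3⟩ := List.exists_first this
  refine ⟨⟨e, s, γ, p, t, by rw [← h1]; exact hl, ?_, h2, hq, h3⟩⟩
  obtain ⟨r', hr'⟩ := List.exists_headD γ p t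
  rw [← h1] at hr'
  simp only [List.cons.injEq] at hr'
  exact hr'.1.symm

namespace Chain

theorem exists_concat {q : ℂ} (s γ : List ℂ) :
    ∃ l₁, s ++ q :: γ = l₁ ++ [γ.reverse.headD q] := by
  rcases List.eq_nil_or_concat γ with rfl | ⟨γ, a, rfl⟩
  · exact ⟨s, by simp⟩
  · exact ⟨s ++ q :: γ, by simp⟩

/-- A chain ending in a crossing is continued straight ahead by the second next segment. -/
theorem exists_cont [Fintype E] [Finite V] (hD : D.IsMin) {q x : ℂ} (c : D.Chain q x)
    (hp : D.Cross c.p) : ∃ y, nextPt D.H c.p (nextPt D.H c.p (c.γ.reverse.headD q)) = y ∧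
      ∃ c' : D.Chain c.p y, c'.e = c.e ∧ c'.s = c.s ++ q :: c.γ ∧ c.t = c'.γ ++ c'.p :: c'.t := by
  obtain ⟨l₁, h1⟩ := exists_concat (q := q) c.s c.γ
  have hor := c.or
  obtain ⟨y, t, ht⟩ : ∃ y t, c.t = y :: t := by
    rcases ht : c.t with _ | ⟨y, t⟩
    · exfalso
      rw [ht] at hor
      obtain ⟨u, v, A, B, -, -, hB, -⟩ := Or.shape_split (A := c.s ++ q :: c.γ) (M := [])
        (B := [c.p]) (by simpa using hor) (by simp) (by simp)
      apply hp.1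
      rcases B with _ | ⟨b, B⟩
      · simp at hB; exact ⟨v, hB.symm⟩
      · have := congrArg List.length hB
        simp at this
    · exact ⟨y, t, rfl⟩
  have h2 : c.s ++ q :: (c.γ ++ c.p :: c.t) = l₁ ++ c.γ.reverse.headD q :: c.p :: y :: t := by
    rw [ht, ← List.cons_append, ← List.append_assoc, h1]; simp
  have hor' := hor
  rw [h2] at hor'
  refine ⟨y, hD.nextPt_nextPt hp hor', ?_⟩
  have hs : Seg (c.s ++ q :: (c.γ ++ c.p :: c.t)) c.p y := ⟨c.s ++ q :: c.γ, t, by simp [ht]⟩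
  obtain ⟨c'⟩ := nonempty_chain (hor.useg.1 (.inl hs)) (.inr hp)
  obtain ⟨he, hl⟩ := c'.or.eq_of_seg hor c'.seg hs
  have := c'.or.nodup.append_cons_inj (m₁ := c.s ++ q :: c.γ) (m₂ := c.t) (by rw [hl]; simp)
  exact ⟨c', he, this.1, this.2.symm⟩

theorem edge_ne [Fintype E] [Finite V] (hD : D.IsMin) {q x : ℂ} (c : D.Chain q x)
    (hq : D.Cross q) {e : E} (h : USeg (D.L e) q (nextPt D.H q x)) : e ≠ c.e := by
  rintro rfl
  have hx : (q, x) ∈ D.H := D.mem_H.2 ⟨_, c.useg⟩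
  obtain ⟨r, hr⟩ := List.exists_headD c.γ c.p c.t
  have hor := c.or
  rw [hr, c.head] at hor
  obtain ⟨l₁, a, hs⟩ : ∃ l₁ a, c.s = l₁ ++ [a] := by
    rcases List.eq_nil_or_concat c.s with h | ⟨s, a, h⟩
    · rw [h] at hor
      obtain ⟨u, v, k, -, hl, -⟩ := hor.shape
      simp only [List.nil_append, List.cons.injEq] at hl
      exact absurd ⟨u, hl.1.symm⟩ hq.1
    · exact ⟨s, a, by simpa using h⟩
  rw [hs] at hor
  have hor' : D.Or c.e (l₁ ++ a :: q :: x :: r) := by simpa using hor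
  have hor'' : D.Or c.e (r.reverse ++ x :: q :: a :: l₁.reverse) := by simpa using hor'.reverse
  have h1 := hD.nextPt_nextPt hq hor'
  have h2 := hD.nextPt_nextPt hq hor''
  have hxa : a ≠ x := by
    have := hor'.nodup
    rintro rfl
    simp [List.nodup_append] at this
  have ha : (q, a) ∈ D.H := by rw [← h2]; exact (IsPlaneGraph.nextPt_spec (IsPlaneGraph.nextPt_spec hx).1).1
  rcases (useg_iff_of_nodup hor'.nodup).1 (hor'.useg.2 h) with h3 | h3
  · rw [h3] at h2
    exact hxa (D.isPlaneGraph.nextPt_injOn ha hx (h2.trans h3.symm))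
  · rw [h3, h3] at h2
    exact hxa h2.symm

theorem nextPt_four [Fintype E] [Finite V] (hD : D.IsMin) {q x : ℂ} (c : D.Chain q x)
    (hq : D.Cross q) : nextPt D.H q (nextPt D.H q (nextPt D.H q (nextPt D.H q x))) = x := by
  obtain ⟨r, hr⟩ := List.exists_headD c.γ c.p c.t
  have hor := c.or
  rw [hr, c.head] at hor
  obtain ⟨l₁, a, hs⟩ : ∃ l₁ a, c.s = l₁ ++ [a] := by
    rcases List.eq_nil_or_concat c.s with h | ⟨s, a, h⟩
    · rw [h] at hor
      obtain ⟨u, v, k, -, hl, -⟩ := hor.shape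
      simp only [List.nil_append, List.cons.injEq] at hl
      exact absurd ⟨u, hl.1.symm⟩ hq.1
    · exact ⟨s, a, by simpa using h⟩
  rw [hs] at hor
  have hor' : D.Or c.e (l₁ ++ a :: q :: x :: r) := by simpa using hor
  have hor'' : D.Or c.e (r.reverse ++ x :: q :: a :: l₁.reverse) := by simpa using hor'.reverse
  rw [hD.nextPt_nextPt hq hor'', hD.nextPt_nextPt hq hor']

end Chain

end PLDrawing

end Chain

section Darts

namespace PLDrawing

variable {V E : Type*} {ends : E → Sym2 V} [Fintype E] (D : PLDrawing ends)

/-- The darts of the planarization: directed segments starting at a node. -/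
abbrev Dart : Type := {d : ℂ × ℂ // d ∈ D.H ∧ D.Node d.1}

noncomputable instance : Fintype D.Dart := by
  classical
  exact Fintype.ofInjective (fun d : D.Dart => (⟨d.1, d.2.1⟩ : {d // d ∈ D.H}))
    fun a b h => Subtype.ext (congrArg (fun x => x.1) h : a.1 = b.1)

variable {D}

namespace Dart

@[ext] theorem ext' {d d' : D.Dart} (h : d.1 = d'.1) : d = d' := Subtype.ext h

/-- The chain starting with a dart. -/
noncomputable def ch (d : D.Dart) : D.Chain d.1.1 d.1.2 :=
  (nonempty_chain (D.mem_H.1 d.2.1).choose_spec d.2.2).some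

/-- The tail of a dart. -/
def tl (d : D.Dart) : ℂ := d.1.1

/-- The node at the end of the chain of a dart. -/
noncomputable def hd (d : D.Dart) : ℂ := d.ch.p

/-- The edge containing a dart. -/
noncomputable def ed (d : D.Dart) : E := d.ch.e

/-- The dart starting a chain. -/
def of {q x : ℂ} (c : D.Chain q x) : D.Dart := ⟨(q, x), D.mem_H.2 ⟨c.e, c.useg⟩, c.node⟩

theorem ch_of {q x : ℂ} (c : D.Chain q x) : (of c).ch = c := Subsingleton.elim _ _

theorem ed_of {q x : ℂ} (c : D.Chain q x) : (of c).ed = c.e := congrArg Chain.e (ch_of c)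

theorem hd_of {q x : ℂ} (c : D.Chain q x) : (of c).hd = c.p := congrArg Chain.p (ch_of c)

/-- The last dart of the chain of a dart, reversed. -/
noncomputable def rev (d : D.Dart) : D.Dart := of d.ch.rev

theorem rev_rev (d : D.Dart) : d.rev.rev = d := by
  have key : ∀ {q x : ℂ} (c : D.Chain q x), of (of c).ch.rev = of c.rev := fun c =>
    congrArg (fun c => of (Chain.rev c)) (ch_of c)
  rw [rev, rev, key]
  refine ext' ?_
  change (d.1.1, d.ch.γ.reverse.reverse.headD d.ch.p) = d.1
  rw [List.reverse_reverse, d.ch.head]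

/-- Edge reversal. -/
noncomputable def α : Equiv.Perm D.Dart := Function.Involutive.toPerm rev rev_rev

theorem α_α (d : D.Dart) : α (α d) = d := rev_rev d

theorem tl_α (d : D.Dart) : (α d).tl = d.hd := rfl

theorem ed_α (d : D.Dart) : (α d).ed = d.ed := ed_of d.ch.rev

theorem hd_α (d : D.Dart) : (α d).hd = d.tl := hd_of d.ch.rev

/-- The next dart in the rotation around the tail. -/
noncomputable def rotFun (d : D.Dart) : D.Dart :=
  ⟨(d.1.1, nextPt D.H d.1.1 d.1.2), (IsPlaneGraph.nextPt_spec d.2.1).1, d.2.2⟩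

theorem rotFun_injective : Function.Injective (rotFun : D.Dart → D.Dart) := by
  rintro ⟨⟨q, x⟩, h, h1⟩ ⟨⟨q', x'⟩, h', h1'⟩ hr
  have hr := congrArg Subtype.val hr
  simp only [rotFun, Prod.mk.injEq] at hr
  obtain ⟨rfl, hr⟩ := hr
  refine ext' ?_
  exact Prod.ext rfl (D.isPlaneGraph.nextPt_injOn h h' hr)

/-- The rotation around the tails. -/
noncomputable def rot : Equiv.Perm D.Dart :=
  Equiv.ofBijective rotFun (Finite.injective_iff_bijective.1 rotFun_injective)

/-- The face permutation. -/
noncomputable def φ : Equiv.Perm D.Dart := α.trans rot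

theorem φ_apply (d : D.Dart) : φ d = rot (α d) := rfl

theorem φ_α (d : D.Dart) : φ (α d) = rot d := by rw [φ_apply, α_α]

theorem tl_φ (d : D.Dart) : (φ d).tl = d.hd := rfl

/-- The tail of a dart is a vertex of the graph. -/
def R (d : D.Dart) : Prop := d.tl ∈ Set.range D.pos

theorem cross_of_not_R {d : D.Dart} (h : ¬ R d) : D.Cross d.tl := d.2.2.resolve_left h

theorem tl_ne_hd (d : D.Dart) : d.tl ≠ d.hd := d.ch.ne

variable [Finite V]

theorem ed_rot (hD : D.IsMin) {d : D.Dart} (h : ¬ R d) : (rot d).ed ≠ d.ed :=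
  d.ch.edge_ne hD (cross_of_not_R h) (rot d).ch.useg

theorem ed_φ (hD : D.IsMin) {d : D.Dart} (h : ¬ R (φ d)) : (φ d).ed ≠ d.ed := by
  rw [φ_apply, ← ed_α d]
  exact ed_rot hD h

theorem rot_four (hD : D.IsMin) {d : D.Dart} (h : ¬ R d) : rot (rot (rot (rot d))) = d :=
  ext' (Prod.ext rfl (d.ch.nextPt_four hD (cross_of_not_R h)))

theorem cont (hD : D.IsMin) {d d' : D.Dart} (h : ¬ R (φ d)) (hd' : φ (α (φ d)) = d') :
    d'.ed = d.ed ∧ d'.ch.s = d.ch.s ++ d.tl :: d.ch.γ ∧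
      d.ch.t = d'.ch.γ ++ d'.hd :: d'.ch.t ∧ d'.tl = d.hd ∧ D.Cross d.hd := by
  have hc : D.Cross d.hd := cross_of_not_R h
  obtain ⟨y, hy, c', h1, h2, h3⟩ := d.ch.exists_cont hD hc
  have : d' = of c' := by
    rw [← hd', φ_α]
    exact ext' (Prod.ext rfl hy)
  subst this
  rw [ed_of, hd_of, ch_of]
  exact ⟨h1, h2, h3, rfl, hc⟩

end Dart

end PLDrawing

end Darts

section CrossMap

namespace PLDrawing

variable {V E : Type*} {ends : E → Sym2 V} [Fintype E] {D : PLDrawing ends}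

namespace Dart

theorem tl_mem (d : D.Dart) : d.tl ∈ D.L d.ed := d.ch.useg.left_mem

theorem hd_mem (d : D.Dart) : d.hd ∈ D.L d.ed := by
  rw [← ed_α, ← tl_α]; exact tl_mem _

/-- The oriented edge containing a dart. -/
noncomputable def ol (d : D.Dart) : List ℂ := d.ch.s ++ d.tl :: (d.ch.γ ++ d.hd :: d.ch.t)

theorem or_ol (d : D.Dart) : D.Or d.ed d.ol := d.ch.or

open Classical in
/-- The dart `b` is reached from `a` by going straight ahead through the nodes `S`. -/
def Trail (a : D.Dart) (S : List ℂ) (b : D.Dart) : Prop :=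
  b.ed = a.ed ∧ ∃ Γ, a.ch.s ++ a.tl :: (Γ ++ b.hd :: b.ch.t) = b.ol ∧
    Γ.filter (fun z => D.Node z) = S

theorem Trail.refl (a : D.Dart) : Trail a [] a :=
  ⟨rfl, a.ch.γ, rfl, by simpa using a.ch.free⟩

theorem Trail.single {a b : D.Dart} (h : a = b) : Trail a [] b := h ▸ Trail.refl a

theorem Trail.cont [Finite V] (hD : D.IsMin) {a b c : D.Dart} {S : List ℂ} (h : Trail a S b)
    (hb : ¬ R (φ b)) (hc : φ (α (φ b)) = c) : Trail a (S ++ [b.hd]) c := by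
  obtain ⟨h1, Γ, h2, h3⟩ := h
  obtain ⟨h4, h5, h6, h7, h8⟩ := Dart.cont hD hb hc
  have hN : D.Node b.hd := Or.inr h8
  refine ⟨h4.trans h1, Γ ++ b.hd :: c.ch.γ, ?_, ?_⟩
  · have h9 : c.ol = b.ol := by
      rw [ol, ol, h5, h6, h7]; simp
    rw [h9, ← h2, h6]; simp
  · rw [List.filter_append, h3, List.filter_cons_of_pos (by simpa using hN),
      List.filter_eq_nil_iff.2 (by simpa using c.ch.free)]

theorem Trail.or {a b : D.Dart} {S : List ℂ} (h : Trail a S b) : D.Or a.ed b.ol :=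
  h.1 ▸ b.or_ol

theorem Trail.lens [Finite V] (hD : D.IsMin) {a b a' b' : D.Dart} {S S' : List ℂ} (h : Trail a S b)
    (h' : Trail a' S' b') (ht : a.tl = a'.tl) (hh : b.hd = b'.hd) (hc : D.Cross b.hd)
    (he : a.ed ≠ a'.ed) (hlen : S.length = S'.length) (hS : ∀ z ∈ S, z ∉ D.L a'.ed)
    (hS' : ∀ z ∈ S', z ∉ D.L a.ed) : False := by
  classical
  have hor := h.or
  have hor' := h'.or
  obtain ⟨-, Γ, h2, h3⟩ := h
  obtain ⟨-, Γ', h2', h3'⟩ := h'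
  rw [← h2] at hor
  rw [← h2', ← ht, ← hh] at hor'
  have key : ∀ {e : E} {s Γ t : List ℂ} {q p : ℂ}, D.Or e (s ++ q :: (Γ ++ p :: t)) →
      ∀ z ∈ Γ, z ∉ Set.range D.pos := by
    rintro e s Γ t q p hor z hz ⟨w, rfl⟩
    obtain ⟨u, v, A, B, -, -, -, h⟩ := Or.shape_split (A := s ++ [q]) (M := Γ) (B := p :: t)
      (by simpa using hor) (by simp) (by simp)
    exact h w (by simp [hz])
  have key2 : ∀ {e f : E} {s Γ t S : List ℂ} {q p : ℂ}, D.Or e (s ++ q :: (Γ ++ p :: t)) →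
      Γ.filter (fun z => D.Node z) = S → e ≠ f → (∀ z ∈ S, z ∉ D.L f) → ∀ z ∈ Γ, z ∉ D.L f := by
    rintro e f s Γ t S q p hor rfl hef hS z hz hzf
    have hc : D.Cross z := cross_of_mem (key hor z hz) hef (hor.mem.1 (by simp [hz])) hzf
    exact hS z (by simpa using ⟨hz, Or.inr hc⟩) hzf
  have key3 : ∀ {e : E} {s Γ t S : List ℂ} {q p : ℂ}, D.Or e (s ++ q :: (Γ ++ p :: t)) →
      Γ.filter (fun z => D.Node z) = S → Γ.countP (fun z => D.Cross z) = S.length := by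
    rintro e s Γ t S q p hor rfl
    rw [List.countP_eq_length_filter]
    congr 1
    refine List.filter_congr fun z hz => ?_
    simp only [Node, key hor z hz, false_or]
  exact hD.no_lens he hor hor' (key2 hor h3 he hS) (key2 hor' h3' he.symm hS') hc
    (by rw [key3 hor h3, key3 hor' h3', hlen])

theorem Trail.ends_eq {a b : D.Dart} {S : List ℂ} (h : Trail a S b) {u v : V} (hu : D.pos u = a.tl)
    (hv : D.pos v = b.hd) : ends a.ed = s(u, v) := by
  have hor := h.or
  obtain ⟨-, Γ, h2, h3⟩ := h
  rw [← h2] at hor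
  obtain ⟨u', v', A, B, he, hA, hB, hk⟩ := Or.shape_split (A := a.ch.s ++ [a.tl]) (M := Γ)
    (B := b.hd :: b.ch.t) (by simpa using hor) (by simp) (by simp)
  rw [he]
  congr 2
  · apply D.pos_inj
    rw [hu]
    rcases List.eq_nil_or_concat A with rfl | ⟨A, x, rfl⟩
    · have := congrArg List.length hA
      simp at this
      rw [this] at hA
      simpa using hA.symm
    · exfalso
      rw [List.concat_eq_append, ← List.cons_append] at hA
      have := (List.append_inj' hA rfl).2
      simp only [List.cons.injEq, and_true] at this
      exact hk u (by simp [hu, this])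
  · apply D.pos_inj
    rw [hv]
    rcases B with _ | ⟨x, B⟩
    · simp at hB
      exact hB.1.symm
    · exfalso
      simp only [List.cons_append, List.cons.injEq] at hB
      exact hk v (by simp [hv, hB.1])

theorem not_mem_of_ne {e f g : E} {z : ℂ} (hz : D.Cross z) (he : z ∈ D.L e) (hg : z ∈ D.L g)
    (heg : e ≠ g) (hfg : f ≠ g) (hef : e ≠ f) : z ∉ D.L f := by
  intro hf
  rcases D.triple hz.1 he hf hg with h | h | h <;> grind

/-- There are no three consecutive inner chains on an edge. -/
theorem three_aux [Finite V] (hD : D.IsMin) {a b c : D.Dart} (ha : ¬ R a) (hb : ¬ R (φ a))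
    (hab : φ (α (φ a)) = b) (hc : ¬ R (φ b)) (hbc : φ (α (φ b)) = c) : R (φ c) := by
  classical
  by_contra hR
  have h := ((Trail.refl a).cont hD hb hab).cont hD hc hbc
  have hor := h.or
  obtain ⟨-, Γ, h2, h3⟩ := h
  rw [← h2] at hor
  have h4 := hD.1 a.ed
  rw [← hor.countP, List.countP_append, List.countP_cons_of_pos
    (by simpa using cross_of_not_R ha), List.countP_append, List.countP_cons_of_pos
    (by simpa using (show D.Cross c.hd from cross_of_not_R (d := φ c) hR))] at h4
  have h5 : (Γ.filter fun z => D.Cross z).length ≥ 2 := by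
    have h6 : ((Γ.filter fun z => D.Node z).filter fun z => D.Cross z) =
        (Γ.filter fun z => D.Cross z) := by
      rw [List.filter_filter]
      congr 1
      ext z
      simp only [Node, Bool.decide_or, Bool.and_or_distrib_left]
      by_cases hz : D.Cross z <;> simp [hz]
    rw [← h6, h3, List.filter_eq_self.2]
    · simp
    · have h7 : D.Cross a.hd := cross_of_not_R (d := φ a) hb
      have h8 : D.Cross b.hd := cross_of_not_R (d := φ b) hc
      simp [h7, h8]
  rw [← List.countP_eq_length_filter] at h5
  omega

theorem digon_aux [Finite V] (hD : D.IsMin) {a b : D.Dart} (ht : a.tl = b.tl) (hh : a.hd = b.hd)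
    (he : a.ed ≠ b.ed) (hc : D.Cross a.hd) : False :=
  (Trail.refl a).lens hD (Trail.refl b) ht hh hc he rfl (by simp) (by simp)

end Dart

end PLDrawing

end CrossMap

section CrossMap

namespace PLDrawing

variable {V E : Type*} {ends : E → Sym2 V} [Fintype E] {D : PLDrawing ends}

namespace Dart

variable [Finite V]

/-- The sides of a triangle at a vertex, followed by a face, after one crossing. -/
structure Tip (y : D.Dart) : Prop where
  h1 : ¬ R y
  h2 : ¬ R (φ y)
  h3 : R (φ (φ y))
  h4 : φ (φ (φ y)) = y

theorem eq_of_ed_eq {a b : D.Dart} {S S' : List ℂ} {a' b' : D.Dart} (h : Trail a S b)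
    (h' : Trail a' S' b') (hinj : Function.Injective ends) (hR : R a) (hR' : R (φ b))
    (h1 : a.tl = a'.tl) (h2 : b.hd = b'.hd) : a.ed = a'.ed := by
  obtain ⟨u, hu⟩ := hR
  obtain ⟨v, hv⟩ := hR'
  rw [tl_φ] at hv
  exact hinj ((h.ends_eq hu hv).trans (h'.ends_eq (hu.trans h1) (hv.trans h2)).symm)

/-- Both sides of a tip start at the same vertex. -/
theorem Tip.contra (hD : D.IsMin) {y : D.Dart} (h : Tip y) (he : (φ (φ y)).ed = (φ y).ed) : False := by
  have ht : (φ (φ y)).tl = (α (φ y)).tl := by rw [tl_φ, tl_α]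
  have hed : (φ (φ y)).ed = (α (φ y)).ed := by rw [ed_α, he]
  set a := φ (φ y)
  set b := α (φ y)
  have hR : R a := h.h3
  have key : ∀ (d : D.Dart), R d → d.ch.s = [] := by
    intro d hd
    have := d.or_ol
    obtain ⟨r, hr⟩ := List.exists_headD d.ch.γ d.ch.p d.ch.t
    obtain ⟨u, v, A, B, -, hA, -, hk⟩ := Or.shape_split (A := d.ch.s ++ [d.tl]) (M := [])
      (B := d.ch.γ ++ d.hd :: d.ch.t) (by simpa [ol] using this) (by simp) (by simp)
    rcases hs : d.ch.s with _ | ⟨x, s⟩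
    · rfl
    · rw [hs] at hA
      simp only [List.cons_append, List.cons.injEq] at hA
      obtain ⟨w, hw⟩ := hd
      exact absurd (by rw [hw, ← hA.2]; simp) (hk w)
  have hol : a.ol = b.ol := by
    have h1 := a.or_ol
    have h2 := b.or_ol
    have h5 : a.ol = a.tl :: (a.ch.γ ++ a.hd :: a.ch.t) := by rw [ol, key a hR]; rfl
    have h6 : b.ol = a.tl :: (b.ch.γ ++ b.hd :: b.ch.t) := by
      rw [ol, key b (by rw [R, ← ht]; exact hR), ht]; rfl
    have nd := h1.nodup
    have rv : a.ol ≠ b.ol.reverse := by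
      intro hr
      rw [h6] at hr
      rw [h5] at hr
      have := congrArg List.getLast? hr
      rw [List.getLast?_reverse, List.head?_cons] at this
      rw [h5, List.nodup_cons] at nd
      apply nd.1
      have h7 : (a.tl :: (a.ch.γ ++ a.hd :: a.ch.t)).getLast? =
          (a.ch.γ ++ a.hd :: a.ch.t).getLast? := by
        rcases hx : a.ch.γ ++ a.hd :: a.ch.t with _ | ⟨x, m⟩
        · simp at hx
        · rfl
      rw [h7] at this
      exact List.mem_of_getLast? this
    rw [← hed] at h2
    rcases h1 with h1 | h1 <;> rcases h2 with h2 | h2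
    · rw [h1, h2]
    · exact absurd (by rw [h2, List.reverse_reverse, h1]) rv
    · exact absurd (by rw [h2, h1]) rv
    · rw [h1, h2]
  have hhd : a.hd = b.hd := by
    have h5 : a.ol = a.tl :: (a.ch.γ ++ a.hd :: a.ch.t) := by rw [ol, key a hR]; rfl
    have h6 : b.ol = a.tl :: (b.ch.γ ++ b.hd :: b.ch.t) := by
      rw [ol, key b (by rw [R, ← ht]; exact hR), ht]; rfl
    rw [h5, h6, List.cons.injEq] at hol
    exact (List.first_unique hol.2 a.ch.free a.ch.node' b.ch.free b.ch.node').2.1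
  have h8 : a.hd = y.tl := by rw [← tl_φ, h.h4]
  have h9 : b.hd = y.hd := by rw [hd_α, tl_φ]
  exact tl_ne_hd y (by rw [← h8, hhd, h9])

theorem cont_rev (hD : D.IsMin) {d d' : D.Dart} (h : ¬ R (φ d)) (hd' : φ (α (φ d)) = d') :
    ¬ R (φ (α d')) ∧ φ (α (φ (α d'))) = α d := by
  rw [φ_α] at hd'
  subst hd'
  constructor
  · rw [φ_α]; exact h
  · rw [φ_α, φ_α]; exact rot_four hD (d := α d) h

/-- A ladder starting at a tip `y` whose last rung is `u`. -/
structure Ladder (y u : D.Dart) (c : D.Dart) (A B : List ℂ) : Prop where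
  left : Trail (φ (φ y)) A c
  hc : φ c = u
  right : Trail (α (φ y)) B (α (φ u))
  hA : ∀ z ∈ A, z ∉ D.L (φ y).ed
  hB : ∀ z ∈ B, z ∉ D.L (φ (φ y)).ed
  len : A.length = B.length
  h1 : ¬ R u
  h2 : ¬ R (φ u)

theorem Tip.ladder {y : D.Dart} (h : Tip y) : Ladder y y (φ (φ y)) [] [] :=
  ⟨Trail.refl _, h.h4, Trail.refl _, by simp, by simp, rfl, h.h1, h.h2⟩

theorem Ladder.ext (hD : D.IsMin) {y u c d : D.Dart} {A B : List ℂ} (hy : Tip y)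
    (h : Ladder y u c A B) (hd : φ d = α u) : ∃ A' B', Trail (φ (φ y)) A' (φ (α u)) ∧
    Trail (α (φ y)) B' (α d) ∧ (∀ z ∈ A', z ∉ D.L (φ y).ed) ∧
    (∀ z ∈ B', z ∉ D.L (φ (φ y)).ed) ∧ A'.length = B'.length := by
  have hef : (φ (φ y)).ed ≠ (φ y).ed := fun h => hy.contra hD h
  have hce : c.ed = (φ (φ y)).ed := h.left.1
  have hue : u.ed ≠ (φ (φ y)).ed := by
    rw [← hce, ← h.hc]
    exact ed_φ hD (by rw [h.hc]; exact h.h1)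
  have hfu : (φ u).ed = (φ y).ed := by
    have := h.right.1
    rwa [ed_α, ed_α] at this
  have huf : u.ed ≠ (φ y).ed := by
    rw [← hfu]
    exact (ed_φ hD h.h2).symm
  have h1 := cont_rev hD (d := d) (d' := φ u) (by rw [hd]; exact h.h2) (by rw [hd, α_α])
  have hl := h.left.cont hD (c := φ (α u)) (by rw [h.hc]; exact h.h1) (by rw [h.hc])
  have hr := h.right.cont hD h1.1 h1.2
  refine ⟨_, _, hl, hr, ?_, ?_, by simp [h.len]⟩
  · intro z hz
    rcases List.mem_append.1 hz with hz | hz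
    · exact h.hA z hz
    · have hz' : z = u.tl := by
        have h2 : c.hd = u.tl := by rw [← tl_φ, h.hc]
        simpa [h2] using hz
      subst hz'
      refine not_mem_of_ne (cross_of_not_R h.h1) ?_ u.tl_mem hue.symm huf.symm hef
      rw [← hce, ← h.hc, tl_φ]
      exact hd_mem c
  · intro z hz
    rcases List.mem_append.1 hz with hz | hz
    · exact h.hB z hz
    · have hz' : z = (φ u).tl := by simpa [hd_α] using hz
      subst hz'
      refine not_mem_of_ne (cross_of_not_R h.h2) ?_ u.hd_mem huf.symm hue.symm hef.symm
      rw [← hfu]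
      exact tl_mem _

theorem Ladder.quad (hD : D.IsMin) {y u c : D.Dart} {A B : List ℂ} (hy : Tip y)
    (h : Ladder y u c A B) (hu : φ (φ (φ (φ (α u)))) = α u) (h1 : ¬ R (φ (φ (α u))))
    (h2 : ¬ R (φ (φ (φ (α u))))) : ∃ c' A' B', Ladder y (φ (φ (α u))) c' A' B' := by
  obtain ⟨A', B', h3, h4, h5, h6, h7⟩ := h.ext hD hy hu
  exact ⟨_, A', B', h3, rfl, h4, h5, h6, h7, h1, h2⟩

theorem Ladder.tri (hD : D.IsMin) (hinj : Function.Injective ends) {y u c : D.Dart} {A B : List ℂ}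
    (hy : Tip y) (h : Ladder y u c A B) (hu : φ (φ (φ (α u))) = α u) : False := by
  obtain ⟨A', B', h3, h4, h5, h6, h7⟩ := h.ext hD hy hu
  have hef : (φ (φ y)).ed ≠ (α (φ y)).ed := fun h => hy.contra hD (h.trans (ed_α _))
  have ht : (φ (φ y)).tl = (α (φ y)).tl := by rw [tl_φ, tl_α]
  have hh : (φ (α u)).hd = (α (φ (φ (α u)))).hd := by rw [hd_α, tl_φ]
  by_cases hR : R (φ (φ (α u)))
  · exact hef (eq_of_ed_eq h3 h4 hinj hy.h3 hR ht hh)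
  · exact h3.lens hD h4 ht hh (cross_of_not_R (d := φ (φ (α u))) hR) hef h7
      (by rwa [ed_α]) h6

end Dart

open Dart in
/-- The combinatorial map of a drawing with the minimal number of crossings. -/
noncomputable def crossMap [Finite V] (hD : D.IsMin) (hinj : Function.Injective ends) :
    CrossMap D.Dart where
  α := α
  φ := φ
  R := R
  inv := α_α
  tail d := by rw [φ_α]; rfl
  four d hd := by simp only [φ_α]; exact rot_four hD hd
  three x h1 h2 := by
    by_contra h
    push Not at h
    obtain ⟨h3, h4⟩ := h
    set w := φ.symm (α (φ.symm x))
    have hw : φ (α (φ w)) = x := by simp [w, α_α]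
    have hw1 : ¬ R (φ w) := by
      intro h
      apply h1
      rw [← hw, φ_α]
      exact h
    exact h3 (three_aux hD h4 hw1 hw h2 rfl)
  loopless d h := tl_ne_hd d (by rw [← tl_φ, h])
  digon d h := by
    have ht : d.tl = (φ d).hd := by rw [← tl_φ, h]
    constructor
    · by_contra hR
      have he := ed_φ hD (d := φ d) (by rw [h]; exact hR)
      rw [h] at he
      refine digon_aux hD (a := α d) (b := φ d) (by rw [tl_α, tl_φ]) (by rw [hd_α, ht])
        (by rwa [ed_α]) ?_
      rw [hd_α]
      exact cross_of_not_R hR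
    · by_contra hR
      have he := ed_φ hD hR
      refine digon_aux hD (a := α (φ d)) (b := d) (by rw [tl_α, ht]) (by rw [hd_α, tl_φ])
        (by rwa [ed_α]) ?_
      rw [hd_α]
      exact cross_of_not_R hR
  noAT y h1 h2 h3 h4 := by
    rintro ⟨h5, -⟩
    exact (Tip.ladder ⟨h1, h2, h3, h4⟩).tri hD hinj ⟨h1, h2, h3, h4⟩ h5
  noAQT y h1 h2 h3 h4 := by
    rintro ⟨h5, -, -, h6, h7⟩ z rfl ⟨h8, -⟩
    have hy : Tip y := ⟨h1, h2, h3, h4⟩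
    obtain ⟨c, A, B, h⟩ := hy.ladder.quad hD hy h5 h6 h7
    exact h.tri hD hinj hy h8
  noAQA y h1 h2 h3 h4 := by
    rintro ⟨h5, -, -, h6, h7⟩ z rfl ⟨h8, -⟩
    have hy : Tip y := ⟨h1, h2, h3, h4⟩
    obtain ⟨c, A, B, h⟩ := hy.ladder.quad hD hy h5 h6 h7
    exact h.tri hD hinj hy h8
  noAQQA y h1 h2 h3 h4 := by
    rintro ⟨h5, -, -, h6, h7⟩ z rfl ⟨h8, -, -, h9, h10⟩ w rfl ⟨h11, -⟩
    have hy : Tip y := ⟨h1, h2, h3, h4⟩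
    obtain ⟨c, A, B, h⟩ := hy.ladder.quad hD hy h5 h6 h7
    obtain ⟨c', A', B', h'⟩ := h.quad hD hy h8 h9 h10
    exact h'.tri hD hinj hy h11

end PLDrawing

end CrossMap

section Euler

theorem sum_seg {H : Finset (ℂ × ℂ)} (F : ℂ → ℝ) {l : List ℂ} {p : ℂ} (hl : (l ++ [p]).Nodup)
    (hH : ∀ s t, Seg (l ++ [p]) s t → (s, t) ∈ H) : open Classical in
    ∑ d ∈ H, (if Seg (l ++ [p]) d.1 d.2 then F d.1 else 0) = (l.map F).sum := by
  classical
  induction l with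
  | nil => simp [not_seg_singleton]
  | cons a l ih =>
    obtain ⟨r, hr⟩ := List.exists_headD l p []
    set b := l.headD p
    have hseg : ∀ s t, Seg (a :: l ++ [p]) s t ↔ (s = a ∧ t = b) ∨ Seg (l ++ [p]) s t := by
      intro s t
      rw [List.cons_append, hr, seg_cons_cons]
    have hna : ∀ s t, Seg (l ++ [p]) s t → s ≠ a := by
      rintro s t h rfl
      exact (List.nodup_cons.1 hl).1 h.left_mem
    have h1 : ∀ d : ℂ × ℂ, (if Seg (a :: l ++ [p]) d.1 d.2 then F d.1 else 0) =
        (if d = (a, b) then F a else 0) + (if Seg (l ++ [p]) d.1 d.2 then F d.1 else 0) := by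
      rintro ⟨s, t⟩
      rw [hseg]
      by_cases h : Seg (l ++ [p]) s t
      · have := hna s t h
        simp [h, this]
      · by_cases h' : s = a ∧ t = b
        · obtain ⟨rfl, rfl⟩ := h'
          simp [h]
        · simp [h, h']
    simp only [h1, Finset.sum_add_distrib]
    rw [ih (List.nodup_cons.1 hl).2 fun s t h => hH s t ((hseg s t).2 (.inr h)),
      Finset.sum_ite_eq' H (a, b) fun _ => F a, if_pos (hH a b ((hseg a b).2 (.inl ⟨rfl, rfl⟩)))]
    simp

namespace PLDrawing

variable {V E : Type*} {ends : E → Sym2 V} [Fintype E] {D : PLDrawing ends}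

theorem nextPt_bend {e : E} {l₁ l₂ : List ℂ} {a b c : ℂ} (h : D.Or e (l₁ ++ a :: b :: c :: l₂))
    (hb : ¬ D.Node b) : nextPt D.H b a = c := by
  have hbe : b ∈ D.L e := h.mem.1 (by simp)
  have h1 := fun w => useg_iff_of_nodup (w := w) h.nodup
  have ha : (b, a) ∈ D.H := D.mem_H.2 ⟨e, h.useg.1 ((h1 a).2 (.inl rfl))⟩
  have hc : (b, c) ∈ D.H := D.mem_H.2 ⟨e, h.useg.1 ((h1 c).2 (.inr rfl))⟩
  refine D.isPlaneGraph.nextPt_eq ha hc fun v hv => ?_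
  obtain ⟨g, hg⟩ := D.mem_H.1 hv
  have hge : g = e := by
    by_contra hne
    exact hb (.inr (cross_of_mem (fun h => hb (.inl h)) hne hg.left_mem hbe))
  subst hge
  rcases (h1 v).1 (h.useg.2 hg) with rfl | rfl
  · rw [Complex.ang_div_self (sub_ne_zero.2 (D.isPlaneGraph.ne ha).symm)]
    exact Complex.ang_le _
  · exact le_rfl

theorem const_of_free {ρ : ℂ → ℂ → ℝ} (hρ : ∀ s t, (s, t) ∈ D.H → ρ t (nextPt D.H t s) = ρ s t)
    {e : E} {γ s t : List ℂ} {q p : ℂ} (h : D.Or e (s ++ q :: (γ ++ p :: t)))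
    (hγ : ∀ z ∈ γ, ¬ D.Node z) : ρ q (γ.headD p) = ρ (γ.reverse.headD q) p := by
  induction γ generalizing s q with
  | nil => rfl
  | cons b γ ih =>
    have h1 := ih (s := s ++ [q]) (q := b) (by simpa using h) fun z hz => hγ z (by simp [hz])
    have h2 : (b :: γ).reverse.headD q = γ.reverse.headD b := by
      rcases List.eq_nil_or_concat γ with rfl | ⟨γ, a, rfl⟩ <;> simp
    rw [h2, ← h1]
    obtain ⟨r, hr⟩ := List.exists_headD γ p t
    have h3 : D.Or e (s ++ q :: b :: γ.headD p :: r) := by rw [← hr]; simpa using h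
    have h4 := nextPt_bend h3 (hγ b (by simp))
    rw [← h4]
    exact (hρ q b (D.mem_H.2 ⟨e, h.useg.1 (.inl ⟨s, γ ++ p :: t, by simp⟩)⟩)).symm

namespace Dart

/-- The points of the chain of a dart. -/
noncomputable def pts (d : D.Dart) : List ℂ := d.tl :: d.ch.γ ++ [d.hd]

theorem γ_α (d : D.Dart) : (α d).ch.γ = d.ch.γ.reverse := by
  change (of d.ch.rev).ch.γ = _
  rw [ch_of]; rfl

theorem pts_α (d : D.Dart) : (α d).pts = d.pts.reverse := by
  rw [pts, pts, γ_α, tl_α, hd_α]; simp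

theorem pts_infix (d : D.Dart) : d.pts <:+: d.ol :=
  ⟨d.ch.s, d.ch.t, by simp [pts, ol]⟩

theorem pts_nodup (d : D.Dart) : d.pts.Nodup := d.or_ol.nodup.sublist d.pts_infix.sublist

theorem useg_of_seg_pts {d : D.Dart} {s t : ℂ} (h : Seg d.pts s t) : USeg (D.L d.ed) s t :=
  d.or_ol.useg.1 (.inl (h.of_infix d.pts_infix))

theorem seg_pts (d : D.Dart) : Seg d.pts d.1.1 d.1.2 := by
  obtain ⟨r, hr⟩ := List.exists_headD d.ch.γ d.ch.p []
  refine ⟨[], r, ?_⟩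
  have : d.pts = d.tl :: (d.ch.γ ++ [d.ch.p]) := rfl
  rw [this, hr, d.ch.head]
  rfl

theorem seg_pts_iff {d d' : D.Dart} : Seg d'.pts d.1.1 d.1.2 ↔ d' = d := by
  constructor
  · intro h
    have h1 : d.1.1 = d'.1.1 := by
      by_contra hne
      obtain ⟨s, t, h⟩ := h
      rw [pts] at h
      rcases s with _ | ⟨a, s⟩
      · simp only [List.cons_append, List.nil_append, List.cons.injEq] at h
        exact hne h.1.symm
      · simp only [List.cons_append, List.cons.injEq] at h
        have h2 : d'.ch.γ = s ++ d.1.1 :: (d.1.2 :: t).dropLast := by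
          have := congrArg List.dropLast h.2
          rw [List.dropLast_concat] at this
          rw [this, List.dropLast_append_of_ne_nil (by simp)]
          rfl
        exact d'.ch.free d.1.1 (by rw [h2]; simp) d.2.2
    have h2 := d'.seg_pts
    rw [← h1] at h2
    exact ext' (Prod.ext h1.symm (h2.right_unique d'.pts_nodup h))
  · rintro rfl
    exact seg_pts _

theorem exists_potential (z : D.Dart → ℝ) (hz : ∀ d, z (α d) = - z d)
    (hF : ∀ F : {p // D.Node p} → ℝ, ∑ d : D.Dart, z d * F ⟨d.tl, d.2.2⟩ = 0) :
    ∃ χ : D.Dart → ℝ, (∀ d, χ (φ d) = χ d) ∧ ∀ d, χ d - χ (α d) = z d := by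
  classical
  set zH : ℂ × ℂ → ℝ := fun a => ∑ d : D.Dart, z d * if Seg d.pts a.1 a.2 then 1 else 0 with hzH
  have hanti : ∀ (f : D.Dart → ℝ), (∀ d, f (α d) = - f d) → ∑ d, f d = 0 := by
    intro f hf
    have := Equiv.sum_comp (α : Equiv.Perm D.Dart) f
    simp only [hf, Finset.sum_neg_distrib] at this
    linarith
  have h1 : ∀ a, zH a.swap = - zH a := by
    rintro ⟨s, t⟩
    rw [hzH]
    simp only [Prod.fst_swap, Prod.snd_swap]
    rw [← Equiv.sum_comp (α : Equiv.Perm D.Dart), ← Finset.sum_neg_distrib]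
    refine Finset.sum_congr rfl fun d _ => ?_
    rw [hz, pts_α]
    simp only [seg_reverse]
    ring
  have h2 : ∀ F : ℂ → ℝ, ∑ a ∈ D.H, zH a * F a.1 = 0 := by
    intro F
    have h3 : ∀ d : D.Dart, ∑ a ∈ D.H, (z d * if Seg d.pts a.1 a.2 then 1 else 0) * F a.1 =
        z d * F d.tl + z d * (d.ch.γ.map F).sum := by
      intro d
      have h4 := sum_seg (H := D.H) F (l := d.tl :: d.ch.γ) (p := d.hd) d.pts_nodup
        fun s t h => D.mem_H.2 ⟨_, useg_of_seg_pts h⟩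
      rw [← mul_add, ← List.sum_cons, ← List.map_cons, ← h4, Finset.mul_sum]
      refine Finset.sum_congr rfl fun a _ => ?_
      rw [mul_assoc]
      congr 1
      rw [ite_mul, one_mul, zero_mul]
      rfl
    simp only [hzH, Finset.sum_mul]
    rw [Finset.sum_comm]
    simp only [h3, Finset.sum_add_distrib]
    rw [hF fun p => F p.1, zero_add]
    refine hanti _ fun d => ?_
    rw [hz, γ_α, List.map_reverse, List.sum_reverse]
    ring
  obtain ⟨ρ, hρ, hρ'⟩ := exists_face_potential D.isPlaneGraph h1 h2
  have hconst : ∀ d : D.Dart, ρ d.1.1 d.1.2 = ρ (α d).1.2 d.hd := by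
    intro d
    have := const_of_free hρ d.or_ol d.ch.free
    rw [show d.hd = d.ch.p from rfl, d.ch.head] at this
    exact this
  refine ⟨fun d => ρ d.1.1 d.1.2, fun d => ?_, fun d => ?_⟩
  · change ρ d.hd (nextPt D.H d.hd (α d).1.2) = _
    have h5 := (D.isPlaneGraph).symm (α d).2.1
    exact (hρ _ _ h5).trans (hconst d).symm
  · have h6 := hconst (α d)
    rw [α_α, hd_α] at h6
    change _ - ρ (α d).1.1 (α d).1.2 = _
    rw [h6]
    change ρ d.1.1 d.1.2 - ρ d.1.2 d.1.1 = _
    rw [hρ' _ _ d.2.1, hzH]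
    simp [seg_pts_iff]

end Dart

theorem Cross.exists_four {p : ℂ} (hp : D.Cross p) :
    ∃ f : Fin 4 → ℂ, Function.Injective f ∧ ∀ i, (p, f i) ∈ D.H := by
  obtain ⟨hr, e, -, -, he, -⟩ := id hp
  obtain ⟨l₁, a, c, l₂, hl⟩ := Or.exists_split (D := D) (.inl rfl) he hr
  obtain ⟨f, m₁, m₂, b, d, -, -, hN, h1, h2, h3, h4, h5, h6⟩ := hp.exists_split (D := D) (.inl hl.symm)
  refine ⟨![a, c, b, d], ?_, ?_⟩
  · intro i j
    fin_cases i <;> fin_cases j <;> simp_all [eq_comm]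
  · intro i
    fin_cases i
    · exact D.mem_H.2 ⟨e, (hN _ _).2 (.inl ⟨rfl, .inl rfl⟩)⟩
    · exact D.mem_H.2 ⟨e, (hN _ _).2 (.inl ⟨rfl, .inr rfl⟩)⟩
    · exact D.mem_H.2 ⟨f, (hN _ _).2 (.inr ⟨rfl, .inl rfl⟩)⟩
    · exact D.mem_H.2 ⟨f, (hN _ _).2 (.inr ⟨rfl, .inr rfl⟩)⟩

open Classical in
theorem four_mul_cr_le : 4 * D.cr ≤ (Finset.univ.filter fun d : D.Dart => ¬ Dart.R d).card := by
  choose f hf hf' using fun p : {z | D.Cross z} => Cross.exists_four p.2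
  have : Finite {z | D.Cross z} := D.finite_cross
  have := Fintype.ofFinite {z | D.Cross z}
  rw [cr, ← Nat.card_coe_set_eq, Nat.card_eq_fintype_card]
  let g : {z | D.Cross z} × Fin 4 → D.Dart := fun x => ⟨(x.1.1, f x.1 x.2), hf' _ _, .inr x.1.2⟩
  have hg : Function.Injective g := by
    rintro ⟨p, i⟩ ⟨p', i'⟩ h
    have h := congrArg Subtype.val h
    simp only [g, Prod.mk.injEq] at h
    obtain ⟨h1, h2⟩ := h
    have h1 : p = p' := Subtype.ext h1
    subst h1
    rw [hf _ h2]
  have h := Finset.card_le_card_of_injOn (s := Finset.univ)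
    (t := Finset.univ.filter fun d : D.Dart => ¬ Dart.R d) g
    (fun x _ => by simpa [g, Dart.R, Dart.tl] using x.1.2.1) hg.injOn
  rw [Finset.card_univ, Fintype.card_prod, Fintype.card_fin] at h
  omega

/-- The number of crossings of a minimal drawing. -/
theorem IsMin.cr_le [Fintype V] (hD : D.IsMin) (hinj : Function.Injective ends)
    (hV : 2 ≤ Fintype.card V) : 10 * D.cr + 132 ≤ 66 * Fintype.card V := by
  classical
  have h4 := D.four_mul_cr_le
  rcases isEmpty_or_nonempty D.Dart with hemp | hne
  · rw [Finset.univ_eq_empty, Finset.filter_empty, Finset.card_empty] at h4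
    omega
  have hfin : Finite {p // D.Node p} :=
    ((Set.finite_range D.pos).union D.finite_cross).to_subtype
  have := Fintype.ofFinite {p // D.Node p}
  have hN : Nat.card {p // D.Node p} ≤ Fintype.card V + D.cr := by
    have h := Set.ncard_union_le (Set.range D.pos) {z | D.Cross z}
    have h' : (Set.range D.pos).ncard = Fintype.card V := by
      rw [← Nat.card_coe_set_eq, Nat.card_range_of_injective D.pos_inj, Nat.card_eq_fintype_card]
    rw [h'] at h
    exact (Nat.card_coe_set_eq _).trans_le h
  have he := euler_inequality (Dart.α (D := D)) Dart.φ (fun d => (⟨d.tl, d.2.2⟩ : {p // D.Node p}))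
    Dart.α_α (fun d h => Dart.tl_ne_hd d (by rw [← Dart.tl_α, h])) Dart.exists_potential
  have hf := (D.crossMap hD hinj).faces_le
  have hc : Nat.card D.Dart = (Finset.univ.filter fun d : D.Dart => ¬ Dart.R d).card +
      (Finset.univ.filter fun d : D.Dart => Dart.R d).card := by
    rw [Nat.card_eq_fintype_card, ← Finset.card_univ, add_comm]
    exact (Finset.card_filter_add_card_filter_not _).symm
  change (66 : ℤ) * (Nat.card (Quotient (Equiv.Perm.SameCycle.setoid (Dart.φ (D := D)))) : ℤ) ≤
    14 * ((Finset.univ.filter fun d : D.Dart => ¬ Dart.R d).card : ℤ) +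
    33 * ((Finset.univ.filter fun d : D.Dart => Dart.R d).card : ℤ) at hf
  omega

end PLDrawing

end Euler

section ToPlane

theorem Path.trans_injective {X : Type*} [TopologicalSpace X] {a b c : X} {γ : Path a b}
    {γ' : Path b c} (hγ : Function.Injective γ) (hγ' : Function.Injective γ')
    (h : ∀ z ∈ Set.range γ, z ∈ Set.range γ' → z = b) : Function.Injective (γ.trans γ') := by
  intro s t hst
  rw [Path.trans_apply, Path.trans_apply] at hst
  have key : ∀ (x y : I), γ x = γ' y → x = 1 ∧ y = 0 := by
    intro x y hxy
    have hb := h (γ x) ⟨x, rfl⟩ ⟨y, hxy.symm⟩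
    exact ⟨hγ (hb.trans γ.target.symm), hγ' ((hxy.symm.trans hb).trans γ'.source.symm)⟩
  split_ifs at hst with h1 h2 h2
  · have := congrArg Subtype.val (hγ hst)
    simp only at this
    exact Subtype.ext (by linarith)
  · obtain ⟨h3, h4⟩ := key _ _ hst
    have h3 := congrArg Subtype.val h3
    have h4 := congrArg Subtype.val h4
    simp only [Set.Icc.coe_one, Set.Icc.coe_zero] at h3 h4
    exact Subtype.ext (by linarith)
  · obtain ⟨h3, h4⟩ := key _ _ hst.symm
    have h3 := congrArg Subtype.val h3
    have h4 := congrArg Subtype.val h4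
    simp only [Set.Icc.coe_one, Set.Icc.coe_zero] at h3 h4
    exact Subtype.ext (by linarith)
  · have := congrArg Subtype.val (hγ' hst)
    simp only at this
    exact Subtype.ext (by linarith)

/-- A simple polygonal line is the range of an injective path. -/
theorem exists_path_polyline {l : List ℂ} {a b : ℂ} (hl : (a :: (l ++ [b])).Nodup)
    (hs : ∀ p q p' q' z, Seg (a :: (l ++ [b])) p q → Seg (a :: (l ++ [b])) p' q' →
      z ∈ segment ℝ p q → z ∈ segment ℝ p' q' → (p = p' ∧ q = q') ∨
        ((z = p ∨ z = q) ∧ (z = p' ∨ z = q'))) :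
    ∃ γ : Path a b, Function.Injective γ ∧
      ∀ z ∈ Set.range γ, ∃ p q, Seg (a :: (l ++ [b])) p q ∧ z ∈ segment ℝ p q := by
  induction l generalizing a with
  | nil =>
    refine ⟨Path.segment a b, Path.segment_injective_of_ne (by simpa using hl), fun z hz => ?_⟩
    rw [Path.range_segment] at hz
    exact ⟨a, b, ⟨[], [], rfl⟩, hz⟩
  | cons c l ih =>
    have hl' := List.nodup_cons.1 hl
    have hm : ∀ {p q}, Seg (c :: (l ++ [b])) p q → Seg (a :: (c :: l ++ [b])) p q := by
      intro p q h
      rw [List.cons_append, seg_cons_cons]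
      exact .inr h
    obtain ⟨γ', h1, h2⟩ := ih hl'.2 fun p q p' q' z h h' => hs p q p' q' z (hm h) (hm h')
    have hac : a ≠ c := fun h => hl'.1 (by simp [h])
    refine ⟨(Path.segment a c).trans γ', Path.trans_injective (Path.segment_injective_of_ne hac) h1 ?_, ?_⟩
    · intro z hz hz'
      rw [Path.range_segment] at hz
      obtain ⟨p, q, h3, h4⟩ := h2 z hz'
      rcases hs a c p q z ⟨[], l ++ [b], rfl⟩ (hm h3) hz h4 with ⟨rfl, -⟩ | ⟨rfl | h5, h6⟩
      · exact absurd h3.left_mem hl'.1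
      · exfalso
        rcases h6 with rfl | rfl
        · exact hl'.1 h3.left_mem
        · exact hl'.1 h3.right_mem
      · exact h5
    · intro z hz
      rw [Path.trans_range] at hz
      rcases hz with hz | hz
      · rw [Path.range_segment] at hz
        exact ⟨a, c, ⟨[], l ++ [b], rfl⟩, hz⟩
      · obtain ⟨p, q, h3, h4⟩ := h2 z hz
        exact ⟨p, q, hm h3, h4⟩

namespace PLDrawing

section

variable {V E : Type*} {ends : E → Sym2 V} (D : PLDrawing ends)

theorem exists_path (e : E) : ∃ u v, ends e = s(u, v) ∧ ∃ γ : Path (D.pos u) (D.pos v),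
    Function.Injective γ ∧ ∀ z ∈ Set.range γ, ∃ p q, USeg (D.L e) p q ∧ z ∈ segment ℝ p q := by
  obtain ⟨u, v, l, he, hl, -⟩ := D.shape e
  have hnd := D.nodup e
  rw [hl] at hnd
  obtain ⟨γ, h1, h2⟩ := exists_path_polyline hnd (by
    intro p q p' q' z h h' hz hz'
    rw [← hl] at h h'
    rcases D.inter (.inl h) (.inl h') hz hz' with h3 | ⟨rfl, rfl⟩ | h3
    · exact .inl h3
    · exact absurd h' (h.not_symm (D.nodup e))
    · exact .inr h3)
  refine ⟨u, v, he, γ, h1, fun z hz => ?_⟩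
  obtain ⟨p, q, h3, h4⟩ := h2 z hz
  rw [← hl] at h3
  exact ⟨p, q, .inl h3, h4⟩

theorem exists_arcs : ∃ arc : ∀ (e : E) (u v : V), ends e = s(u, v) → Path (D.pos u) (D.pos v),
    (∀ e u v h h', arc e v u h' = (arc e u v h).symm) ∧
    (∀ e u v h, Function.Injective (arc e u v h)) ∧
    ∀ e u v h, ∀ z ∈ Set.range (arc e u v h), ∃ p q, USeg (D.L e) p q ∧ z ∈ segment ℝ p q := by
  classical
  choose a b hab γ h1 h2 using D.exists_path
  have hne : ∀ e, a e ≠ b e := by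
    intro e h
    have h3 := congrArg D.pos h
    have := h1 e ((γ e).source.trans (h3.trans (γ e).target.symm))
    simp at this
  have key : ∀ e u v, ends e = s(u, v) → (u = a e ∧ v = b e) ∨ (u = b e ∧ v = a e) := by
    intro e u v h
    rw [hab, Sym2.eq_iff] at h
    rcases h with ⟨h, h'⟩ | ⟨h, h'⟩
    · exact .inl ⟨h.symm, h'.symm⟩
    · exact .inr ⟨h'.symm, h.symm⟩
  have key' : ∀ e u v, ends e = s(u, v) → u ≠ a e → (u = b e ∧ v = a e) := fun e u v h hu =>
    (key e u v h).resolve_left fun h => hu h.1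
  have key2 : ∀ e u v, ends e = s(u, v) → u = a e → v = b e := fun e u v h hu =>
    (key e u v h).elim (fun h => h.2) fun h => absurd (hu.symm.trans h.1) (hne e)
  let arc : ∀ (e : E) (u v : V), ends e = s(u, v) → Path (D.pos u) (D.pos v) := fun e u v h =>
    if hu : u = a e then (γ e).cast (by rw [hu]) (by rw [key2 e u v h hu]) else
      (γ e).symm.cast (by rw [(key' e u v h hu).1]) (by rw [(key' e u v h hu).2])
  have harc : ∀ e u v h, (arc e u v h : I → ℂ) = γ e ∨ (arc e u v h : I → ℂ) = (γ e).symm := by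
    intro e u v h
    by_cases hu : u = a e
    · left; simp only [arc, dif_pos hu]; rfl
    · right; simp only [arc, dif_neg hu]; rfl
  refine ⟨arc, ?_, ?_, ?_⟩
  · intro e u v h h'
    ext t
    by_cases hu : u = a e
    · have hv : v ≠ a e := fun hv => hne e ((hv.symm.trans (key2 e u v h hu)))
      simp only [arc, dif_pos hu, dif_neg hv]
      rfl
    · have hv : v = a e := (key' e u v h hu).2
      simp only [arc, dif_neg hu, dif_pos hv]
      simp [Path.symm]
  · intro e u v h
    rcases harc e u v h with h3 | h3
    · rw [h3]; exact h1 e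
    · rw [h3]; exact (h1 e).comp unitInterval.symm_bijective.injective
  · intro e u v h z hz
    apply h2 e
    rcases harc e u v h with h3 | h3
    · rwa [h3] at hz
    · rwa [h3, Path.symm_range] at hz

end

theorem exists_planeDrawing {V : Type*} {G : SimpleGraph V} [Finite G.edgeSet]
    (D : PLDrawing (Subtype.val : G.edgeSet → Sym2 V)) :
    ∃ D' : PlaneDrawing G, D'.crossingCount ≤ D.cr := by
  obtain ⟨arc, hsymm, hinj, hrange⟩ := D.exists_arcs
  let ψ := Complex.equivRealProdCLM.toHomeomorph
  have hψ : Function.Injective ψ := ψ.injective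
  have hmem : ∀ {e f : G.edgeSet} {u v x y : V} {h h'} {z : ℂ}, e ≠ f →
      z ∈ Set.range (arc e u v h) → z ∈ Set.range (arc f x y h') → z ∈ D.L e := by
    intro e f u v x y h h' z hef hz hz'
    obtain ⟨p, q, h1, h2⟩ := hrange _ _ _ _ z hz
    obtain ⟨p', q', h3, h4⟩ := hrange _ _ _ _ z hz'
    rcases D.inter h1 h3 h2 h4 with ⟨rfl, rfl⟩ | ⟨rfl, rfl⟩ | ⟨rfl | rfl, -⟩
    · exact absurd (D.sep h1 h3) hef
    · exact absurd (D.sep h1 h3.symm) hef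
    · exact h1.left_mem
    · exact h1.right_mem
  have hvert : ∀ {e : G.edgeSet} {u v : V} {h} {w : V}, D.pos w ∈ Set.range (arc e u v h) →
      w = u ∨ w = v := by
    intro e u v h w hw
    obtain ⟨p, q, h1, h2⟩ := hrange _ _ _ _ _ hw
    have h3 : D.pos w ∈ D.L e := by
      rcases D.vert h1 h2 with h3 | h3
      · rw [h3]; exact h1.left_mem
      · rw [h3]; exact h1.right_mem
    obtain ⟨u', v', l, h4, h5, h6⟩ := D.shape e
    rw [h5] at h3
    simp only [List.mem_cons, List.mem_append, h6 w, D.pos_inj.eq_iff, List.not_mem_nil, or_false,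
      false_or] at h3
    rw [h4, Sym2.eq_iff] at h
    grind
  have h_interior : ∀ {e : G.edgeSet} {u v : V} {h} {t : I}, t ≠ 0 → t ≠ 1 →
      arc e u v h t ∉ Set.range D.pos := by
    rintro e u v h t h0 h1 ⟨w, hw⟩
    rcases hvert (h := h) ⟨t, hw.symm⟩ with rfl | rfl
    · exact h0 (hinj _ _ _ h (hw.symm.trans (Path.source _).symm))
    · exact h1 (hinj _ _ _ h (hw.symm.trans (Path.target _).symm))
  have hne : ∀ {u v x y : V} {h₁ : G.Adj u v} {h₂ : G.Adj x y}, s(u, v) ≠ s(x, y) →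
      (⟨s(u, v), h₁⟩ : G.edgeSet) ≠ ⟨s(x, y), h₂⟩ := fun h h' => h (congrArg Subtype.val h')
  have hcongr : ∀ {e f : G.edgeSet} {u v : V} (h h'), e = f → arc e u v h = arc f u v h' := by
    rintro e f u v h h' rfl; rfl
  refine ⟨⟨fun v => ψ (D.pos v), hψ.comp D.pos_inj,
    fun u v h => (arc ⟨s(u, v), h⟩ u v rfl).map ψ.continuous, ?_, ?_, ?_, ?_, ?_⟩, ?_⟩
  · intro u v h
    have : (⟨s(v, u), h.symm⟩ : G.edgeSet) = ⟨s(u, v), h⟩ := Subtype.ext Sym2.eq_swap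
    rw [hcongr rfl Sym2.eq_swap this, hsymm ⟨s(u, v), h⟩ u v rfl]
    rfl
  · intro u v h
    exact hψ.comp (hinj _ _ _ _)
  · intro u v h w t ht
    exact hvert ⟨t, hψ ht⟩
  · intro u v x y h₁ h₂ hne'
    refine ((D.L ⟨s(u, v), h₁⟩).finite_toSet.image ψ).subset ?_
    rintro _ ⟨⟨s, rfl⟩, ⟨t, ht⟩⟩
    exact ⟨_, hmem (h := rfl) (h' := rfl) (hne (h₁ := h₁) (h₂ := h₂) hne') ⟨s, rfl⟩ ⟨t, hψ ht⟩, rfl⟩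
  · intro u₁ v₁ u₂ v₂ u₃ v₃ h₁ h₂ h₃ h12 h13 h23 t₁ t₂ t₃ a1 b1 a2 b2 a3 b3 e1 e2
    have e1 := hψ e1
    have e2 := hψ e2
    have m1 := hmem (h := rfl) (h' := rfl) (hne (h₁ := h₁) (h₂ := h₂) h12) ⟨t₁, rfl⟩ ⟨t₂, e1.symm⟩
    have m2 := hmem (h := rfl) (h' := rfl) (hne (h₁ := h₂) (h₂ := h₃) h23) ⟨t₂, e1.symm⟩
      ⟨t₃, (e1.trans e2).symm⟩
    have m3 := hmem (h := rfl) (h' := rfl) (hne (h₁ := h₃) (h₂ := h₁) h13.symm)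
      ⟨t₃, (e1.trans e2).symm⟩ ⟨t₁, rfl⟩
    rcases D.triple (h_interior a1 b1) m1 m2 m3 with h | h | h
    · exact hne h12 h
    · exact hne h13 h
    · exact hne h23 h
  · rw [PlaneDrawing.crossingCount, cr, ← Set.ncard_image_of_injective _ hψ]
    refine Set.ncard_le_ncard ?_ (D.finite_cross.image _)
    rintro _ ⟨u, v, x, y, h₁, h₂, h12, ⟨s, hs0, hs1, rfl⟩, ⟨t, -, -, ht⟩⟩
    have ht := hψ ht
    refine ⟨arc ⟨s(u, v), h₁⟩ u v rfl s, ⟨h_interior hs0 hs1, ⟨s(u, v), h₁⟩, ⟨s(x, y), h₂⟩, hne h12, ?_, ?_⟩, rfl⟩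
    · exact hmem (h := rfl) (h' := rfl) (hne (h₁ := h₁) (h₂ := h₂) h12) ⟨s, rfl⟩ ⟨t, ht⟩
    · exact hmem (h := rfl) (h' := rfl) (hne (h₁ := h₂) (h₂ := h₁) h12.symm) ⟨t, ht⟩ ⟨s, rfl⟩

end PLDrawing

end ToPlane

section Simple

/-- `z` lies on the polygonal line through the points of `l`. -/
def OnLine (l : List ℂ) (z : ℂ) : Prop := z ∈ l ∨ ∃ p q, Seg l p q ∧ z ∈ segment ℝ p q

/-- The polygonal line through the points of `l` is simple. -/
def SimpleLine (l : List ℂ) : Prop := l.Nodup ∧ ∀ p q p' q' z, Seg l p q → Seg l p' q' →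
  z ∈ segment ℝ p q → z ∈ segment ℝ p' q' → (p = p' ∧ q = q') ∨
    ((z = p ∨ z = q) ∧ (z = p' ∨ z = q'))

theorem onLine_singleton {a z : ℂ} : OnLine [a] z ↔ z = a := by
  simp [OnLine, not_seg_singleton]

theorem onLine_cons_cons {a b z : ℂ} {l : List ℂ} :
    OnLine (a :: b :: l) z ↔ z ∈ segment ℝ a b ∨ OnLine (b :: l) z := by
  constructor
  · rintro (h | ⟨p, q, h, hz⟩)
    · rcases List.mem_cons.1 h with rfl | h
      · exact .inl (left_mem_segment ℝ _ _)
      · exact .inr (.inl h)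
    · rcases seg_cons_cons.1 h with ⟨rfl, rfl⟩ | h
      · exact .inl hz
      · exact .inr (.inr ⟨p, q, h, hz⟩)
  · rintro (h | h | ⟨p, q, h, hz⟩)
    · exact .inr ⟨a, b, seg_cons_cons.2 (.inl ⟨rfl, rfl⟩), h⟩
    · exact .inl (List.mem_cons_of_mem _ h)
    · exact .inr ⟨p, q, seg_cons_cons.2 (.inr h), hz⟩

theorem isClosed_onLine (l : List ℂ) : IsClosed {z | OnLine l z} := by
  induction l with
  | nil => simp [OnLine, not_seg_nil]
  | cons a l ih =>
    cases l with
    | nil => simp [onLine_singleton]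
    | cons b l =>
      simp only [onLine_cons_cons, Set.ofPred_or]
      refine IsClosed.union ?_ ih
      rw [Set.ofPred_mem_eq, segment_eq_image_lineMap]
      exact (isCompact_Icc.image (AffineMap.lineMap_continuous)).isClosed

theorem simpleLine_singleton (a : ℂ) : SimpleLine [a] := by
  simp [SimpleLine, not_seg_singleton]

theorem SimpleLine.cons {x y : ℂ} {r : List ℂ} (h : SimpleLine (y :: r)) (hxy : x ≠ y)
    (hz : ∀ z ∈ segment ℝ x y, OnLine (y :: r) z → z = y) : SimpleLine (x :: y :: r) := by
  have key : ∀ {p q z : ℂ}, Seg (y :: r) p q → z ∈ segment ℝ x y → z ∈ segment ℝ p q →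
      z = y ∧ (z = p ∨ z = q) := by
    intro p q z hs h1 h2
    have h3 := hz z h1 (.inr ⟨p, q, hs, h2⟩)
    refine ⟨h3, ?_⟩
    subst h3
    rcases r with _ | ⟨c, r⟩
    · exact absurd hs not_seg_singleton
    · rcases h.2 z c p q z ⟨[], r, rfl⟩ hs (left_mem_segment ℝ _ _) h2 with h4 | h4
      · exact .inl h4.1
      · exact h4.2
  refine ⟨List.nodup_cons.2 ⟨fun hx => hxy (hz x (left_mem_segment ℝ _ _) (.inl hx)), h.1⟩, ?_⟩
  intro p q p' q' z h1 h2 h3 h4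
  rcases seg_cons_cons.1 h1 with ⟨rfl, rfl⟩ | h1' <;>
    rcases seg_cons_cons.1 h2 with ⟨rfl, rfl⟩ | h2'
  · exact .inl ⟨rfl, rfl⟩
  · exact .inr ⟨.inr (key h2' h3 h4).1, (key h2' h3 h4).2⟩
  · exact .inr ⟨(key h1' h4 h3).2, .inr (key h1' h4 h3).1⟩
  · exact h.2 _ _ _ _ _ h1' h2' h3 h4

theorem SimpleLine.of_cons {x y : ℂ} {r : List ℂ} (h : SimpleLine (x :: y :: r)) :
    SimpleLine (y :: r) ∧ x ≠ y ∧ ∀ z ∈ segment ℝ x y, OnLine (y :: r) z → z = y := by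
  have hs : ∀ {p q}, Seg (y :: r) p q → Seg (x :: y :: r) p q := fun h => seg_cons_cons.2 (.inr h)
  have hx := (List.nodup_cons.1 h.1).1
  refine ⟨⟨(List.nodup_cons.1 h.1).2, fun p q p' q' z h1 h2 => h.2 p q p' q' z (hs h1) (hs h2)⟩,
    fun h => hx (by simp [h]), ?_⟩
  have key : ∀ {p q z : ℂ}, Seg (y :: r) p q → z ∈ segment ℝ x y → z ∈ segment ℝ p q → z = y := by
    intro p q z h1 h2 h3
    rcases h.2 x y p q z ⟨[], r, rfl⟩ (hs h1) h2 h3 with h4 | ⟨rfl | h4, h5⟩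
    · exact absurd (h4.1 ▸ h1.left_mem) hx
    · rcases h5 with rfl | rfl
      · exact absurd h1.left_mem hx
      · exact absurd h1.right_mem hx
    · exact h4
  rintro z hz (h1 | ⟨p, q, h1, h2⟩)
  · rcases r with _ | ⟨c, r⟩
    · simpa using h1
    · obtain ⟨s, t, hst⟩ := List.append_of_mem h1
      rcases s with _ | ⟨a, s⟩
      · simp only [List.nil_append, List.cons.injEq] at hst
        exact hst.1.symm
      · obtain ⟨s', b, hb⟩ := (List.eq_nil_or_concat (a :: s)).resolve_left (by simp)
        have : Seg (y :: c :: r) b z := ⟨s', t, by rw [hst, hb]; simp⟩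
        exact key this hz (right_mem_segment ℝ _ _)
  · exact key h1 hz h2

/-- A simple polygonal line can be started at any of its points. -/
theorem SimpleLine.exists_tail {l : List ℂ} {q z : ℂ} (h : SimpleLine (l ++ [q]))
    (hz : OnLine (l ++ [q]) z) : ∃ T l', z :: T = l' ++ [q] ∧ SimpleLine (z :: T) ∧
      ∀ w, OnLine (z :: T) w → OnLine (l ++ [q]) w := by
  induction l with
  | nil =>
    rw [List.nil_append, onLine_singleton] at hz
    subst hz
    exact ⟨[], [], rfl, h, fun w hw => hw⟩
  | cons x l ih =>
    obtain ⟨y, r, hr⟩ := List.exists_cons_of_ne_nil (l := l ++ [q]) (by simp)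
    rw [List.cons_append, hr] at h hz ⊢
    rw [hr] at ih
    obtain ⟨h1, h2, h3⟩ := h.of_cons
    by_cases hz' : OnLine (y :: r) z
    · obtain ⟨T, l', h4, h5, h6⟩ := ih h1 hz'
      exact ⟨T, l', h4, h5, fun w hw => onLine_cons_cons.2 (.inr (h6 w hw))⟩
    · have hz := (onLine_cons_cons.1 hz).resolve_right hz'
      have hsub : segment ℝ z y ⊆ segment ℝ x y :=
        (convex_segment x y).segment_subset hz (right_mem_segment ℝ _ _)
      refine ⟨y :: r, z :: l, by rw [List.cons_append, hr], h1.cons ?_ fun w hw => h3 w (hsub hw), ?_⟩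
      · rintro rfl
        exact hz' (.inl (by simp))
      · intro w hw
        rw [onLine_cons_cons] at hw ⊢
        exact hw.imp_left fun h => hsub h

theorem exists_first_hit {l : List ℂ} {x y : ℂ} (h : OnLine l y) : ∃ z ∈ segment ℝ x y,
    OnLine l z ∧ ∀ w ∈ segment ℝ x z, OnLine l w → w = z := by
  have hc : IsCompact {t : ℝ | t ∈ Set.Icc (0 : ℝ) 1 ∧ OnLine l (AffineMap.lineMap x y t)} :=
    isCompact_Icc.inter_right ((isClosed_onLine l).preimage AffineMap.lineMap_continuous)
  obtain ⟨t, ⟨ht, ht'⟩, hmin⟩ := hc.exists_isLeast ⟨1, by simp, by simpa using h⟩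
  refine ⟨AffineMap.lineMap x y t, ?_, ht', ?_⟩
  · rw [segment_eq_image_lineMap]
    exact ⟨t, ht, rfl⟩
  · intro w hw hwl
    rw [segment_eq_image_lineMap] at hw
    obtain ⟨s, hs, rfl⟩ := hw
    have h1 : AffineMap.lineMap x (AffineMap.lineMap x y t) s = AffineMap.lineMap x y (s * t) := by
      simp only [AffineMap.lineMap_apply_module']
      simp only [add_sub_cancel_right, smul_smul]
    rw [h1] at hwl ⊢
    have h2 := hmin ⟨⟨mul_nonneg hs.1 ht.1, mul_le_one₀ hs.2 ht.1 ht.2⟩, hwl⟩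
    have h3 : s * t = t := le_antisymm (mul_le_of_le_one_left ht.1 hs.2) h2
    rw [h3]

/-- Points joined by a sequence of segments in a set are joined by a simple polygonal line. -/
theorem exists_simpleLine {U : Set ℂ} {p q : ℂ}
    (h : Relation.ReflTransGen (fun x y => segment ℝ x y ⊆ U) p q) (hpq : p ≠ q) :
    ∃ l, SimpleLine (p :: (l ++ [q])) ∧ ∀ z, OnLine (p :: (l ++ [q])) z → z ∈ U := by
  have key : p = q ∨ q ∈ U ∧ ∃ T l', p :: T = l' ++ [q] ∧ SimpleLine (p :: T) ∧
      ∀ z, OnLine (p :: T) z → z ∈ U := by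
    clear hpq
    induction h using Relation.ReflTransGen.head_induction_on with
    | refl => exact .inl rfl
    | @head x y hxy _ ih =>
      have ih' : q ∈ U ∧ ∃ T l', y :: T = l' ++ [q] ∧ SimpleLine (y :: T) ∧
          ∀ z, OnLine (y :: T) z → z ∈ U := by
        rcases ih with rfl | h
        · have hy : y ∈ U := hxy (right_mem_segment ℝ _ _)
          exact ⟨hy, [], [], rfl, simpleLine_singleton y, fun z hz => by
            rw [onLine_singleton] at hz; rwa [hz]⟩
        · exact h
      obtain ⟨hq, T, l, h1, h2, h3⟩ := ih'
      obtain ⟨z, hz, hz', hz''⟩ := exists_first_hit (l := y :: T) (x := x) (y := y) (.inl (by simp))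
      rw [h1] at h2 hz'
      obtain ⟨T', l', h4, h5, h6⟩ := h2.exists_tail hz'
      rw [← h1] at h6
      refine .inr ⟨hq, ?_⟩
      rcases eq_or_ne x z with rfl | hxz
      · exact ⟨T', l', h4, h5, fun w hw => h3 w (h6 w hw)⟩
      · refine ⟨z :: T', x :: l', by rw [h4]; rfl,
          h5.cons hxz fun w hw hw' => hz'' w hw (h6 w hw'), fun w hw => ?_⟩
        rcases onLine_cons_cons.1 hw with hw | hw
        · exact hxy ((convex_segment x y).segment_subset (left_mem_segment ℝ _ _) hz hw)
        · exact h3 w (h6 w hw)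
  obtain ⟨-, T, l', h1, h2, h3⟩ := key.resolve_left hpq
  rcases l' with _ | ⟨a, l⟩
  · simp only [List.nil_append, List.cons.injEq] at h1
    exact absurd h1.1 hpq
  · simp only [List.cons_append, List.cons.injEq] at h1
    rw [h1.2] at h2 h3
    exact ⟨l, h2, h3⟩

end Simple

section Polygonalize

theorem exists_last_eq {f : ℝ → ℝ} (hf : Continuous f) {a b r : ℝ} (hab : a ≤ b) (ha : f a ≤ r)
    (hb : r < f b) : ∃ t ∈ Set.Icc a b, f t = r ∧ ∀ u ∈ Set.Icc t b, f u ≤ r → u = t := by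
  have hc : IsCompact (Set.Icc a b ∩ f ⁻¹' Set.Iic r) :=
    isCompact_Icc.inter_right (isClosed_Iic.preimage hf)
  obtain ⟨t, ⟨ht, ht'⟩, hmax⟩ := hc.exists_isGreatest ⟨a, ⟨le_rfl, hab⟩, ha⟩
  have key : ∀ u ∈ Set.Icc t b, f u ≤ r → u = t := fun u hu h =>
    le_antisymm (hmax ⟨⟨ht.1.trans hu.1, hu.2⟩, h⟩) hu.1
  refine ⟨t, ht, ?_, key⟩
  obtain ⟨u, hu, hu'⟩ := intermediate_value_Icc ht.2 hf.continuousOn ⟨ht', hb.le⟩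
  rw [← key u hu hu'.le, hu']

theorem exists_first_eq {f : ℝ → ℝ} (hf : Continuous f) {a b r : ℝ} (hab : a ≤ b) (ha : r < f a)
    (hb : f b ≤ r) : ∃ t ∈ Set.Icc a b, f t = r ∧ ∀ u ∈ Set.Icc a t, f u ≤ r → u = t := by
  obtain ⟨t, ht, h1, h2⟩ := exists_last_eq (f := fun u => f (-u)) (a := -b) (b := -a) (r := r)
    (by fun_prop) (by linarith) (by simpa using hb) (by simpa using ha)
  refine ⟨-t, ⟨by linarith [ht.2], by linarith [ht.1]⟩, h1, fun u hu h => ?_⟩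
  have := h2 (-u) ⟨by linarith [hu.2], by linarith [hu.1]⟩ (by simpa using h)
  linarith

theorem exists_truncation {g : ℝ → ℂ} (hg : Continuous g) {s t r : ℝ} (hst : s ≤ t) (hr : 0 < r)
    (h : 2 * r < dist (g s) (g t)) : ∃ a b, s < a ∧ a ≤ b ∧ b < t ∧ dist (g a) (g s) = r ∧
      dist (g b) (g t) = r ∧ (∀ u ∈ Set.Icc a b, dist (g u) (g s) ≤ r → u = a) ∧
      ∀ u ∈ Set.Icc a b, dist (g u) (g t) ≤ r → u = b := by
  obtain ⟨a, ha, h1, h2⟩ := exists_last_eq (f := fun u => dist (g u) (g s)) (r := r) (by fun_prop)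
    hst (by simpa using hr.le) (by rw [dist_comm]; linarith)
  have h3 := dist_triangle_left (g s) (g t) (g a)
  obtain ⟨b, hb, h4, h5⟩ := exists_first_eq (f := fun u => dist (g u) (g t)) (r := r) (by fun_prop)
    ha.2 (by linarith) (by simpa using hr.le)
  refine ⟨a, b, lt_of_le_of_ne ha.1 ?_, hb.1, lt_of_le_of_ne hb.2 ?_, h1, h4,
    fun u hu => h2 u ⟨hu.1, hu.2.trans hb.2⟩, h5⟩
  · rintro rfl
    simp at h1; exact hr.ne h1
  · rintro rfl
    simp at h4; exact hr.ne h4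

theorem dist_le_of_mem_segment {c x z : ℂ} (hz : z ∈ segment ℝ c x) : dist z c ≤ dist x c := by
  rw [segment_eq_image_lineMap] at hz
  obtain ⟨θ, hθ, rfl⟩ := hz
  rw [dist_lineMap_left, Real.norm_of_nonneg hθ.1, dist_comm c x]
  exact mul_le_of_le_one_left dist_nonneg hθ.2

theorem eq_of_mem_segment_of_dist {c x z : ℂ} (hz : z ∈ segment ℝ c x) (h : dist z c = dist x c) :
    z = x := by
  rw [segment_eq_image_lineMap] at hz
  obtain ⟨θ, hθ, rfl⟩ := hz
  rcases eq_or_ne x c with rfl | hxc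
  · simp
  rw [dist_lineMap_left, Real.norm_of_nonneg hθ.1, dist_comm c x] at h
  have := mul_right_cancel₀ (dist_ne_zero.2 hxc) (h.trans (one_mul _).symm)
  rw [this, AffineMap.lineMap_apply_one]

theorem eq_of_mem_segment_of_mem_segment {c x y z : ℂ} (hx : z ∈ segment ℝ c x)
    (hy : z ∈ segment ℝ c y) (h : dist x c = dist y c) (hz : z ≠ c) : x = y := by
  rw [segment_eq_image_lineMap] at hx hy
  obtain ⟨θ, hθ, rfl⟩ := hx
  obtain ⟨η, hη, h1⟩ := hy
  have hd := congrArg (fun w => dist w c) h1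
  simp only [dist_lineMap_left, Real.norm_of_nonneg hθ.1, Real.norm_of_nonneg hη.1,
    dist_comm c, h] at hd
  have hyc : y ≠ c := by
    rintro rfl
    rw [dist_self, dist_eq_zero] at h
    exact hz (by rw [h]; simp)
  have hηθ := mul_right_cancel₀ (dist_ne_zero.2 hyc) hd
  subst hηθ
  have hη0 : η ≠ 0 := by
    rintro rfl
    simp at hz
  simp only [AffineMap.lineMap_apply_module', add_left_inj] at h1
  have := smul_right_injective ℂ hη0 h1
  simpa using this.symm

theorem eventually_lt_nhdsGT_zero {c : ℝ} (hc : 0 < c) :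
    ∀ᶠ r in nhdsWithin (0 : ℝ) (Set.Ioi 0), r < c := by
  filter_upwards [Ioo_mem_nhdsGT hc] with r hr using hr.2

theorem eventually_disjoint_thickening {A B : Set ℂ} (h : Disjoint A B) (hA : IsCompact A)
    (hB : IsClosed B) : ∀ᶠ δ in nhdsWithin (0 : ℝ) (Set.Ioi 0),
      Disjoint (Metric.thickening δ A) (Metric.thickening δ B) := by
  obtain ⟨δ, hδ, h⟩ := h.exists_thickenings hA hB
  filter_upwards [eventually_lt_nhdsGT_zero hδ] with r hr
  exact h.mono (Metric.thickening_mono hr.le A) (Metric.thickening_mono hr.le B)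

theorem reflTransGen_thickening {M : Set ℂ} (hM : IsPreconnected M) {δ : ℝ} (hδ : 0 < δ) {x y : ℂ}
    (hx : x ∈ M) (hy : y ∈ M) :
    Relation.ReflTransGen (fun x y => segment ℝ x y ⊆ Metric.thickening δ M) x y := by
  have key : ∀ {x y}, x ∈ M → dist y x < δ → segment ℝ x y ⊆ Metric.thickening δ M := by
    intro x y hx hxy
    refine ((convex_ball x δ).segment_subset (Metric.mem_ball_self hδ) hxy).trans ?_
    exact Metric.ball_subset_thickening hx δ
  refine hM.induction₂' (fun x y => Relation.ReflTransGen
    (fun x y => segment ℝ x y ⊆ Metric.thickening δ M) x y) (fun x hx => ?_)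
    (fun x y z _ _ _ h h' => h.trans h') hx hy
  filter_upwards [mem_nhdsWithin_of_mem_nhds (Metric.ball_mem_nhds x hδ)] with y hy
  refine ⟨.single (key hx hy), .single ?_⟩
  rw [segment_symm]
  exact key hx hy

/-- Finitely many arcs that meet only in a finite set of common endpoints can be replaced by
simple polygonal lines with the same endpoints that still meet only there. -/
theorem exists_polylines {K : Type*} [Finite K] (P : Finset ℂ) (g : K → ℝ → ℂ)
    (hg : ∀ k, Continuous (g k)) (s t : K → ℝ) (hst : ∀ k, s k < t k)
    (hs : ∀ k, g k (s k) ∈ P) (ht : ∀ k, g k (t k) ∈ P) (hne : ∀ k, g k (s k) ≠ g k (t k))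
    (hP : ∀ k, ∀ u ∈ Set.Ioo (s k) (t k), g k u ∉ P)
    (hdisj : ∀ j k, j ≠ k → ∀ u ∈ Set.Ioo (s j) (t j), ∀ v ∈ Set.Ioo (s k) (t k), g j u ≠ g k v) :
    ∃ mid : K → List ℂ, (∀ k, SimpleLine (g k (s k) :: (mid k ++ [g k (t k)]))) ∧
      (∀ k z, OnLine (g k (s k) :: (mid k ++ [g k (t k)])) z → z ∈ P →
        z = g k (s k) ∨ z = g k (t k)) ∧
      ∀ j k z, j ≠ k → OnLine (g j (s j) :: (mid j ++ [g j (t j)])) z →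
        OnLine (g k (s k) :: (mid k ++ [g k (t k)])) z → z ∈ P := by
  obtain ⟨r, hr, hr1, hr2⟩ : ∃ r > 0, (∀ x ∈ P, ∀ y ∈ P, x ≠ y → 2 * r < dist x y) ∧
      ∀ k, ∀ x ∈ P, x ≠ g k (s k) → x ≠ g k (t k) → ∀ u ∈ Set.Icc (s k) (t k), r < dist (g k u) x := by
    have h1 : ∀ᶠ r in nhdsWithin (0 : ℝ) (Set.Ioi 0),
        ∀ x ∈ P, ∀ y ∈ P, x ≠ y → 2 * r < dist x y := by
      refine (Filter.eventually_all_finset P).2 fun x _ => (Filter.eventually_all_finset P).2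
        fun y _ => ?_
      by_cases hxy : x = y
      · simp [hxy]
      · filter_upwards [eventually_lt_nhdsGT_zero (half_pos (dist_pos.2 hxy))] with r hr _
        linarith
    have h2 : ∀ᶠ r in nhdsWithin (0 : ℝ) (Set.Ioi 0), ∀ k, ∀ x ∈ P, x ≠ g k (s k) →
        x ≠ g k (t k) → ∀ u ∈ Set.Icc (s k) (t k), r < dist (g k u) x := by
      refine Filter.eventually_all.2 fun k => (Filter.eventually_all_finset P).2 fun x hx => ?_
      by_cases hxk : x ≠ g k (s k) ∧ x ≠ g k (t k)
      · obtain ⟨u, hu, hmin⟩ := (isCompact_Icc (a := s k) (b := t k)).exists_isMinOn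
          ⟨s k, le_rfl, (hst k).le⟩ (f := fun u => dist (g k u) x)
          (by have := hg k; fun_prop)
        have hpos : 0 < dist (g k u) x := by
          refine dist_pos.2 fun h => ?_
          rcases eq_or_lt_of_le hu.1 with h3 | h3
          · exact hxk.1 (by rw [← h, h3])
          rcases eq_or_lt_of_le hu.2 with h4 | h4
          · exact hxk.2 (by rw [← h, h4])
          · exact hP k u ⟨h3, h4⟩ (by rw [h]; exact hx)
        filter_upwards [eventually_lt_nhdsGT_zero hpos] with r hr _ _ v hv
        exact hr.trans_le (hmin hv)
      · refine .of_forall fun r h h' => absurd ⟨h, h'⟩ hxk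
    obtain ⟨r, ⟨h1, h2⟩, h3⟩ := ((h1.and h2).and self_mem_nhdsWithin).exists
    exact ⟨r, h3, h1, h2⟩
  choose a b hsa hab hbt ha hb ha' hb' using fun k =>
    exists_truncation (hg k) (hst k).le hr (hr1 _ (hs k) _ (ht k) (hne k))
  have hIoo : ∀ k, ∀ u ∈ Set.Icc (a k) (b k), u ∈ Set.Ioo (s k) (t k) := fun k u hu =>
    ⟨(hsa k).trans_le hu.1, hu.2.trans_lt (hbt k)⟩
  set M : K → Set ℂ := fun k => g k '' Set.Icc (a k) (b k) with hM
  have haM : ∀ k, g k (a k) ∈ M k := fun k => ⟨_, ⟨le_rfl, hab k⟩, rfl⟩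
  have hbM : ∀ k, g k (b k) ∈ M k := fun k => ⟨_, ⟨hab k, le_rfl⟩, rfl⟩
  set S : K → Set ℂ := fun k => segment ℝ (g k (s k)) (g k (a k)) ∪
    segment ℝ (g k (t k)) (g k (b k)) with hS
  have hS' : ∀ k z, z ∈ S k → ∃ c x, c ∈ P ∧ (c = g k (s k) ∨ c = g k (t k)) ∧ x ∈ M k ∧
      dist x c = r ∧ z ∈ segment ℝ c x := by
    rintro k z (h | h)
    · exact ⟨_, _, hs k, .inl rfl, haM k, ha k, h⟩
    · exact ⟨_, _, ht k, .inr rfl, hbM k, hb k, h⟩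
  have hMP : ∀ k, Disjoint (M k) (P : Set ℂ) := by
    intro k
    rw [Set.disjoint_left]
    rintro _ ⟨u, hu, rfl⟩ h
    exact hP k u (hIoo k u hu) h
  have hMM : ∀ j k, j ≠ k → Disjoint (M j) (M k) := by
    intro j k hjk
    rw [Set.disjoint_left]
    rintro _ ⟨u, hu, rfl⟩ ⟨v, hv, h⟩
    exact hdisj j k hjk u (hIoo j u hu) v (hIoo k v hv) h.symm
  have hnear : ∀ k z c, z ∈ M k → c ∈ P → dist z c ≤ r → dist z c = r := by
    rintro k _ c ⟨u, hu, rfl⟩ hc h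
    by_cases h1 : c = g k (s k)
    · subst h1
      rw [ha' k u hu h, ha k]
    by_cases h2 : c = g k (t k)
    · subst h2
      rw [hb' k u hu h, hb k]
    · have := hr2 k c hc h1 h2 u ⟨(hIoo k u hu).1.le, (hIoo k u hu).2.le⟩
      linarith
  have hSM : ∀ j k, j ≠ k → Disjoint (M j) (S k) := by
    intro j k hjk
    rw [Set.disjoint_left]
    intro z hz hz'
    obtain ⟨c, x, hc, -, hx, hxc, hzc⟩ := hS' k z hz'
    have h1 := hnear j z c hz hc (hxc ▸ dist_le_of_mem_segment hzc)
    have h2 := eq_of_mem_segment_of_dist hzc (h1.trans hxc.symm)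
    subst h2
    exact Set.disjoint_left.1 (hMM j k hjk) hz hx
  have hSS : ∀ j k, j ≠ k → ∀ z ∈ S j, z ∈ S k → z ∈ P := by
    intro j k hjk z hz hz'
    obtain ⟨c, x, hc, -, hx, hxc, hzc⟩ := hS' j z hz
    obtain ⟨c', x', hc', -, hx', hxc', hzc'⟩ := hS' k z hz'
    have h1 := dist_le_of_mem_segment hzc
    have h2 := dist_le_of_mem_segment hzc'
    have hcc : c = c' := by
      by_contra hcc
      have := hr1 c hc c' hc' hcc
      have := dist_triangle_left c c' z
      linarith
    subst hcc
    by_contra hzP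
    have hzc0 : z ≠ c := fun h => hzP (h ▸ hc)
    have := eq_of_mem_segment_of_mem_segment hzc hzc' (hxc.trans hxc'.symm) hzc0
    subst this
    exact Set.disjoint_left.1 (hMM j k hjk) hx hx'
  have hSP : ∀ k, ∀ z ∈ S k, z ∈ P → z = g k (s k) ∨ z = g k (t k) := by
    intro k z hz hzP
    obtain ⟨c, x, hc, hcc, hx, hxc, hzc⟩ := hS' k z hz
    have hzc' : z = c := by
      by_contra h
      have := hr1 z hzP c hc h
      have := dist_le_of_mem_segment hzc
      linarith
    rwa [hzc']
  have hMc : ∀ k, IsCompact (M k) := fun k => isCompact_Icc.image (hg k)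
  have hSc : ∀ k, IsClosed (S k) := fun k => by
    refine IsClosed.union ?_ ?_ <;>
    · rw [segment_eq_image_lineMap]
      exact (isCompact_Icc.image AffineMap.lineMap_continuous).isClosed
  obtain ⟨δ, hδ, h1, h2, h3⟩ : ∃ δ > 0,
      (∀ k, Disjoint (Metric.thickening δ (M k)) (P : Set ℂ)) ∧
      (∀ j k, j ≠ k → Disjoint (Metric.thickening δ (M j)) (Metric.thickening δ (M k))) ∧
      ∀ j k, j ≠ k → Disjoint (Metric.thickening δ (M j)) (S k) := by
    have h1 : ∀ᶠ δ in nhdsWithin (0 : ℝ) (Set.Ioi 0), ∀ k,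
        Disjoint (Metric.thickening δ (M k)) (Metric.thickening δ (P : Set ℂ)) :=
      Filter.eventually_all.2 fun k => eventually_disjoint_thickening (hMP k) (hMc k)
        P.finite_toSet.isClosed
    have h2 : ∀ᶠ δ in nhdsWithin (0 : ℝ) (Set.Ioi 0), ∀ j k, j ≠ k →
        Disjoint (Metric.thickening δ (M j)) (Metric.thickening δ (M k)) := by
      refine Filter.eventually_all.2 fun j => Filter.eventually_all.2 fun k => ?_
      by_cases h : j = k
      · simp [h]
      · filter_upwards [eventually_disjoint_thickening (hMM j k h) (hMc j) (hMc k).isClosed]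
          with δ hδ _ using hδ
    have h3 : ∀ᶠ δ in nhdsWithin (0 : ℝ) (Set.Ioi 0), ∀ j k, j ≠ k →
        Disjoint (Metric.thickening δ (M j)) (Metric.thickening δ (S k)) := by
      refine Filter.eventually_all.2 fun j => Filter.eventually_all.2 fun k => ?_
      by_cases h : j = k
      · simp [h]
      · filter_upwards [eventually_disjoint_thickening (hSM j k h) (hMc j) (hSc k)]
          with δ hδ _ using hδ
    obtain ⟨δ, ⟨⟨h1, h2⟩, h3⟩, h4⟩ := (((h1.and h2).and h3).and self_mem_nhdsWithin).exists
    exact ⟨δ, h4, fun k => (h1 k).mono_right (Metric.self_subset_thickening h4 _), h2,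
      fun j k h => (h3 j k h).mono_right (Metric.self_subset_thickening h4 _)⟩
  set U : K → Set ℂ := fun k => S k ∪ Metric.thickening δ (M k) with hU
  have hmid : ∀ k, ∃ l, SimpleLine (g k (s k) :: (l ++ [g k (t k)])) ∧
      ∀ z, OnLine (g k (s k) :: (l ++ [g k (t k)])) z → z ∈ U k := by
    intro k
    refine exists_simpleLine ?_ (hne k)
    refine .head (b := g k (a k)) (fun z hz => .inl (.inl hz)) (.tail (b := g k (b k)) ?_ ?_)
    · exact Relation.ReflTransGen.mono (fun x y => (Set.Subset.trans · Set.subset_union_right)) _ _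
        (reflTransGen_thickening (isPreconnected_Icc.image _ (hg k).continuousOn) hδ
          (haM k) (hbM k))
    · rw [segment_symm]
      exact fun z hz => .inl (.inr hz)
  choose mid hm1 hm2 using hmid
  refine ⟨mid, hm1, fun k z hz hzP => ?_, fun j k z hjk hz hz' => ?_⟩
  · rcases hm2 k z hz with h | h
    · exact hSP k z h hzP
    · exact absurd hzP (Set.disjoint_left.1 (h1 k) h)
  · rcases hm2 j z hz with h | h <;> rcases hm2 k z hz' with h' | h'
    · exact hSS j k hjk z h h'
    · exact absurd h (Set.disjoint_left.1 (h3 k j hjk.symm) h')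
    · exact absurd h' (Set.disjoint_left.1 (h3 j k hjk) h)
    · exact absurd h' (Set.disjoint_left.1 (h2 j k hjk) h)

end Polygonalize

section Glue

/-- The list obtained from `l` by applying `g` and inserting `m s t` between the images of
consecutive entries `s` and `t`. -/
def glue {α β : Type*} (g : α → β) (m : α → α → List β) : List α → List β
  | [] => []
  | [t] => [g t]
  | s :: t :: r => g s :: (m s t ++ glue g m (t :: r))

variable {α β : Type*} {g : α → β} {m : α → α → List β}

theorem exists_glue_cons (t : α) (r : List α) : ∃ r', glue g m (t :: r) = g t :: r' := by
  cases r with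
  | nil => exact ⟨[], rfl⟩
  | cons a r => exact ⟨_, rfl⟩

theorem exists_glue_concat (l : List α) (t : α) : ∃ l', glue g m (l ++ [t]) = l' ++ [g t] := by
  induction l with
  | nil => exact ⟨[], rfl⟩
  | cons a l ih =>
    obtain ⟨l', h⟩ := ih
    obtain ⟨b, r, hr⟩ := List.exists_cons_of_ne_nil (l := l ++ [t]) (by simp)
    rw [List.cons_append, hr, glue, ← hr, h]
    exact ⟨g a :: (m a b ++ l'), by simp⟩

theorem exists_glue_cons_concat (s t : α) (l : List α) :
    ∃ l', glue g m (s :: (l ++ [t])) = g s :: (l' ++ [g t]) := by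
  obtain ⟨b, r, hr⟩ := List.exists_cons_of_ne_nil (l := l ++ [t]) (by simp)
  obtain ⟨l', h⟩ := exists_glue_concat (g := g) (m := m) l t
  rw [hr, glue, ← hr, h]
  exact ⟨m s b ++ l', by simp⟩

theorem mem_glue {l : List α} {z : β} :
    z ∈ glue g m l ↔ (∃ t ∈ l, z = g t) ∨ ∃ s t, Seg l s t ∧ z ∈ m s t := by
  induction l with
  | nil => simp [glue, not_seg_nil]
  | cons s l ih =>
    cases l with
    | nil => simp [glue, not_seg_singleton]
    | cons t r =>
      rw [glue, List.mem_cons, List.mem_append, ih]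
      constructor
      · rintro (rfl | h | ⟨u, hu, rfl⟩ | ⟨u, v, h, hz⟩)
        · exact .inl ⟨s, by simp, rfl⟩
        · exact .inr ⟨s, t, seg_cons_cons.2 (.inl ⟨rfl, rfl⟩), h⟩
        · exact .inl ⟨u, List.mem_cons_of_mem _ hu, rfl⟩
        · exact .inr ⟨u, v, seg_cons_cons.2 (.inr h), hz⟩
      · rintro (⟨u, hu, rfl⟩ | ⟨u, v, h, hz⟩)
        · rcases List.mem_cons.1 hu with rfl | hu
          · exact .inl rfl
          · exact .inr (.inr (.inl ⟨u, hu, rfl⟩))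
        · rcases seg_cons_cons.1 h with ⟨rfl, rfl⟩ | h
          · exact .inr (.inl hz)
          · exact .inr (.inr (.inr ⟨u, v, h, hz⟩))

theorem seg_glue {l : List α} {p q : β} :
    Seg (glue g m l) p q ↔ ∃ s t, Seg l s t ∧ Seg (g s :: (m s t ++ [g t])) p q := by
  induction l with
  | nil => simp [glue, not_seg_nil]
  | cons s l ih =>
    cases l with
    | nil => simp [glue, not_seg_singleton]
    | cons t r =>
      obtain ⟨r', hr'⟩ := exists_glue_cons (g := g) (m := m) t r
      rw [glue, hr', ← List.cons_append, seg_append, ← hr', ih, List.cons_append]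
      constructor
      · rintro (h | ⟨u, v, h, hz⟩)
        · exact ⟨s, t, seg_cons_cons.2 (.inl ⟨rfl, rfl⟩), h⟩
        · exact ⟨u, v, seg_cons_cons.2 (.inr h), hz⟩
      · rintro ⟨u, v, h, hz⟩
        rcases seg_cons_cons.1 h with ⟨rfl, rfl⟩ | h
        · exact .inl hz
        · exact .inr ⟨u, v, h, hz⟩

theorem nodup_glue {l : List α} (hl : l.Nodup) (hg : ∀ s ∈ l, ∀ t ∈ l, g s = g t → s = t)
    (h1 : ∀ s t, Seg l s t → (m s t).Nodup) (h2 : ∀ s t u, Seg l s t → u ∈ l → g u ∉ m s t)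
    (h3 : ∀ s t s' t' z, Seg l s t → Seg l s' t' → z ∈ m s t → z ∈ m s' t' → s = s') :
    (glue g m l).Nodup := by
  induction l with
  | nil => simp [glue]
  | cons s l ih =>
    cases l with
    | nil => simp [glue]
    | cons t r =>
      have hc : ∀ {u v}, Seg (t :: r) u v → Seg (s :: t :: r) u v :=
        fun h => seg_cons_cons.2 (.inr h)
      have hs : Seg (s :: t :: r) s t := seg_cons_cons.2 (.inl ⟨rfl, rfl⟩)
      obtain ⟨hl1, hl2⟩ := List.nodup_cons.1 hl
      have hm : ∀ {u}, u ∈ t :: r → u ∈ s :: t :: r := List.mem_cons_of_mem _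
      rw [glue, List.nodup_cons, List.nodup_append]
      refine ⟨?_, h1 s t hs, ih hl2 (fun s hs t ht => hg s (hm hs) t (hm ht))
        (fun s t h => h1 s t (hc h)) (fun s t u h hu => h2 s t u (hc h) (hm hu))
        (fun s t s' t' z h h' => h3 s t s' t' z (hc h) (hc h')), ?_⟩
      · rw [List.mem_append, mem_glue]
        rintro (h | ⟨u, hu, h⟩ | ⟨u, v, h, hz⟩)
        · exact h2 s t s hs (by simp) h
        · exact hl1 (hg s (by simp) u (hm hu) h ▸ hu)
        · exact h2 u v s (hc h) (by simp) hz
      · rintro z hz _ hz' rfl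
        rcases mem_glue.1 hz' with ⟨u, hu, rfl⟩ | ⟨u, v, h, hz'⟩
        · exact h2 s t u hs (hm hu) hz
        · exact hl1 (h3 s t u v z hs (hc h) hz hz' ▸ h.left_mem)

theorem exists_useg_of_mem {l : List α} {a b z : α} (hl : Seg l a b) (hz : z ∈ l) :
    ∃ w, USeg l z w := by
  obtain ⟨s, t, rfl⟩ := List.append_of_mem hz
  cases t with
  | cons c t => exact ⟨c, .inl ⟨s, t, rfl⟩⟩
  | nil =>
    rcases List.eq_nil_or_concat s with rfl | ⟨s', c, rfl⟩
    · exact absurd hl not_seg_singleton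
    · exact ⟨c, .inr ⟨s', [], by simp⟩⟩

theorem SimpleLine.eq_of_mem {l : List ℂ} (h : SimpleLine l) {p q z : ℂ} (hz : z ∈ l)
    (hs : USeg l p q) (hzs : z ∈ segment ℝ p q) : z = p ∨ z = q := by
  have key : ∀ {p q}, Seg l p q → z ∈ segment ℝ p q → z = p ∨ z = q := by
    intro p q hs hzs
    obtain ⟨w, hw | hw⟩ := exists_useg_of_mem hs hz
    · rcases h.2 _ _ _ _ z hs hw hzs (left_mem_segment ℝ _ _) with h | h
      · exact .inl h.1.symm
      · exact h.1
    · rcases h.2 _ _ _ _ z hs hw hzs (right_mem_segment ℝ _ _) with h | h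
      · exact .inr h.2.symm
      · exact h.1
  rcases hs with hs | hs
  · exact key hs hzs
  · exact (key hs (segment_symm ℝ p q ▸ hzs)).symm

theorem SimpleLine.useg {l : List ℂ} (h : SimpleLine l) {p q p' q' z : ℂ} (hs : USeg l p q)
    (hs' : USeg l p' q') (hz : z ∈ segment ℝ p q) (hz' : z ∈ segment ℝ p' q') :
    (p = p' ∧ q = q') ∨ (p = q' ∧ q = p') ∨ ((z = p ∨ z = q) ∧ (z = p' ∨ z = q')) := by
  rcases hs with hs | hs <;> rcases hs' with hs' | hs'
  · have := h.2 _ _ _ _ z hs hs' hz hz'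
    tauto
  · have := h.2 _ _ _ _ z hs hs' hz (segment_symm ℝ p' q' ▸ hz')
    tauto
  · have := h.2 _ _ _ _ z hs hs' (segment_symm ℝ p q ▸ hz) hz'
    tauto
  · have := h.2 _ _ _ _ z hs hs' (segment_symm ℝ p q ▸ hz) (segment_symm ℝ p' q' ▸ hz')
    tauto

theorem OnLine.of_useg {l : List ℂ} {p q z : ℂ} (h : USeg l p q) (hz : z ∈ segment ℝ p q) :
    OnLine l z := by
  rcases h with h | h
  · exact .inr ⟨p, q, h, hz⟩
  · exact .inr ⟨q, p, h, segment_symm ℝ p q ▸ hz⟩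

theorem Seg.lt_of_pairwise {l : List ℝ} (hl : l.Pairwise (· < ·)) {s t : ℝ} (h : Seg l s t) :
    s < t := by
  obtain ⟨a, b, rfl⟩ := h
  exact (List.pairwise_cons.1 (List.pairwise_append.1 hl).2.1).1 t (by simp)

theorem Seg.notMem_Ioo_of_pairwise {l : List ℝ} (hl : l.Pairwise (· < ·)) {s t u : ℝ}
    (h : Seg l s t) (hu : u ∈ l) : u ∉ Set.Ioo s t := by
  obtain ⟨a, b, rfl⟩ := h
  rw [List.pairwise_append, List.pairwise_cons, List.pairwise_cons] at hl
  simp only [List.mem_append, List.mem_cons] at hu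
  rintro ⟨h1, h2⟩
  rcases hu with hu | rfl | rfl | hu
  · exact lt_asymm h1 (hl.2.2 u hu s (by simp))
  · exact lt_irrefl _ h1
  · exact lt_irrefl _ h2
  · exact lt_asymm h2 (hl.2.1.2.1 u hu)

theorem Seg.eq_of_mem_Ioo {l : List ℝ} (hl : l.Pairwise (· < ·)) {s t s' t' u : ℝ}
    (h : Seg l s t) (h' : Seg l s' t') (hu : u ∈ Set.Ioo s t) (hu' : u ∈ Set.Ioo s' t') :
    s = s' ∧ t = t' := by
  have h1 := h.notMem_Ioo_of_pairwise hl h'.left_mem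
  have h2 := h.notMem_Ioo_of_pairwise hl h'.right_mem
  have h3 := h'.notMem_Ioo_of_pairwise hl h.left_mem
  have h4 := h'.notMem_Ioo_of_pairwise hl h.right_mem
  simp only [Set.mem_Ioo, not_and, not_lt] at h1 h2 h3 h4 hu hu'
  constructor
  · refine le_antisymm ?_ ?_ <;> by_contra! hlt
    · linarith [h3 hlt]
    · linarith [h1 hlt]
  · refine le_antisymm ?_ ?_ <;> by_contra! hlt
    · linarith [h2 (by linarith)]
    · linarith [h4 (by linarith)]

end Glue

section Polygonal

theorem eq_or_mem_Ioo_of_mem {l : List ℝ} {t : ℝ} (hl : ∀ u ∈ l, u ∈ Set.Ioo (0 : ℝ) 1)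
    (ht : t ∈ (0 : ℝ) :: (l ++ [1])) : t = 0 ∨ t = 1 ∨ t ∈ Set.Ioo (0 : ℝ) 1 := by
  simp only [List.mem_cons, List.mem_append, List.not_mem_nil, or_false] at ht
  rcases ht with rfl | h | rfl
  · exact .inl rfl
  · exact .inr (.inr (hl t h))
  · exact .inr (.inl rfl)

/-- A drawing by arbitrary arcs with at most three crossings on each edge can be replaced by a
polygonal drawing with the same property. -/
theorem exists_plDrawing {V E : Type*} [Finite V] [Finite E] {ends : E → Sym2 V} {pos : V → ℂ}
    (hpos : Function.Injective pos) (g : E → ℝ → ℂ) (hg : ∀ e, Continuous (g e))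
    (hinj : ∀ e, Set.InjOn (g e) (Set.Icc 0 1))
    (hends : ∀ e, ∃ u v, ends e = s(u, v) ∧ g e 0 = pos u ∧ g e 1 = pos v)
    (hvert : ∀ e, ∀ t ∈ Set.Ioo (0 : ℝ) 1, ∀ w, g e t ≠ pos w)
    (hfin : ∀ e f, e ≠ f → (g e '' Set.Icc 0 1 ∩ g f '' Set.Icc 0 1).Finite)
    (htriple : ∀ e f h, e ≠ f → e ≠ h → f ≠ h → ∀ t ∈ Set.Ioo (0 : ℝ) 1, ∀ t' ∈ Set.Ioo (0 : ℝ) 1,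
      ∀ t'' ∈ Set.Ioo (0 : ℝ) 1, g e t = g f t' → g f t' = g h t'' → False)
    (h3 : ∀ e, {z | ∃ t ∈ Set.Ioo (0 : ℝ) 1, g e t = z ∧ ∃ f, e ≠ f ∧
      ∃ t' ∈ Set.Ioo (0 : ℝ) 1, g f t' = z}.ncard ≤ 3) :
    ∃ D : PLDrawing ends, D.Plane3 := by
  classical
  have hPfin : (Set.range pos ∪ ⋃ e, ⋃ f, ⋃ _ : e ≠ f,
      (g e '' Set.Icc 0 1 ∩ g f '' Set.Icc 0 1)).Finite :=
    (Set.finite_range pos).union (Set.finite_iUnion fun e => Set.finite_iUnion fun f =>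
      Set.finite_iUnion fun h => hfin e f h)
  obtain ⟨P, hP⟩ : ∃ P : Finset ℂ, ∀ z, z ∈ P ↔ (z ∈ Set.range pos ∨
      ∃ e f, e ≠ f ∧ z ∈ g e '' Set.Icc 0 1 ∧ z ∈ g f '' Set.Icc 0 1) :=
    ⟨hPfin.toFinset, fun z => by
      simp only [Set.Finite.mem_toFinset, Set.mem_union, Set.mem_iUnion, Set.mem_inter_iff,
        exists_prop]⟩
  have hposP : ∀ w, pos w ∈ P := fun w => (hP _).2 (.inl ⟨w, rfl⟩)
  have hTfin : ∀ e, {t | t ∈ Set.Ioo (0 : ℝ) 1 ∧ g e t ∈ P}.Finite := by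
    intro e
    refine Set.Finite.of_finite_image (f := g e) (P.finite_toSet.subset ?_) ?_
    · rintro _ ⟨t, ht, rfl⟩
      exact ht.2
    · intro t ht u hu
      exact hinj e ⟨ht.1.1.le, ht.1.2.le⟩ ⟨hu.1.1.le, hu.1.2.le⟩
  set l : E → List ℝ := fun e => 0 :: ((hTfin e).toFinset.sort (· ≤ ·) ++ [1]) with hl
  have hTmem : ∀ e t, t ∈ (hTfin e).toFinset.sort (· ≤ ·) ↔ t ∈ Set.Ioo (0 : ℝ) 1 ∧ g e t ∈ P := by
    intro e t
    simp
  have hlmem : ∀ e t, t ∈ l e → t = 0 ∨ t = 1 ∨ t ∈ Set.Ioo (0 : ℝ) 1 := fun e t ht =>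
    eq_or_mem_Ioo_of_mem (fun u hu => ((hTmem e u).1 hu).1) ht
  have hlIcc : ∀ e t, t ∈ l e → t ∈ Set.Icc (0 : ℝ) 1 := by
    intro e t ht
    rcases hlmem e t ht with rfl | rfl | h
    · simp
    · simp
    · exact ⟨h.1.le, h.2.le⟩
  have hlP : ∀ e t, t ∈ l e → g e t ∈ P := by
    intro e t ht
    obtain ⟨u, v, -, hu, hv⟩ := hends e
    simp only [hl, List.mem_cons, List.mem_append, List.not_mem_nil, or_false] at ht
    rcases ht with rfl | h | rfl
    · rw [hu]; exact hposP u
    · exact ((hTmem e t).1 h).2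
    · rw [hv]; exact hposP v
  have hPl : ∀ e, ∀ t ∈ Set.Ioo (0 : ℝ) 1, g e t ∈ P → t ∈ l e := by
    intro e t ht h
    exact List.mem_cons_of_mem _ (List.mem_append_left _ ((hTmem e t).2 ⟨ht, h⟩))
  have hlt : ∀ e, (l e).Pairwise (· < ·) := by
    intro e
    refine List.pairwise_cons.2 ⟨fun t ht => ?_, List.pairwise_append.2 ⟨?_, by simp, ?_⟩⟩
    · simp only [List.mem_append, List.mem_cons, List.not_mem_nil, or_false] at ht
      rcases ht with h | rfl
      · exact ((hTmem e t).1 h).1.1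
      · exact one_pos
    · exact (Finset.sortedLT_sort _).pairwise
    · intro t ht u hu
      rw [List.mem_singleton.1 hu]
      exact ((hTmem e t).1 ht).1.2
  have hlnd : ∀ e, (l e).Nodup := fun e => (hlt e).imp fun h => h.ne
  have hgl : ∀ e, ∀ s ∈ l e, ∀ t ∈ l e, g e s = g e t → s = t := fun e s hs t ht h =>
    hinj e (hlIcc e s hs) (hlIcc e t ht) h
  have hKfin : {k : E × ℝ × ℝ | Seg (l k.1) k.2.1 k.2.2}.Finite := by
    refine (Set.finite_iUnion fun e : E => (Set.finite_singleton e).prod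
      (((l e).toFinset.finite_toSet).prod ((l e).toFinset.finite_toSet))).subset ?_
    rintro ⟨e, s, t⟩ h
    rw [Set.mem_iUnion]
    exact ⟨e, rfl, by simpa using Seg.left_mem h, by simpa using Seg.right_mem h⟩
  have := hKfin.to_subtype
  have hIoo : ∀ e s t, Seg (l e) s t → ∀ u ∈ Set.Ioo s t, u ∈ Set.Ioo (0 : ℝ) 1 := fun e s t h u hu =>
    ⟨(hlIcc e s h.left_mem).1.trans_lt hu.1, hu.2.trans_le (hlIcc e t h.right_mem).2⟩
  have hseg : ∀ e s t, Seg (l e) s t → ∀ u ∈ Set.Ioo s t, g e u ∉ P := fun e s t h u hu hu' =>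
    h.notMem_Ioo_of_pairwise (hlt e) (hPl e u (hIoo e s t h u hu) hu') hu
  obtain ⟨mid, hm1, hm2, hm3⟩ := exists_polylines (K := {k : E × ℝ × ℝ | Seg (l k.1) k.2.1 k.2.2}) P
    (fun k => g k.1.1) (fun k => hg _) (fun k => k.1.2.1) (fun k => k.1.2.2)
    (fun k => Seg.lt_of_pairwise (hlt _) k.2) (fun k => hlP _ _ (Seg.left_mem k.2))
    (fun k => hlP _ _ (Seg.right_mem k.2))
    (fun k h => (Seg.lt_of_pairwise (hlt _) k.2).ne
      (hgl _ _ (Seg.left_mem k.2) _ (Seg.right_mem k.2) h))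
    (fun k u hu => hseg _ _ _ k.2 u hu)
    (by
      rintro ⟨⟨e, s, t⟩, h⟩ ⟨⟨f, s', t'⟩, h'⟩ hne u hu v hv huv
      have hu0 := hIoo e s t h u hu
      have hv0 := hIoo f s' t' h' v hv
      by_cases hef : e = f
      · subst hef
        have := hinj e ⟨hu0.1.le, hu0.2.le⟩ ⟨hv0.1.le, hv0.2.le⟩ huv
        subst this
        obtain ⟨h1, h2⟩ := Seg.eq_of_mem_Ioo (hlt e) h h' hu hv
        simp only at h1 h2
        subst h1 h2
        exact hne rfl
      · exact hseg e s t h u hu ((hP _).2 (.inr ⟨e, f, hef, ⟨u, ⟨hu0.1.le, hu0.2.le⟩, rfl⟩,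
          v, ⟨hv0.1.le, hv0.2.le⟩, huv.symm⟩)))
  set m : E → ℝ → ℝ → List ℂ := fun e s t =>
    if h : Seg (l e) s t then mid ⟨(e, s, t), h⟩ else [] with hm
  have hmk : ∀ e s t (h : Seg (l e) s t), m e s t = mid ⟨(e, s, t), h⟩ := fun e s t h => dif_pos h
  have hsimple : ∀ e s t, Seg (l e) s t → SimpleLine (g e s :: (m e s t ++ [g e t])) := by
    intro e s t h
    rw [hmk e s t h]
    exact hm1 ⟨(e, s, t), h⟩
  have hend : ∀ e s t, Seg (l e) s t → ∀ z, OnLine (g e s :: (m e s t ++ [g e t])) z → z ∈ P →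
      z = g e s ∨ z = g e t := by
    intro e s t h
    rw [hmk e s t h]
    exact hm2 ⟨(e, s, t), h⟩
  have hcommon : ∀ e s t f s' t', Seg (l e) s t → Seg (l f) s' t' → (e, s, t) ≠ (f, s', t') →
      ∀ z, OnLine (g e s :: (m e s t ++ [g e t])) z →
      OnLine (g f s' :: (m f s' t' ++ [g f t'])) z → z ∈ P := by
    intro e s t f s' t' h h' hne z
    rw [hmk e s t h, hmk f s' t' h']
    exact hm3 ⟨(e, s, t), h⟩ ⟨(f, s', t'), h'⟩ z fun h => hne (congrArg Subtype.val h)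
  have hmP : ∀ e s t, Seg (l e) s t → ∀ z ∈ m e s t, z ∉ P := by
    intro e s t h z hz hzP
    have hnd := (hsimple e s t h).1
    rw [List.nodup_cons, List.nodup_append] at hnd
    rcases hend e s t h z (.inl (by simp [hz])) hzP with rfl | rfl
    · exact hnd.1 (by simp [hz])
    · exact hnd.2.2.2 _ hz _ (by simp) rfl
  set L : E → List ℂ := fun e => glue (g e) (m e) (l e) with hL
  have hLuseg : ∀ e p q, USeg (L e) p q → ∃ s t, Seg (l e) s t ∧
      USeg (g e s :: (m e s t ++ [g e t])) p q := by
    rintro e p q (h | h) <;> obtain ⟨s, t, h1, h2⟩ := seg_glue.1 h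
    · exact ⟨s, t, h1, .inl h2⟩
    · exact ⟨s, t, h1, .inr h2⟩
  have hLseg : ∀ e, ∃ p q, Seg (L e) p q := by
    intro e
    obtain ⟨b, r, hr⟩ := List.exists_cons_of_ne_nil
      (l := (hTfin e).toFinset.sort (· ≤ ·) ++ [1]) (by simp)
    obtain ⟨c, r', hr'⟩ := List.exists_cons_of_ne_nil (l := m e 0 b ++ [g e b]) (by simp)
    refine ⟨g e 0, c, seg_glue.2 ⟨0, b, ⟨[], r, by rw [← hr]; rfl⟩, [], r', by rw [hr']; rfl⟩⟩
  have hLonLine : ∀ e z, z ∈ L e → ∃ s t, Seg (l e) s t ∧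
      OnLine (g e s :: (m e s t ++ [g e t])) z := by
    intro e z hz
    obtain ⟨p, q, h⟩ := hLseg e
    obtain ⟨w, hw⟩ := exists_useg_of_mem h hz
    obtain ⟨s, t, h1, h2⟩ := hLuseg e z w hw
    exact ⟨s, t, h1, .inl h2.left_mem⟩
  have hLP : ∀ e z, z ∈ L e → z ∈ P → ∃ t ∈ l e, g e t = z := by
    intro e z hz hzP
    rcases mem_glue.1 hz with ⟨t, ht, rfl⟩ | ⟨s, t, h, hz⟩
    · exact ⟨t, ht, rfl⟩
    · exact absurd hzP (hmP e s t h z hz)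
  have hLIoo : ∀ e z, z ∈ L e → z ∈ P → z ∉ Set.range pos → ∃ t ∈ Set.Ioo (0 : ℝ) 1, g e t = z := by
    intro e z hz hzP hzV
    obtain ⟨t, ht, rfl⟩ := hLP e z hz hzP
    obtain ⟨u, v, -, hu, hv⟩ := hends e
    rcases hlmem e t ht with rfl | rfl | h
    · exact absurd ⟨u, hu.symm⟩ hzV
    · exact absurd ⟨v, hv.symm⟩ hzV
    · exact ⟨t, h, rfl⟩
  have hLL : ∀ e f z, e ≠ f → z ∈ L e → z ∈ L f → z ∈ P := by
    intro e f z hef he hf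
    obtain ⟨s, t, h1, h2⟩ := hLonLine e z he
    obtain ⟨s', t', h3, h4⟩ := hLonLine f z hf
    exact hcommon e s t f s' t' h1 h3 (fun h => hef (congrArg Prod.fst h)) z h2 h4
  have hbend : ∀ e s t p q z, Seg (l e) s t → USeg (g e s :: (m e s t ++ [g e t])) p q →
      z ∈ segment ℝ p q → z ∈ P → z = p ∨ z = q := by
    intro e s t p q z h h1 h2 hz
    refine (hsimple e s t h).eq_of_mem ?_ h1 h2
    rcases hend e s t h z (.of_useg h1 h2) hz with rfl | rfl <;> simp
  have hLnd : ∀ e, (L e).Nodup := by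
    intro e
    refine nodup_glue (hlnd e) (hgl e) (fun s t h => ?_)
      (fun s t u h hu hu' => hmP e s t h _ hu' (hlP e u hu)) (fun s t s' t' z h h' hz hz' => ?_)
    · have hnd := (hsimple e s t h).1
      rw [List.nodup_cons, List.nodup_append] at hnd
      exact hnd.2.1
    · by_contra hss
      exact hmP e s t h z hz (hcommon e s t e s' t' h h' (fun h => hss (by simp at h; exact h.1)) z
        (.inl (by simp [hz])) (.inl (by simp [hz'])))
  refine ⟨⟨pos, hpos, L, fun e => ?_, hLnd, ?_, ?_, ?_, ?_⟩, ?_⟩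
  · obtain ⟨u, v, huv, hu, hv⟩ := hends e
    obtain ⟨l', hl'⟩ := exists_glue_cons_concat (g := g e) (m := m e) 0 1
      ((hTfin e).toFinset.sort (· ≤ ·))
    have hLe : L e = pos u :: (l' ++ [pos v]) := by rw [← hu, ← hv, ← hl']
    refine ⟨u, v, l', huv, hLe, fun w hw => ?_⟩
    have hnd := hLnd e
    obtain ⟨t, ht, htw⟩ := hLP e (pos w) (by rw [hLe]; simp [hw]) (hposP w)
    rw [hLe, List.nodup_cons, List.nodup_append] at hnd
    rcases hlmem e t ht with rfl | rfl | h
    · rw [← htw, hu] at hw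
      exact hnd.1 (by simp [hw])
    · rw [← htw, hv] at hw
      exact hnd.2.2.2 _ hw _ (by simp) rfl
    · exact hvert e t h w htw
  · intro e f p q p' q' z h h' hz hz'
    obtain ⟨s, t, h1, h2⟩ := hLuseg e p q h
    obtain ⟨s', t', h1', h2'⟩ := hLuseg f p' q' h'
    by_cases heq : (e, s, t) = (f, s', t')
    · simp only [Prod.mk.injEq] at heq
      obtain ⟨rfl, rfl, rfl⟩ := heq
      exact (hsimple e s t h1).useg h2 h2' hz hz'
    · have hzP := hcommon e s t f s' t' h1 h1' heq z (.of_useg h2 hz) (.of_useg h2' hz')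
      exact .inr (.inr ⟨hbend e s t p q z h1 h2 hz hzP, hbend f s' t' p' q' z h1' h2' hz' hzP⟩)
  · intro e f p q h h'
    by_contra hef
    obtain ⟨s, t, h1, h2⟩ := hLuseg e p q h
    obtain ⟨s', t', h1', h2'⟩ := hLuseg f p q h'
    have hz : midpoint ℝ p q ∈ segment ℝ p q := midpoint_mem_segment p q
    have hzP := hcommon e s t f s' t' h1 h1' (fun h => hef (congrArg Prod.fst h)) _
      (.of_useg h2 hz) (.of_useg h2' hz)
    have hne := h.ne (hLnd e)
    rcases hbend e s t p q _ h1 h2 hz hzP with h | h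
    · exact hne ((midpoint_eq_left_iff ℝ).1 h)
    · exact hne ((midpoint_eq_right_iff ℝ).1 h)
  · intro e p q w h hw
    obtain ⟨s, t, h1, h2⟩ := hLuseg e p q h
    exact hbend e s t p q _ h1 h2 hw (hposP w)
  · intro e f h z hz he hf hh
    by_contra! hne
    have hzP := hLL e f z hne.1 he hf
    obtain ⟨t, ht, rfl⟩ := hLIoo e z he hzP hz
    obtain ⟨t', ht', h1⟩ := hLIoo f _ hf hzP hz
    obtain ⟨t'', ht'', h2⟩ := hLIoo h _ hh hzP hz
    exact htriple e f h hne.1 hne.2.1 hne.2.2 t ht t' ht' t'' ht'' h1.symm (h1.trans h2.symm)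
  · intro e
    rw [List.countP_eq_length_filter]
    refine le_trans ?_ (h3 e)
    rw [← List.toFinset_card_of_nodup ((hLnd e).filter _), ← Set.ncard_coe_finset]
    refine Set.ncard_le_ncard ?_ (P.finite_toSet.subset ?_)
    · intro z hz
      simp only [List.coe_toFinset, Set.mem_ofPred_eq, List.mem_filter, decide_eq_true_eq] at hz
      obtain ⟨hze, hzV, f₁, f₂, hne, hz1, hz2⟩ := hz
      obtain ⟨f, hef, hzf⟩ : ∃ f, e ≠ f ∧ z ∈ L f := by
        by_cases h : e = f₁
        · exact ⟨f₂, h ▸ hne, hz2⟩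
        · exact ⟨f₁, h, hz1⟩
      have hzP := hLL e f z hef hze hzf
      obtain ⟨t, ht, h1⟩ := hLIoo e z hze hzP hzV
      exact ⟨t, ht, h1, f, hef, hLIoo f z hzf hzP hzV⟩
    · rintro z ⟨t, ht, h1, f, hef, t', ht', h2⟩
      exact (hP z).2 (.inr ⟨e, f, hef, ⟨t, ⟨ht.1.le, ht.2.le⟩, h1⟩, t', ⟨ht'.1.le, ht'.2.le⟩, h2⟩)

end Polygonal

section OfPlane

theorem PlaneDrawing.exists_plDrawing {V : Type*} [Finite V] {G : SimpleGraph V}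
    (D : PlaneDrawing G) (hD : D.IsKPlane 3) :
    ∃ D' : PLDrawing (Subtype.val : G.edgeSet → Sym2 V), D'.Plane3 := by
  have hrep : ∀ e : G.edgeSet, ∃ u v, ∃ _ : G.Adj u v, e.1 = s(u, v) := by
    rintro ⟨e, he⟩
    induction e using Sym2.ind with
    | _ u v => exact ⟨u, v, he, rfl⟩
  choose a b hab hrep using hrep
  let ψ := Complex.equivRealProdCLM.symm.toHomeomorph
  have hψ : Function.Injective ψ := ψ.injective
  have hne : ∀ {e f : G.edgeSet}, e ≠ f → s(a e, b e) ≠ s(a f, b f) := by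
    intro e f h h'
    rw [← hrep, ← hrep] at h'
    exact h (Subtype.ext h')
  have hIcc : ∀ {t : ℝ}, t ∈ Set.Ioo (0 : ℝ) 1 → t ∈ Set.Icc (0 : ℝ) 1 := fun h => ⟨h.1.le, h.2.le⟩
  have h0 : ∀ {t : ℝ} (h : t ∈ Set.Ioo (0 : ℝ) 1), (⟨t, hIcc h⟩ : I) ≠ 0 := fun h h' =>
    h.1.ne' (congrArg Subtype.val h')
  have h1 : ∀ {t : ℝ} (h : t ∈ Set.Ioo (0 : ℝ) 1), (⟨t, hIcc h⟩ : I) ≠ 1 := fun h h' =>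
    h.2.ne (congrArg Subtype.val h')
  have hext : ∀ (e : G.edgeSet) {t : ℝ} (h : t ∈ Set.Icc (0 : ℝ) 1),
      (D.arc (hab e)).extend t = D.arc (hab e) ⟨t, h⟩ := fun e t h => Path.extend_apply _ h
  have h_interior : ∀ (e : G.edgeSet) {t : ℝ}, t ∈ Set.Ioo (0 : ℝ) 1 →
      D.IsInteriorPoint (hab e) ((D.arc (hab e)).extend t) := fun e t ht =>
    ⟨⟨t, hIcc ht⟩, h0 ht, h1 ht, (hext e (hIcc ht)).symm⟩
  refine _root_.exists_plDrawing (pos := fun v => ψ (D.pos v)) (hψ.comp D.pos_inj)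
    (fun e t => ψ ((D.arc (hab e)).extend t)) (fun e => ψ.continuous.comp (Path.continuous_extend _))
    ?_ (fun e => ⟨a e, b e, hrep e, by simp, by simp⟩) ?_ ?_ ?_ ?_
  · intro e t ht u hu h
    have h := hψ h
    rw [hext e ht, hext e hu] at h
    exact congrArg Subtype.val (D.arc_inj (hab e) h)
  · intro e t ht w h
    have h := hψ h
    rw [hext e (hIcc ht)] at h
    rcases D.no_vertex_mem (hab e) w _ h with rfl | rfl
    · exact h0 ht (D.arc_inj (hab e) (h.trans (Path.source _).symm))
    · exact h1 ht (D.arc_inj (hab e) (h.trans (Path.target _).symm))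
  · intro e f hef
    refine ((D.finite_inter (hab e) (hab f) (hne hef)).image ψ).subset ?_
    rintro _ ⟨⟨t, ht, rfl⟩, ⟨u, hu, h⟩⟩
    have h := hψ h
    exact ⟨_, ⟨⟨⟨t, ht⟩, (hext e ht).symm⟩, ⟨u, hu⟩, by rw [← h, hext f hu]⟩, rfl⟩
  · intro e f h hef heh hfh t ht t' ht' t'' ht'' h2 h3
    have h2 := hψ h2
    have h3 := hψ h3
    rw [hext _ (hIcc ht), hext _ (hIcc ht')] at h2
    rw [hext _ (hIcc ht'), hext _ (hIcc ht'')] at h3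
    exact D.no_triple_point (hab e) (hab f) (hab h) (hne hef) (hne heh) (hne hfh) _ _ _
      (h0 ht) (h1 ht) (h0 ht') (h1 ht') (h0 ht'') (h1 ht'') h2 h3
  · intro e
    have hfin : (D.edgeCrossings (hab e)).Finite := by
      refine (Set.finite_iUnion fun x => Set.finite_iUnion fun y => Set.finite_iUnion
        fun h : G.Adj x y => Set.finite_iUnion fun h' : s(a e, b e) ≠ s(x, y) =>
          D.finite_inter (hab e) h h').subset ?_
      rintro p ⟨⟨t, -, -, ht⟩, x, y, h, h', ⟨u, -, -, hu⟩⟩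
      simp only [Set.mem_iUnion]
      exact ⟨x, y, h, h', ⟨t, ht⟩, ⟨u, hu⟩⟩
    refine le_trans ?_ (hD (hab e))
    rw [← Set.ncard_image_of_injective _ hψ]
    refine Set.ncard_le_ncard ?_ (hfin.image ψ)
    rintro z ⟨t, ht, rfl, f, hef, t', ht', h⟩
    have h := hψ h
    exact ⟨_, ⟨h_interior e ht, _, _, hab f, hne hef, h ▸ h_interior f ht'⟩, rfl⟩

end OfPlane

theorem stmt_3 {V : Type} [Fintype V] (G : SimpleGraph V)
    (hG : KPlanar G 3) (hn : 2 ≤ Fintype.card V) :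
    (∃ D : PlaneDrawing G,
        (D.crossingCount : ℝ) ≤ (33 * Fintype.card V - 66) / 5) ∧
      (crossingNumber G : ℝ) ≤ (33 * Fintype.card V - 66) / 5 := by
  classical
  obtain ⟨D, hD⟩ := hG
  have hex : ∃ n, ∃ P : PLDrawing (Subtype.val : G.edgeSet → Sym2 V), P.Plane3 ∧ P.cr = n := by
    obtain ⟨P, hP⟩ := D.exists_plDrawing hD
    exact ⟨_, P, hP, rfl⟩
  obtain ⟨P, hP, hPn⟩ := Nat.find_spec hex
  have hmin : P.IsMin := ⟨hP, fun P' hP' => hPn.trans_le (Nat.find_min' hex ⟨P', hP', rfl⟩)⟩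
  have := Fintype.ofFinite G.edgeSet
  have hcr := hmin.cr_le Subtype.val_injective hn
  obtain ⟨D', hD'⟩ := P.exists_planeDrawing
  have hle : (D'.crossingCount : ℝ) ≤ (33 * Fintype.card V - 66) / 5 := by
    have h : 5 * D'.crossingCount + 66 ≤ 33 * Fintype.card V := by omega
    have h : (5 * D'.crossingCount + 66 : ℝ) ≤ 33 * Fintype.card V := by exact_mod_cast h
    linarith
  refine ⟨⟨D', hle⟩, le_trans ?_ hle⟩
  exact Nat.cast_le.2 (Nat.sInf_le ⟨D', rfl⟩)
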